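/- Let n ∈ ℕ, let C_n be the class of separable unital C*-algebras D with decomposition rank dr(D) ≤ n, let A be a separable unital C*-algebra which is a unital local C_n-algebra, and let α : G → Aut(A) be an action of a finite group G with the Rokhlin property. Then the fixed point algebra A^α satisfies dr(A^α) ≤ n. -/

import Mathlib

noncomputable section
set_option linter.unusedSectionVars false

open scoped ComplexOrder Matrix.Norms.L2Operator
open Filter Topology

/-- An element of a `*`-ring is *positive* (in the C*-algebraic sense) if it has the
form `star y * y`. -/
def IsPosElem {R : Type*} [Mul R] [Star R] (a : R) : Prop :=
  ∃ y : R, a = star y * y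

/-- A linear functional on a unital complex `*`-algebra is a *tracial state* if it is unital,
positive and tracial. -/
def IsTracialState {R : Type*} [Ring R] [StarRing R] [Module ℂ R] (τ : R →ₗ[ℂ] ℂ) : Prop :=
  τ 1 = 1 ∧ (∀ x : R, 0 ≤ τ (star x * x)) ∧ ∀ a b : R, τ (a * b) = τ (b * a)

/-- A linear map between complex `*`-algebras is *completely positive* if all of its matrix
amplifications map positive elements to positive elements. -/
def IsCompletelyPositive {A B : Type*} [Ring A] [StarRing A] [Module ℂ A]
    [Ring B] [StarRing B] [Module ℂ B] (φ : A →ₗ[ℂ] B) : Prop :=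
  ∀ (k : ℕ) (x : Matrix (Fin k) (Fin k) A), IsPosElem x → IsPosElem (x.map φ)

/-- A map has *order zero* on a subset if it preserves orthogonality there. -/
def OrderZeroOn {F D : Type*} [Mul F] [Zero F] [Mul D] [Zero D] (φ : F → D) (s : Set F) : Prop :=
  ∀ e ∈ s, ∀ f ∈ s, e * f = 0 → f * e = 0 → φ e * φ f = 0 ∧ φ f * φ e = 0

/-- The finite-dimensional C*-algebra `⊕_{i=1}^s M_{r i}(ℂ)`. -/
abbrev FDBlock (s : ℕ) (r : Fin s → ℕ) : Type :=
  ∀ i : Fin s, Matrix (Fin (r i)) (Fin (r i)) ℂ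

/-- The elements of `⊕_{i=1}^s M_{r i}(ℂ)` supported on the blocks with label `j`. -/
def blockSupp {s : ℕ} {r : Fin s → ℕ} {n : ℕ} (J : Fin s → Fin (n + 1)) (j : Fin (n + 1)) :
    Set (FDBlock s r) :=
  {x | ∀ i : Fin s, J i ≠ j → x i = 0}

/-- `DecompositionRankLE n D` : the C*-algebra `D` has decomposition rank at most `n`. -/
def DecompositionRankLE (n : ℕ) (D : Type*) [NormedRing D] [StarRing D]
    [NormedAlgebra ℂ D] : Prop :=
  ∀ (S : Finset D) (ε : ℝ), 0 < ε →
    ∃ (s : ℕ) (r : Fin s → ℕ) (J : Fin s → Fin (n + 1))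
      (ψ : D →ₗ[ℂ] FDBlock s r) (φ : FDBlock s r →ₗ[ℂ] D),
      IsCompletelyPositive ψ ∧ IsCompletelyPositive φ ∧
      (∀ a : D, ‖ψ a‖ ≤ ‖a‖) ∧ (∀ x : FDBlock s r, ‖φ x‖ ≤ ‖x‖) ∧
      (∀ j : Fin (n + 1), OrderZeroOn φ (blockSupp J j)) ∧
      ∀ a ∈ S, ‖φ (ψ a) - a‖ < ε

/-- `NuclearDimensionLE n D` : the C*-algebra `D` has nuclear dimension at most `n`. -/
def NuclearDimensionLE (n : ℕ) (D : Type*) [NormedRing D] [StarRing D]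
    [NormedAlgebra ℂ D] : Prop :=
  ∀ (S : Finset D) (ε : ℝ), 0 < ε →
    ∃ (s : ℕ) (r : Fin s → ℕ) (J : Fin s → Fin (n + 1))
      (ψ : D →ₗ[ℂ] FDBlock s r) (φ : FDBlock s r →ₗ[ℂ] D),
      IsCompletelyPositive ψ ∧ IsCompletelyPositive φ ∧
      (∀ a : D, ‖ψ a‖ ≤ ‖a‖) ∧
      (∀ j : Fin (n + 1), (∀ x ∈ blockSupp J j, ‖φ x‖ ≤ ‖x‖) ∧
        OrderZeroOn φ (blockSupp J j)) ∧
      ∀ a ∈ S, ‖φ (ψ a) - a‖ < ε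

/-- A bundled unital C*-algebra. -/
structure CStarAlg : Type 1 where
  carrier : Type
  [str : CStarAlgebra carrier]

attribute [instance] CStarAlg.str

/-- The *finite saturation* of a class `𝒞` of unital C*-algebras: the smallest class
containing `𝒞` which is closed under isomorphism, finite direct sums, matrix amplifications
and corners by nonzero projections. -/
inductive FinSat (𝒞 : CStarAlg → Prop) : CStarAlg → Prop
  | base {B : CStarAlg} : 𝒞 B → FinSat 𝒞 B
  | iso {B B' : CStarAlg} : FinSat 𝒞 B → Nonempty (B'.carrier ≃⋆ₐ[ℂ] B.carrier) →
      FinSat 𝒞 B'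
  | sum {B₁ B₂ B : CStarAlg} : FinSat 𝒞 B₁ → FinSat 𝒞 B₂ →
      Nonempty (B.carrier ≃⋆ₐ[ℂ] (B₁.carrier × B₂.carrier)) → FinSat 𝒞 B
  | matrix {B B' : CStarAlg} (k : ℕ) : FinSat 𝒞 B →
      Nonempty (B'.carrier ≃⋆ₐ[ℂ] Matrix (Fin (k + 1)) (Fin (k + 1)) B.carrier) →
      FinSat 𝒞 B'
  | corner {B B' : CStarAlg} (p : B.carrier) : FinSat 𝒞 B → p ≠ 0 → p * p = p →
      star p = p →
      (∃ ι : B'.carrier →⋆ₙₐ[ℂ] B.carrier, Function.Injective ι ∧ ι 1 = p ∧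
        Set.range ι = {x : B.carrier | p * x * p = x}) →
      FinSat 𝒞 B'

/-- `A` is a *unital local `𝒞`-algebra*. -/
def IsUnitalLocalAlg (𝒞 : CStarAlg → Prop) (A : Type*) [NormedRing A] [StarRing A]
    [NormedAlgebra ℂ A] : Prop :=
  ∀ (S : Finset A) (ε : ℝ), 0 < ε →
    ∃ B : CStarAlg, FinSat 𝒞 B ∧
      ∃ φ : B.carrier →⋆ₐ[ℂ] A, ∀ a ∈ S, ∃ b : B.carrier, ‖a - φ b‖ < ε

/-- The class of separable unital C*-algebras with decomposition rank at most `n`. -/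
def drClass (n : ℕ) : CStarAlg → Prop :=
  fun B => TopologicalSpace.SeparableSpace B.carrier ∧ DecompositionRankLE n B.carrier

/-- The class of separable unital C*-algebras with nuclear dimension at most `n`. -/
def nucClass (n : ℕ) : CStarAlg → Prop :=
  fun B => TopologicalSpace.SeparableSpace B.carrier ∧ NuclearDimensionLE n B.carrier

/-- The class of separable unital C*-algebras with finite nuclear dimension. -/
def lnucClass : CStarAlg → Prop :=
  fun B => TopologicalSpace.SeparableSpace B.carrier ∧ ∃ n : ℕ, NuclearDimensionLE n B.carrier

/-- A separable unital C*-algebra has *locally finite nuclear dimension* if it is a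
unital local `C_lnuc`-algebra. -/
def HasLocallyFiniteNuclearDimension (A : Type*) [NormedRing A] [StarRing A]
    [NormedAlgebra ℂ A] : Prop :=
  IsUnitalLocalAlg lnucClass A
/-! ### Group actions and the Rokhlin property -/

/-- `α : G → (A →⋆ₐ[ℂ] A)` is an action of the group `G` on `A` by *-automorphisms. -/
def IsGroupAction {G A : Type*} [Group G] [CStarAlgebra A] (α : G → (A →⋆ₐ[ℂ] A)) : Prop :=
  (∀ a : A, α 1 a = a) ∧ ∀ (g h : G) (a : A), α g (α h a) = α (g * h) a

/-- The fixed point algebra `A^α` of an action, as a star subalgebra of `A`. -/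
def fixedPointAlgebra {G A : Type*} [Group G] [CStarAlgebra A] (α : G → (A →⋆ₐ[ℂ] A)) :
    StarSubalgebra ℂ A where
  carrier := {a : A | ∀ g : G, α g a = a}
  mul_mem' := fun {a} {b} ha hb g => by rw [map_mul, ha g, hb g]
  add_mem' := fun {a} {b} ha hb g => by rw [map_add, ha g, hb g]
  algebraMap_mem' := fun c g => by rw [AlgHomClass.commutes]
  star_mem' := fun {a} ha g => by rw [map_star, ha g]

/-- The Rokhlin property for a finite group action, expressed in terms of representing
sequences for projections in `A_∞ = (ℓ^∞(ℕ,A)/c₀(ℕ,A)) ∩ A'`. -/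
def ActionHasRokhlin {G A : Type*} [Group G] [Fintype G] [CStarAlgebra A]
    (α : G → (A →⋆ₐ[ℂ] A)) : Prop :=
  ∃ e : G → ℕ → A,
    (∀ g, ∃ M : ℝ, ∀ k, ‖e g k‖ ≤ M) ∧
    (∀ g, Tendsto (fun k => ‖e g k * e g k - e g k‖) atTop (𝓝 0)) ∧
    (∀ g, Tendsto (fun k => ‖star (e g k) - e g k‖) atTop (𝓝 0)) ∧
    (∀ g (a : A), Tendsto (fun k => ‖e g k * a - a * e g k‖) atTop (𝓝 0)) ∧
    Tendsto (fun k => ‖(∑ g : G, e g k) - 1‖) atTop (𝓝 0) ∧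
    (∀ g h, Tendsto (fun k => ‖α g (e h k) - e (g * h) k‖) atTop (𝓝 0))

/-! ### Inclusions of unital C*-algebras, conditional expectations, Watatani index -/

variable {P A : Type*}

/-- `E : A →ₗ[ℂ] P` is a conditional expectation onto the subalgebra `P` (included in `A`
via the injective unital *-homomorphism `ι`). -/
structure IsCondExpect [CStarAlgebra P] [CStarAlgebra A] (ι : P →⋆ₐ[ℂ] A)
    (E : A →ₗ[ℂ] P) : Prop where
  restricts : ∀ p : P, E (ι p) = p
  pos : ∀ x : A, IsPosElem (E (star x * x))
  bimodule : ∀ (p q : P) (x : A), E (ι p * x * ι q) = p * E x * q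

/-- `{(u i, v i)}` is a quasi-basis for the conditional expectation `E`; the existence of a
quasi-basis says precisely that `E` is of index-finite type. -/
def IsQuasiBasis [CStarAlgebra P] [CStarAlgebra A] (ι : P →⋆ₐ[ℂ] A) (E : A →ₗ[ℂ] P)
    {m : ℕ} (u v : Fin m → A) : Prop :=
  ∀ a : A, (a = ∑ i, u i * ι (E (v i * a))) ∧ (a = ∑ i, ι (E (a * u i)) * v i)

/-- The Rokhlin property for a conditional expectation of index-finite type with index
`ind = ∑ u i * v i` : there is a projection `e` in `A_∞ = (ℓ^∞(ℕ,A)/c₀(ℕ,A)) ∩ A'`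
(given by a representing sequence) with `E^∞(e) = (Index E)⁻¹ · 1` such that `x ↦ x e`
is injective on `A`. -/
def CondExpectHasRokhlin [CStarAlgebra P] [CStarAlgebra A] (ι : P →⋆ₐ[ℂ] A)
    (E : A →ₗ[ℂ] P) (ind : A) : Prop :=
  ∃ e : ℕ → A,
    (∃ M : ℝ, ∀ k, ‖e k‖ ≤ M) ∧
    Tendsto (fun k => ‖e k * e k - e k‖) atTop (𝓝 0) ∧
    Tendsto (fun k => ‖star (e k) - e k‖) atTop (𝓝 0) ∧
    (∀ a : A, Tendsto (fun k => ‖e k * a - a * e k‖) atTop (𝓝 0)) ∧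
    (∃ w : A, w * ind = 1 ∧ ind * w = 1 ∧
      Tendsto (fun k => ‖ι (E (e k)) - w‖) atTop (𝓝 0)) ∧
    (∀ x : A, Tendsto (fun k => ‖x * e k‖) atTop (𝓝 0) → x = 0)

/-! ### Cuntz comparison, dimension functions, strict comparison, almost divisibility -/

/-- Cuntz subequivalence for positive matrices over a C*-algebra (the topology on matrices
over a C*-algebra is the norm topology, which agrees with the product topology). -/
def CuntzSub {R : Type*} [NonUnitalNonAssocSemiring R] [Star R] [TopologicalSpace R]
    {m k : Type*} [Fintype m] [Fintype k] (a : Matrix m m R) (b : Matrix k k R) : Prop :=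
  ∃ v : ℕ → Matrix m k R, Tendsto (fun j => v j * b * (v j).conjTranspose) atTop (𝓝 a)

/-- `matNthRoot a j` is the (unique, if it exists) positive `j`-th root `a^{1/j}` of a
positive matrix `a` over a C*-algebra. -/
def matNthRoot {R : Type*} [Ring R] [StarRing R] {m : Type*} [Fintype m] [DecidableEq m]
    (a : Matrix m m R) (j : ℕ) : Matrix m m R :=
  open scoped Classical in
  if h : ∃ b : Matrix m m R, IsPosElem b ∧ b ^ j = a then h.choose else 0

/-- The standard extension `τ ⊗ Tr` of a functional `τ` to matrices. -/
def traceExt {R : Type*} [Ring R] [Module ℂ R] {m : Type*} [Fintype m]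
    (τ : R →ₗ[ℂ] ℂ) (x : Matrix m m R) : ℂ :=
  ∑ i, τ (x i i)

/-- The dimension function `d_τ(a) = lim_{n → ∞} τ(a^{1/n})` associated to a tracial
state `τ` (the limit exists, so it agrees with the `limsup` used here). -/
def dimFun {R : Type*} [Ring R] [StarRing R] [Module ℂ R] {m : Type*} [Fintype m]
    [DecidableEq m] (τ : R →ₗ[ℂ] ℂ) (a : Matrix m m R) : ℝ :=
  Filter.limsup (fun j : ℕ => (traceExt τ (matNthRoot a (j + 1))).re) atTop

/-- A unital C*-algebra `R` has *strict comparison* (of positive elements, with respect to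
tracial states) if `d_τ(a) < d_τ(b)` for all tracial states `τ` implies `a ≾ b`. -/
def HasStrictComparison (R : Type*) [Ring R] [StarRing R] [Module ℂ R]
    [TopologicalSpace R] : Prop :=
  ∀ (m k : ℕ) (a : Matrix (Fin m) (Fin m) R) (b : Matrix (Fin k) (Fin k) R),
    IsPosElem a → IsPosElem b →
    (∀ τ : R →ₗ[ℂ] ℂ, IsTracialState τ → dimFun τ a < dimFun τ b) →
    CuntzSub a b

/-- The Cuntz semigroup `W(R)` is *almost divisible*: for every positive contraction `a`
over `R` and every `k ≠ 0` there is `x = ⟨c⟩ ∈ W(R)` with `k ⬝ x ≤ ⟨a⟩ ≤ (k+1) ⬝ x`. -/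
def AlmostDivisible (R : Type*) [Ring R] [StarRing R] [TopologicalSpace R] : Prop :=
  ∀ (m : ℕ) (a : Matrix (Fin m) (Fin m) R),
    IsPosElem a → IsPosElem ((1 : Matrix (Fin m) (Fin m) R) - a) →
    ∀ k : ℕ, k ≠ 0 →
      ∃ (l : ℕ) (c : Matrix (Fin l) (Fin l) R), IsPosElem c ∧
        CuntzSub (Matrix.blockDiagonal fun _ : Fin k => c) a ∧
        CuntzSub a (Matrix.blockDiagonal fun _ : Fin (k + 1) => c)

/-- A unital C*-algebra is *pure* if it has strict comparison and almost divisible Cuntz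
semigroup. -/
def IsPure (R : Type*) [Ring R] [StarRing R] [Module ℂ R] [TopologicalSpace R] : Prop :=
  HasStrictComparison R ∧ AlmostDivisible R

/-- The order on projections over `R` is determined by traces. -/
def ProjOrderDeterminedByTraces (R : Type*) [Ring R] [StarRing R] [Module ℂ R] : Prop :=
  ∀ (k l : ℕ) (p : Matrix (Fin k) (Fin k) R) (q : Matrix (Fin l) (Fin l) R),
    p * p = p → star p = p → q * q = q → star q = q →
    (∀ τ : R →ₗ[ℂ] ℂ, IsTracialState τ → (traceExt τ p).re < (traceExt τ q).re) →
    ∃ v : Matrix (Fin l) (Fin k) R,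
      v.conjTranspose * v = p ∧ IsPosElem (q - v * v.conjTranspose)

/-- A unital C*-algebra has stable rank one if its invertible elements are dense. -/
def HasStableRankOne (R : Type*) [Ring R] [TopologicalSpace R] : Prop :=
  Dense {x : R | IsUnit x}

/-- A unital C*-algebra is simple if it has no nontrivial closed two-sided ideals. -/
def IsSimpleCStarAlgebra (A : Type*) [CStarAlgebra A] : Prop :=
  ∀ I : TwoSidedIdeal A, IsClosed (I : Set A) → I = ⊥ ∨ I = ⊤
/-! ### Corners `pRp` by a projection `p` -/

section CornerSection

variable {R : Type*} [Ring R] [StarRing R] [Algebra ℂ R] [StarModule ℂ R]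

/-- The corner `p R p` of a unital C*-algebra `R` by a projection `p`, as a unital
`*`-algebra with unit `p`. -/
def Corner (p : R) (_hp : p * p = p) (_hsp : star p = p) : Type _ :=
  {x : R // p * x * p = x}

namespace Corner

variable {p : R} {hp : p * p = p} {hsp : star p = p}

theorem mem_mul_left (hp : p * p = p) {x : R} (hx : p * x * p = x) : p * x = x := by
  conv_lhs => rw [← hx]
  simp only [← mul_assoc]
  rw [hp, hx]

theorem mem_mul_right (hp : p * p = p) {x : R} (hx : p * x * p = x) : x * p = x := by
  conv_lhs => rw [← hx]
  rw [mul_assoc, mul_assoc, hp, ← mul_assoc, hx]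

instance : Add (Corner p hp hsp) :=
  ⟨fun x y => ⟨x.1 + y.1, by rw [mul_add, add_mul, x.2, y.2]⟩⟩

instance : Zero (Corner p hp hsp) :=
  ⟨⟨0, by rw [mul_zero, zero_mul]⟩⟩

instance : Neg (Corner p hp hsp) :=
  ⟨fun x => ⟨-x.1, by rw [mul_neg, neg_mul, x.2]⟩⟩

instance : Mul (Corner p hp hsp) :=
  ⟨fun x y => ⟨x.1 * y.1, by
    rw [← mul_assoc p x.1 y.1, mem_mul_left hp x.2, mul_assoc x.1 y.1 p,
      mem_mul_right hp y.2]⟩⟩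

instance : One (Corner p hp hsp) :=
  ⟨⟨p, by rw [hp, hp]⟩⟩

instance : SMul ℂ (Corner p hp hsp) :=
  ⟨fun c x => ⟨c • x.1, by rw [mul_smul_comm, smul_mul_assoc, x.2]⟩⟩

instance : Star (Corner p hp hsp) :=
  ⟨fun x => ⟨star x.1, by
    conv_rhs => rw [← x.2]
    rw [star_mul, star_mul, hsp, ← mul_assoc]⟩⟩

@[simp] theorem val_add (x y : Corner p hp hsp) : (x + y).1 = x.1 + y.1 := rfl
@[simp] theorem val_mul (x y : Corner p hp hsp) : (x * y).1 = x.1 * y.1 := rfl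
@[simp] theorem val_zero : (0 : Corner p hp hsp).1 = 0 := rfl
@[simp] theorem val_one : (1 : Corner p hp hsp).1 = p := rfl
@[simp] theorem val_neg (x : Corner p hp hsp) : (-x).1 = -x.1 := rfl
@[simp] theorem val_smul (c : ℂ) (x : Corner p hp hsp) : (c • x).1 = c • x.1 := rfl
@[simp] theorem val_star (x : Corner p hp hsp) : (star x).1 = star x.1 := rfl

instance instRing : Ring (Corner p hp hsp) where
  add_assoc x y z := Subtype.ext <| by simp [add_assoc]
  zero_add x := Subtype.ext <| by simp
  add_zero x := Subtype.ext <| by simp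
  add_comm x y := Subtype.ext <| by simp [add_comm]
  neg_add_cancel x := Subtype.ext <| by simp
  nsmul := nsmulRec
  zsmul := zsmulRec
  mul_assoc x y z := Subtype.ext <| by simp [mul_assoc]
  one_mul x := Subtype.ext <| by simpa using mem_mul_left hp x.2
  mul_one x := Subtype.ext <| by simpa using mem_mul_right hp x.2
  left_distrib x y z := Subtype.ext <| by simp [left_distrib]
  right_distrib x y z := Subtype.ext <| by simp [right_distrib]
  zero_mul x := Subtype.ext <| by simp
  mul_zero x := Subtype.ext <| by simp

instance instStarRing : StarRing (Corner p hp hsp) where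
  star_involutive x := Subtype.ext <| by simp
  star_mul x y := Subtype.ext <| by simp
  star_add x y := Subtype.ext <| by simp

instance instModule : Module ℂ (Corner p hp hsp) where
  one_smul x := Subtype.ext <| by simp
  mul_smul c d x := Subtype.ext <| by simp [mul_smul]
  smul_zero c := Subtype.ext <| by simp
  smul_add c x y := Subtype.ext <| by simp
  add_smul c d x := Subtype.ext <| by simp [add_smul]
  zero_smul x := Subtype.ext <| by simp

instance instTop [TopologicalSpace R] : TopologicalSpace (Corner p hp hsp) :=
  instTopologicalSpaceSubtype

end Corner

end CornerSection

/-! ### Sequence algebras: `A^∞ = ℓ^∞(ℕ, A)/c₀(ℕ, A)` via representing sequences -/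

/-- A sequence in a normed space is null (i.e. lies in `c₀(ℕ, A)`). -/
def IsNullSeq {A : Type*} [Norm A] (x : ℕ → A) : Prop :=
  Tendsto (fun n => ‖x n‖) atTop (𝓝 0)

/-- A sequence in a normed space is bounded (i.e. lies in `ℓ^∞(ℕ, A)`). -/
def IsBddSeq {A : Type*} [Norm A] (x : ℕ → A) : Prop :=
  ∃ M : ℝ, ∀ n, ‖x n‖ ≤ M

/-- A linear map `β : A →ₗ[ℂ] ℓ^∞(ℕ, P)` represents a unital *-homomorphism
`A → P^∞ = ℓ^∞(ℕ, P)/c₀(ℕ, P)` : it takes values in bounded sequences and is unital,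
multiplicative and star-preserving modulo `c₀(ℕ, P)`. -/
structure RepresentsHomToSeqAlg {A P : Type*} [CStarAlgebra A] [CStarAlgebra P]
    (β : A →ₗ[ℂ] (ℕ → P)) : Prop where
  bdd : ∀ x : A, IsBddSeq (β x)
  unital : IsNullSeq (β 1 - 1)
  mul : ∀ x y : A, IsNullSeq (β (x * y) - β x * β y)
  star : ∀ x : A, IsNullSeq (β (star x) - star (β x))

/-- A Banach limit: a linear functional on (bounded) complex sequences which is unital,
shift-invariant, positive and bounded. -/
structure IsBanachLimit (L : (ℕ → ℂ) →ₗ[ℂ] ℂ) : Prop where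
  unital : L 1 = 1
  shift : ∀ x : ℕ → ℂ, IsBddSeq x → L (fun n => x (n + 1)) = L x
  pos : ∀ x : ℕ → ℂ, IsBddSeq x → (∀ n, 0 ≤ x n) → 0 ≤ L x
  norm_le : ∀ (x : ℕ → ℂ) (M : ℝ), (∀ n, ‖x n‖ ≤ M) → ‖L x‖ ≤ M

/-- A C*-algebra is *exact* iff it is nuclearly embeddable (Kirchberg): it admits a faithful
representation `π : A → B(H)` which approximately factors through matrix algebras by
completely positive contractions in the point-norm topology. -/
def IsExactCStar (A : Type*) [CStarAlgebra A] : Prop :=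
  ∃ (H : Type) (_ : NormedAddCommGroup H) (_ : InnerProductSpace ℂ H) (_ : CompleteSpace H)
    (π : A →⋆ₐ[ℂ] (H →L[ℂ] H)), Function.Injective π ∧
      ∀ (S : Finset A) (ε : ℝ), 0 < ε →
        ∃ (k : ℕ) (ψ : A →ₗ[ℂ] Matrix (Fin k) (Fin k) ℂ)
          (φ : Matrix (Fin k) (Fin k) ℂ →ₗ[ℂ] (H →L[ℂ] H)),
          IsCompletelyPositive ψ ∧ IsCompletelyPositive φ ∧
          (∀ a : A, ‖ψ a‖ ≤ ‖a‖) ∧ (∀ x, ‖φ x‖ ≤ ‖x‖) ∧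
          ∀ a ∈ S, ‖φ (ψ a) - π a‖ < ε


/-! ### Row norms -/

section RowNorm
variable {ι D : Type*} [Fintype ι] [DecidableEq ι] [CStarAlgebra D]

def rn {ι D : Type*} [Fintype ι] [CStarAlgebra D] (y : ι → D) : ℝ := Real.sqrt ‖∑ c, y c * star (y c)‖

theorem rn_nonneg (y : ι → D) : 0 ≤ rn y := Real.sqrt_nonneg _

theorem rn_sq (y : ι → D) : rn y ^ 2 = ‖∑ c, y c * star (y c)‖ := Real.sq_sqrt (norm_nonneg _)

def rowM (y : ι → D) : CStarMatrix (Option ι) (Option ι) D :=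
  CStarMatrix.ofMatrix (fun a b => match a, b with
    | none, some c => y c
    | none, none => 0
    | some _, _ => 0)

@[simp] theorem rowM_ns (y : ι → D) (c : ι) : rowM y none (some c) = y c := rfl
@[simp] theorem rowM_nn (y : ι → D) : rowM y none none = 0 := rfl
@[simp] theorem rowM_s (y : ι → D) (c : ι) (b) : rowM y (some c) b = 0 := rfl

def cornMf (b : D) : CStarMatrix (Option ι) (Option ι) D :=
  CStarMatrix.ofMatrix (fun u v => match u, v with
    | none, none => b
    | none, some _ => 0
    | some _, _ => 0)

@[simp] theorem cornMf_nn (b : D) : cornMf (ι := ι) b none none = b := rfl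
@[simp] theorem cornMf_ns (b : D) (c : ι) : cornMf (ι := ι) b none (some c) = 0 := rfl
@[simp] theorem cornMf_s (b : D) (c : ι) (d) : cornMf (ι := ι) b (some c) d = 0 := rfl

def subMf (f : ι → ι → D) : CStarMatrix (Option ι) (Option ι) D :=
  CStarMatrix.ofMatrix (fun u v => match u, v with
    | some c, some d => f c d
    | none, _ => 0
    | some _, none => 0)

@[simp] theorem subMf_ss (f : ι → ι → D) (c d : ι) : subMf f (some c) (some d) = f c d := rfl
@[simp] theorem subMf_n (f : ι → ι → D) (d) : subMf f none d = 0 := rfl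
@[simp] theorem subMf_sn (f : ι → ι → D) (c : ι) : subMf f (some c) none = 0 := rfl

def cornM : D →⋆ₙₐ[ℂ] CStarMatrix (Option ι) (Option ι) D where
  toFun := cornMf
  map_smul' c b := by ext u v; cases u <;> cases v <;> simp
  map_zero' := by ext u v; cases u <;> cases v <;> simp
  map_add' b b' := by ext u v; cases u <;> cases v <;> simp
  map_mul' b b' := by
    ext u v; cases u <;> cases v <;> simp [CStarMatrix.mul_apply, Fintype.sum_option]
  map_star' b := by ext u v; cases u <;> cases v <;> simp [CStarMatrix.star_apply]

def scM : Matrix ι ι ℂ →⋆ₙₐ[ℂ] CStarMatrix (Option ι) (Option ι) D where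
  toFun X := subMf (fun c d => X c d • (1 : D))
  map_smul' c b := by ext u v; cases u <;> cases v <;> simp [mul_smul]
  map_zero' := by ext u v; cases u <;> cases v <;> simp
  map_add' b b' := by ext u v; cases u <;> cases v <;> simp [add_smul]
  map_mul' b b' := by
    ext u v
    cases u <;> cases v <;>
      simp [CStarMatrix.mul_apply, Fintype.sum_option, Matrix.mul_apply, Finset.sum_smul, smul_smul,
        mul_comm]
  map_star' b := by ext u v; cases u <;> cases v <;> simp [CStarMatrix.star_apply]

def dgM : (ι → D) →⋆ₙₐ[ℂ] CStarMatrix (Option ι) (Option ι) D where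
  toFun k := subMf (fun c d => if c = d then k c else 0)
  map_smul' c b := by ext u v; cases u <;> cases v <;> simp
  map_zero' := by ext u v; cases u <;> cases v <;> simp
  map_add' b b' := by
    ext u v; cases u <;> cases v <;> simp; split_ifs <;> simp
  map_mul' b b' := by
    ext u v
    cases u <;> cases v <;>
      simp [CStarMatrix.mul_apply, Fintype.sum_option]
    split_ifs with h
    · rw [h]
    · rfl
  map_star' b := by
    ext u v; cases u <;> cases v <;> simp [CStarMatrix.star_apply]
    rename_i c d
    by_cases h : c = d
    · subst h; simp
    · simp [h, Ne.symm h]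

theorem rowM_mul_star (y z : ι → D) :
    rowM y * star (rowM z) = cornM (∑ c, y c * star (z c)) := by
  change _ = cornMf _
  ext u v
  cases u <;> cases v <;> simp [CStarMatrix.mul_apply, Fintype.sum_option, CStarMatrix.star_apply]

theorem star_rowM_mul (y z : ι → D) :
    star (rowM y) * rowM z = subMf (fun c d => star (y c) * z d) := by
  ext u v
  cases u <;> cases v <;> simp [CStarMatrix.mul_apply, Fintype.sum_option, CStarMatrix.star_apply]

theorem rowM_add (y z : ι → D) : rowM (fun c => y c + z c) = rowM y + rowM z := by
  ext u v; cases u <;> cases v <;> simp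

theorem rowM_sub (y z : ι → D) : rowM (fun c => y c - z c) = rowM y - rowM z := by
  ext u v; cases u <;> cases v <;> simp

theorem rowM_mul_left (b : D) (y : ι → D) : rowM (fun c => b * y c) = cornM b * rowM y := by
  change _ = cornMf _ * _
  ext u v; cases u <;> cases v <;> simp [CStarMatrix.mul_apply, Fintype.sum_option]

theorem rowM_mul_sc (X : Matrix ι ι ℂ) (y : ι → D) :
    rowM (fun d => ∑ c, X c d • y c) = rowM y * scM X := by
  change _ = _ * subMf _
  ext u v; cases u <;> cases v <;> simp [CStarMatrix.mul_apply, Fintype.sum_option]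

section
variable [PartialOrder D] [StarOrderedRing D]

theorem norm_cornM (b : D) : ‖cornM (ι := ι) b‖ = ‖b‖ := by
  apply le_antisymm
  · exact NonUnitalStarAlgHom.norm_apply_le _ b
  · exact CStarMatrix.norm_entry_le_norm (M := cornMf (ι := ι) b) (i := none) (j := none)

theorem norm_rowM (y : ι → D) : ‖rowM y‖ = rn y := by
  have h : ‖rowM y‖ * ‖rowM y‖ = rn y ^ 2 := by
    rw [← CStarRing.norm_self_mul_star, rowM_mul_star, norm_cornM, rn_sq]
  rw [← sq] at h
  exact (sq_eq_sq₀ (norm_nonneg _) (rn_nonneg _)).1 h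

end

theorem rn_add_le (y z : ι → D) : rn (fun c => y c + z c) ≤ rn y + rn z := by
  let _ := CStarAlgebra.spectralOrder D
  let _ := CStarAlgebra.spectralOrderedRing D
  simp only [← norm_rowM, rowM_add]
  exact norm_add_le _ _

theorem rn_sub_le (y z : ι → D) : rn (fun c => y c - z c) ≤ rn y + rn z := by
  let _ := CStarAlgebra.spectralOrder D
  let _ := CStarAlgebra.spectralOrderedRing D
  simp only [← norm_rowM, rowM_sub]
  exact norm_sub_le _ _

theorem rn_mul_left (b : D) (y : ι → D) : rn (fun c => b * y c) ≤ ‖b‖ * rn y := by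
  let _ := CStarAlgebra.spectralOrder D
  let _ := CStarAlgebra.spectralOrderedRing D
  simp only [← norm_rowM, rowM_mul_left]
  exact (norm_mul_le _ _).trans (by rw [norm_cornM])

theorem rn_mul_sc (X : Matrix ι ι ℂ) (y : ι → D) :
    rn (fun d => ∑ c, X c d • y c) ≤ rn y * ‖X‖ := by
  let _ := CStarAlgebra.spectralOrder D
  let _ := CStarAlgebra.spectralOrderedRing D
  simp only [← norm_rowM, rowM_mul_sc]
  refine (norm_mul_le _ _).trans ?_
  gcongr
  exact NonUnitalStarAlgHom.norm_apply_le (scM : Matrix ι ι ℂ →⋆ₙₐ[ℂ] CStarMatrix (Option ι) (Option ι) D) X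

theorem norm_sum_mul_star_le (y z : ι → D) : ‖∑ c, y c * star (z c)‖ ≤ rn y * rn z := by
  let _ := CStarAlgebra.spectralOrder D
  let _ := CStarAlgebra.spectralOrderedRing D
  rw [← norm_cornM (ι := ι), ← rowM_mul_star, ← norm_rowM, ← norm_rowM, ← norm_star (rowM z)]
  exact norm_mul_le _ _

theorem rn_map {E : Type*} [CStarAlgebra E] (θ : D →⋆ₙₐ[ℂ] E) (y : ι → D) :
    rn (fun c => θ (y c)) ≤ rn y := by
  unfold rn
  apply Real.sqrt_le_sqrt
  have : ∑ c, θ (y c) * star (θ (y c)) = θ (∑ c, y c * star (y c)) := by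
    simp [map_sum, map_mul, map_star]
  rw [this]
  exact NonUnitalStarAlgHom.norm_apply_le θ _

theorem norm_sum_sub_le (y : ι → D) {κ : Type*} [Fintype κ] (f : κ → ι)
    (hf : Function.Injective f) :
    ‖∑ c, y (f c) * star (y (f c))‖ ≤ ‖∑ c, y c * star (y c)‖ := by
  let _ := CStarAlgebra.spectralOrder D
  let _ := CStarAlgebra.spectralOrderedRing D
  apply CStarAlgebra.norm_le_norm_of_nonneg_of_le
  · exact Finset.sum_nonneg fun c _ => mul_star_self_nonneg _
  · have h := Finset.sum_map Finset.univ ⟨f, hf⟩ (fun c => y c * star (y c))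
    simp only [Function.Embedding.coeFn_mk] at h
    rw [← h]
    exact Finset.sum_le_sum_of_subset_of_nonneg (Finset.subset_univ _)
      fun c _ _ => mul_star_self_nonneg _

theorem rn_comp_le (y : ι → D) {κ : Type*} [Fintype κ] (f : κ → ι)
    (hf : Function.Injective f) : rn (fun c => y (f c)) ≤ rn y :=
  Real.sqrt_le_sqrt (norm_sum_sub_le y f hf)

theorem rn_mask_le (y : ι → D) (P : ι → Prop) [DecidablePred P] :
    rn (fun c => if P c then y c else 0) ≤ rn y := by
  let _ := CStarAlgebra.spectralOrder D
  let _ := CStarAlgebra.spectralOrderedRing D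
  apply Real.sqrt_le_sqrt
  apply CStarAlgebra.norm_le_norm_of_nonneg_of_le
  · exact Finset.sum_nonneg fun c _ => mul_star_self_nonneg _
  · apply Finset.sum_le_sum
    intro c _
    dsimp only
    split_ifs
    · exact le_rfl
    · simp

theorem norm_le_rn (y : ι → D) (c : ι) : ‖y c‖ ≤ rn y := by
  have := rn_comp_le y (fun _ : Unit => c) (fun _ _ _ => rfl)
  refine le_trans (le_of_eq ?_) this
  unfold rn
  simp [CStarRing.norm_self_mul_star]

theorem rn_congr {y z : ι → D} (h : ∀ c, y c = z c) : rn y = rn z := by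
  rw [funext h]

theorem rn_zero : rn (fun _ : ι => (0 : D)) = 0 := by simp [rn]

theorem rn_sum_le {κ : Type*} (s : Finset κ) (y : κ → ι → D) :
    rn (fun c => ∑ u ∈ s, y u c) ≤ ∑ u ∈ s, rn (y u) := by
  classical
  induction s using Finset.induction_on with
  | empty => simp [rn_zero]
  | insert a s ha ih =>
    simp only [Finset.sum_insert ha]
    exact (rn_add_le _ _).trans (by gcongr)

end RowNorm


/-! ### The central approximation property -/

def StarP (n : ℕ) (D : Type) [CStarAlgebra D] : Prop :=
  ∀ (S : Finset D) (ε : ℝ), 0 < ε → ∃ (ι I : Type) (_ : Fintype ι) (_ : DecidableEq ι)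
    (_ : Fintype I) (_ : DecidableEq I) (blk : ι → I) (col : I → Fin (n + 1))
    (y : ι → D) (k : I → D) (X : D → Matrix ι ι ℂ),
    (∀ b c d, blk c ≠ blk d → X b c d = 0) ∧
    (∀ c d, col (blk c) = col (blk d) → star (y c) * y d = if c = d then k (blk c) else 0) ∧
    ‖∑ c, y c * star (y c) - 1‖ ≤ ε ∧
    ∀ b ∈ S, rn (fun d => b * y d - ∑ c, X b c d • y c) ≤ ε

section CP
variable {F D : Type*} [Ring F] [StarRing F] [Module ℂ F] [Ring D] [StarRing D] [Module ℂ D]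

theorem cp_factor {φ : F →ₗ[ℂ] D} (hφ : IsCompletelyPositive φ) (a b : F) :
    ∃ z w : Fin 2 → D, φ (star a * a) = ∑ i, star (z i) * z i ∧
      φ (star a * b) = ∑ i, star (z i) * w i ∧ φ (star b * a) = ∑ i, star (w i) * z i ∧
      φ (star b * b) = ∑ i, star (w i) * w i := by
  obtain ⟨Z, hZ⟩ := hφ 2 (star (!![a, b; 0, 0]) * !![a, b; 0, 0]) ⟨_, rfl⟩
  refine ⟨fun i => Z i 0, fun i => Z i 1, ?_, ?_, ?_, ?_⟩
  · have := congrFun (congrFun hZ 0) 0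
    simpa [Matrix.mul_apply, Matrix.star_apply] using this
  · have := congrFun (congrFun hZ 0) 1
    simpa [Matrix.mul_apply, Matrix.star_apply] using this
  · have := congrFun (congrFun hZ 1) 0
    simpa [Matrix.mul_apply, Matrix.star_apply] using this
  · have := congrFun (congrFun hZ 1) 1
    simpa [Matrix.mul_apply, Matrix.star_apply] using this

theorem cp_star {φ : F →ₗ[ℂ] D} (hφ : IsCompletelyPositive φ) (b : F) :
    φ (star b) = star (φ b) := by
  obtain ⟨z, w, -, h2, h3, -⟩ := cp_factor hφ 1 b
  simp only [star_one, one_mul, mul_one] at h2 h3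
  rw [h2, h3, star_sum]
  simp

end CP

section CP2
variable {F D : Type*} [CStarAlgebra F] [CStarAlgebra D] [PartialOrder D] [StarOrderedRing D]

theorem cp_nonneg {φ : F →ₗ[ℂ] D} (hφ : IsCompletelyPositive φ) (b : F) :
    0 ≤ φ (star b * b) := by
  obtain ⟨z, w, h2, -⟩ := cp_factor hφ b b
  rw [h2]
  exact Finset.sum_nonneg fun i _ => star_mul_self_nonneg _

theorem cp_nonneg' {φ : F →ₗ[ℂ] D} (hφ : IsCompletelyPositive φ) [PartialOrder F]
    [StarOrderedRing F] {b : F} (hb : 0 ≤ b) : 0 ≤ φ b := by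
  obtain ⟨x, rfl⟩ := CStarAlgebra.nonneg_iff_eq_star_mul_self.1 hb
  exact cp_nonneg hφ x

theorem one_sub_nonneg_of_norm_le {b : D} (hb : 0 ≤ b) (h : ‖b‖ ≤ 1) : 0 ≤ 1 - b :=
  sub_nonneg.2 ((CStarAlgebra.norm_le_one_iff_of_nonneg b hb).1 h)

/-- Kadison inequality. -/
theorem cp_kadison {φ : F →ₗ[ℂ] D} (hφ : IsCompletelyPositive φ) (h1 : ‖φ 1‖ ≤ 1) (b : F) :
    0 ≤ φ (b * star b) - φ b * star (φ b) := by
  obtain ⟨w, z, h1', h2, h3, h4⟩ := cp_factor hφ (star b) 1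
  simp only [star_star, star_one, one_mul, mul_one] at h1' h2 h3 h4
  have hs : star (φ b) = ∑ i, star (z i) * w i := by rw [← cp_star hφ, h3]
  set x := φ b with hx
  have key : φ (b * star b) - x * star x =
      ∑ i, star (w i - z i * star x) * (w i - z i * star x) + x * (1 - φ 1) * star x := by
    have e : ∀ i, star (w i - z i * star x) * (w i - z i * star x) =
      star (w i) * w i - star (w i) * z i * star x - x * (star (z i) * w i)
        + x * (star (z i) * z i) * star x := by
      intro i
      simp only [star_sub, star_mul, star_star]
      noncomm_ring
    simp only [e, Finset.sum_add_distrib, Finset.sum_sub_distrib, ← Finset.sum_mul,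
      ← Finset.mul_sum, ← h1', ← h2, ← h4, ← hs]
    noncomm_ring
  rw [key]
  apply add_nonneg
  · exact Finset.sum_nonneg fun i _ => star_mul_self_nonneg _
  · have h0 : 0 ≤ φ 1 := by simpa using cp_nonneg hφ 1
    have := star_left_conjugate_nonneg (one_sub_nonneg_of_norm_le h0 h1) (star x)
    simpa using this

theorem star_mul_self_zero' {a : D} (h : star a * a = 0) : a = 0 :=
  CStarRing.star_mul_self_eq_zero_iff a |>.1 h

theorem sum_star_zero {m : ℕ} {z : Fin m → D} (h : ∑ i, star (z i) * z i = 0) (i : Fin m) :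
    z i = 0 := by
  have := (Finset.sum_eq_zero_iff_of_nonneg (fun i _ => star_mul_self_nonneg (z i))).1 h i
    (Finset.mem_univ i)
  exact star_mul_self_zero' this

theorem cp_orth {φ : F →ₗ[ℂ] D} (hφ : IsCompletelyPositive φ) (x y : F)
    (h : φ (star x * x) * φ (y * star y) = 0) : φ x * φ y = 0 := by
  obtain ⟨z, w, -, h2, -, h4⟩ := cp_factor hφ 1 x
  obtain ⟨z', w', k1, k2, -, -⟩ := cp_factor hφ (star y) 1
  simp only [star_one, one_mul, mul_one, star_star] at h2 h4 k1 k2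
  have hwQ : ∀ i, w i * φ (y * star y) = 0 := by
    apply sum_star_zero
    have hsa : star (φ (y * star y)) = φ (y * star y) := by
      rw [← cp_star hφ]; simp
    simp only [star_mul, hsa]
    have : ∑ i, φ (y * star y) * star (w i) * (w i * φ (y * star y)) =
      φ (y * star y) * (φ (star x * x) * φ (y * star y)) := by
      rw [h4, Finset.sum_mul, Finset.mul_sum]
      exact Finset.sum_congr rfl fun i _ => by noncomm_ring
    rw [this, h, mul_zero]
  have hwz : ∀ i l, w i * star (z' l) = 0 := by
    intro i l
    have : ∀ l, z' l * star (w i) = 0 := by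
      apply sum_star_zero
      have e : ∑ l, star (z' l * star (w i)) * (z' l * star (w i)) =
        w i * φ (y * star y) * star (w i) := by
        rw [k1, Finset.mul_sum, Finset.sum_mul]
        exact Finset.sum_congr rfl fun i _ => by simp [mul_assoc]
      rw [e, hwQ, zero_mul]
    have := congrArg star (this l)
    simpa using this
  rw [h2, k2, Finset.sum_mul]
  refine Finset.sum_eq_zero fun i _ => ?_
  rw [Finset.mul_sum]
  refine Finset.sum_eq_zero fun l _ => ?_
  have : star (z i) * w i * (star (z' l) * w' l) = star (z i) * (w i * star (z' l)) * w' l := by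
    noncomm_ring
  rw [this, hwz, mul_zero, zero_mul]

end CP2

section OZ
variable {D : Type*} [CStarAlgebra D] {s : ℕ} {r : Fin s → ℕ} {n : ℕ}
  {J : Fin s → Fin (n + 1)} {j : Fin (n + 1)} {φ : FDBlock s r →ₗ[ℂ] D}

theorem bs_mul_left {x : FDBlock s r} (hx : x ∈ blockSupp J j) (z : FDBlock s r) :
    x * z ∈ blockSupp J j := fun i hi => by simp [hx i hi]

theorem bs_mul_right {x : FDBlock s r} (hx : x ∈ blockSupp J j) (z : FDBlock s r) :
    z * x ∈ blockSupp J j := fun i hi => by simp [hx i hi]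

theorem bs_star {x : FDBlock s r} (hx : x ∈ blockSupp J j) :
    star x ∈ blockSupp J j := fun i hi => by simp [hx i hi]

theorem bs_sub {x z : FDBlock s r} (hx : x ∈ blockSupp J j) (hz : z ∈ blockSupp J j) :
    x - z ∈ blockSupp J j := fun i hi => by simp [hx i hi, hz i hi]

theorem oz_mul_zero (hφ : IsCompletelyPositive φ) (ho : OrderZeroOn φ (blockSupp J j))
    {x y : FDBlock s r} (hx : x ∈ blockSupp J j) (hy : y ∈ blockSupp J j) (h : x * y = 0) :
    φ x * φ y = 0 := by
  let _ := CStarAlgebra.spectralOrder D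
  let _ := CStarAlgebra.spectralOrderedRing D
  apply cp_orth hφ
  have h' : star y * star x = 0 := by rw [← star_mul, h, star_zero]
  refine (ho _ (bs_mul_right hx (star x)) _ (bs_mul_left hy (star y)) ?_ ?_).1
  · rw [show star x * x * (y * star y) = star x * (x * y) * star y by noncomm_ring, h]; simp
  · rw [show y * star y * (star x * x) = y * (star y * star x) * x by noncomm_ring, h']; simp

theorem oz_idem (hφ : IsCompletelyPositive φ) (ho : OrderZeroOn φ (blockSupp J j))
    {x y : FDBlock s r} (hx : x ∈ blockSupp J j) (hy : y ∈ blockSupp J j) {e : FDBlock s r}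
    (he : e * e = e) : φ (x * e) * φ y = φ x * φ (e * y) := by
  have h1 : φ (x * e) * φ (y - e * y) = 0 := by
    refine oz_mul_zero hφ ho (bs_mul_left hx e) (bs_sub hy (bs_mul_right hy e)) ?_
    rw [show x * e * (y - e * y) = x * e * y - x * (e * e) * y by noncomm_ring, he, sub_self]
  have h2 : φ (x - x * e) * φ (e * y) = 0 := by
    refine oz_mul_zero hφ ho (bs_sub hx (bs_mul_left hx e)) (bs_mul_right hy e) ?_
    rw [show (x - x * e) * (e * y) = x * e * y - x * (e * e) * y by noncomm_ring, he, sub_self]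
  rw [map_sub, mul_sub, sub_eq_zero] at h1
  rw [map_sub, sub_mul, sub_eq_zero] at h2
  rw [h1, h2]

theorem oz_bal (hφ : IsCompletelyPositive φ) (ho : OrderZeroOn φ (blockSupp J j))
    {x y : FDBlock s r} (hx : x ∈ blockSupp J j) (hy : y ∈ blockSupp J j) (z : FDBlock s r) :
    φ (x * z) * φ y = φ x * φ (z * y) := by
  let N : Submodule ℂ (FDBlock s r) :=
    { carrier := {z | φ (x * z) * φ y = φ x * φ (z * y)}
      add_mem' := fun {a b} ha hb => by
        simp only [Set.mem_ofPred_eq] at *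
        rw [mul_add, add_mul, map_add, map_add, add_mul, mul_add, ha, hb]
      zero_mem' := by simp
      smul_mem' := fun c a ha => by
        simp only [Set.mem_ofPred_eq] at *
        rw [mul_smul_comm, smul_mul_assoc, map_smul, map_smul, smul_mul_assoc, mul_smul_comm, ha] }
  have hidem : ∀ e : FDBlock s r, e * e = e → e ∈ N := fun e he => oz_idem hφ ho hx hy he
  have hunit : ∀ i (a b : Fin (r i)), (Pi.single i (Matrix.single a b 1) : FDBlock s r) ∈ N := by
    intro i a b
    by_cases hab : a = b
    · subst hab
      apply hidem
      rw [← Pi.single_mul]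
      simp
    · have h1 : (Pi.single i (Matrix.single a a 1) : FDBlock s r) ∈ N := by
        apply hidem
        rw [← Pi.single_mul]
        simp
      have h2 : (Pi.single i (Matrix.single a a 1 + Matrix.single a b 1) : FDBlock s r) ∈ N := by
        apply hidem
        rw [← Pi.single_mul]
        congr 1
        simp [mul_add, add_mul, Ne.symm hab]
      rw [Pi.single_add] at h2
      have := N.sub_mem h2 h1
      simpa using this
  have : z ∈ N := by
    rw [← Finset.univ_sum_single z]
    refine N.sum_mem fun i _ => ?_
    rw [Matrix.matrix_eq_sum_single (z i)]
    have : (Pi.single i (∑ a, ∑ b, Matrix.single a b (z i a b)) : FDBlock s r) =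
      ∑ a, ∑ b, z i a b • Pi.single i (Matrix.single a b 1) := by
      rw [← LinearMap.coe_single (R := ℂ)]
      simp only [map_sum, ← map_smul]
      simp
    rw [this]
    exact N.sum_mem fun a _ => N.sum_mem fun b _ => N.smul_mem _ (hunit i a b)
  exact this

def cUnit (r : Fin s → ℕ) (J : Fin s → Fin (n + 1)) (j : Fin (n + 1)) : FDBlock s r :=
  fun i => if J i = j then 1 else 0

theorem cUnit_mem : cUnit r J j ∈ blockSupp J j := fun i hi => by simp [cUnit, hi]

theorem cUnit_mul {x : FDBlock s r} (hx : x ∈ blockSupp J j) : cUnit r J j * x = x := by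
  funext i
  by_cases h : J i = j
  · simp [cUnit, h]
  · simp [cUnit, h, hx i h]

theorem mul_cUnit {x : FDBlock s r} (hx : x ∈ blockSupp J j) : x * cUnit r J j = x := by
  funext i
  by_cases h : J i = j
  · simp [cUnit, h]
  · simp [cUnit, h, hx i h]

theorem oz_mul (hφ : IsCompletelyPositive φ) (ho : OrderZeroOn φ (blockSupp J j))
    {x y : FDBlock s r} (hx : x ∈ blockSupp J j) (hy : y ∈ blockSupp J j) :
    φ x * φ y = φ (cUnit r J j) * φ (x * y) := by
  have := oz_bal hφ ho cUnit_mem hy x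
  rwa [cUnit_mul hx] at this

theorem oz_mul' (hφ : IsCompletelyPositive φ) (ho : OrderZeroOn φ (blockSupp J j))
    {x y : FDBlock s r} (hx : x ∈ blockSupp J j) (hy : y ∈ blockSupp J j) :
    φ x * φ y = φ (x * y) * φ (cUnit r J j) := by
  have := oz_bal hφ ho hx cUnit_mem y
  rwa [mul_cUnit hy, eq_comm] at this

theorem oz_comm (hφ : IsCompletelyPositive φ) (ho : OrderZeroOn φ (blockSupp J j))
    {x : FDBlock s r} (hx : x ∈ blockSupp J j) :
    Commute (φ (cUnit r J j)) (φ x) := by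
  have h1 := oz_mul hφ ho cUnit_mem hx
  have h2 := oz_mul' hφ ho hx cUnit_mem
  have h3 := oz_mul hφ ho hx cUnit_mem
  rw [cUnit_mul hx] at h1
  rw [mul_cUnit hx] at h2 h3
  exact h3.symm.trans h2 |>.trans (by rw [h2])

end OZ


section Phi
variable {ι D : Type*} [Fintype ι] [DecidableEq ι] [CStarAlgebra D]

def PhiM (y : ι → D) (X : Matrix ι ι ℂ) : D := ∑ c, ∑ d, X c d • (y c * star (y d))

theorem PhiM_one (y : ι → D) : PhiM y 1 = ∑ c, y c * star (y c) := by
  simp [PhiM, Matrix.one_apply, ite_smul]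

theorem cornM_PhiM (y : ι → D) (X : Matrix ι ι ℂ) :
    cornM (PhiM y X) = rowM y * scM X * star (rowM y) := by
  rw [← rowM_mul_sc, rowM_mul_star]
  congr 1
  simp only [PhiM, Finset.sum_mul, smul_mul_assoc]
  exact Finset.sum_comm

theorem cornM_inj {a b : D} (h : cornM (ι := ι) a = cornM b) : a = b :=
  congrArg (fun M => M none none) h

theorem sum_RR (y : ι → D) (X : Matrix ι ι ℂ) (b : D) :
    ∑ d, (b * y d - ∑ c, X c d • y c) * star (b * y d - ∑ c, X c d • y c) =
      b * PhiM y 1 * star b - b * PhiM y (star X) - PhiM y X * star b + PhiM y (X * star X) := by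
  apply cornM_inj (ι := ι)
  rw [← rowM_mul_star, rowM_sub, rowM_mul_left, rowM_mul_sc]
  simp only [map_sub, map_add, map_mul, map_star, cornM_PhiM, PhiM_one, ← rowM_mul_star,
    star_sub, star_mul]
  noncomm_ring

theorem norm_PhiM_le (y : ι → D) (X : Matrix ι ι ℂ) : ‖PhiM y X‖ ≤ rn y ^ 2 * ‖X‖ := by
  have : PhiM y X = ∑ d, (∑ c, X c d • y c) * star (y d) := by
    simp only [PhiM, Finset.sum_mul, smul_mul_assoc]
    exact Finset.sum_comm
  rw [this]
  refine (norm_sum_mul_star_le _ _).trans ?_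
  have := mul_le_mul_of_nonneg_right (rn_mul_sc X y) (rn_nonneg y)
  linarith

end Phi

theorem exists_g {D : Type*} [CStarAlgebra D] [PartialOrder D] [StarOrderedRing D]
    {h : D} (hh : 0 ≤ h) {δ : ℝ} (hδ : 0 < δ) :
    ∃ g : D, star g = g ∧ (∀ x, Commute h x → Commute g x) ∧
      ‖(1 - g * g * h) * (1 - g * g * h) * h‖ ≤ δ := by
  have hsa : IsSelfAdjoint h := .of_nonneg hh
  have hc : Continuous (fun t : ℝ => (Real.sqrt (|t| + δ))⁻¹) := by
    refine Continuous.inv₀ (by fun_prop) fun t => ?_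
    positivity
  obtain ⟨f, hf⟩ : ∃ f : ℝ → ℝ, f = fun t : ℝ => (Real.sqrt (|t| + δ))⁻¹ := ⟨_, rfl⟩
  rw [← hf] at hc
  refine ⟨cfc f h, (cfc_predicate (p := IsSelfAdjoint) (R := ℝ) _ h).star_eq, ?_, ?_⟩
  · intro x hx
    exact (hx.cfc_real _)
  · have e : (1 - cfc f h * cfc f h * h) * (1 - cfc f h * cfc f h * h) * h =
        cfc (fun t : ℝ => (1 - f t * f t * t) * (1 - f t * f t * t) * t) h := by
      have h1 : cfc (fun t : ℝ => 1 - f t * f t * t) h = 1 - cfc f h * cfc f h * h := by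
        rw [cfc_sub _ _ h (by fun_prop) (by fun_prop), cfc_mul _ _ h (by fun_prop) (by fun_prop),
          cfc_mul _ _ h (by fun_prop) (by fun_prop), cfc_const_one ℝ h, cfc_id' ℝ h]
      rw [cfc_mul _ _ h (by fun_prop) (by fun_prop), cfc_mul _ _ h (by fun_prop) (by fun_prop),
        cfc_id' ℝ h, h1]
    rw [e, hf]
    refine norm_cfc_le hδ.le fun t ht => ?_
    have ht0 : 0 ≤ t := spectrum_nonneg_of_nonneg hh ht
    dsimp only
    rw [abs_of_nonneg ht0, ← mul_inv, Real.mul_self_sqrt (by positivity)]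
    have : 1 - (t + δ)⁻¹ * t = δ / (t + δ) := by field_simp; ring
    rw [this, Real.norm_of_nonneg (by positivity)]
    rw [div_mul_div_comm, div_mul_eq_mul_div, div_le_iff₀ (by positivity)]
    nlinarith [mul_nonneg ht0 ht0, mul_pos hδ hδ, mul_nonneg ht0 hδ.le,
      mul_nonneg (mul_nonneg ht0 ht0) hδ.le, mul_nonneg ht0 (mul_pos hδ hδ).le,
      mul_pos hδ (mul_pos hδ hδ)]

section Step1
variable {D : Type*} [CStarAlgebra D] {s : ℕ} {r : Fin s → ℕ} {n : ℕ}
  {J : Fin s → Fin (n + 1)} {φ : FDBlock s r →ₗ[ℂ] D}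

def EE (r : Fin s → ℕ) (i : Fin s) (a b : Fin (r i)) : FDBlock s r :=
  Pi.single i (Matrix.single a b 1)

theorem EE_mem (i : Fin s) (a b : Fin (r i)) : EE r i a b ∈ blockSupp J (J i) := by
  intro i' h
  have : i' ≠ i := fun e => h (by rw [e])
  simp [EE, this]

theorem EE_mem' {i : Fin s} {j : Fin (n + 1)} (h : J i = j) (a b : Fin (r i)) :
    EE r i a b ∈ blockSupp J j := h ▸ EE_mem i a b

theorem EE_star (i : Fin s) (a b : Fin (r i)) : star (EE r i a b) = EE r i b a := by
  funext i'
  by_cases h : i' = i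
  · subst h; simp [EE, Matrix.star_eq_conjTranspose]
  · simp [EE, h]

theorem EE_mul (i : Fin s) (a b c d : Fin (r i)) :
    EE r i a b * EE r i c d = if b = c then EE r i a d else 0 := by
  unfold EE
  rw [← Pi.single_mul]
  split_ifs with h
  · subst h; simp
  · simp [h]

theorem EE_mul_ne {i i' : Fin s} (h : i ≠ i') (a b : Fin (r i)) (c d : Fin (r i')) :
    EE r i a b * EE r i' c d = 0 := by
  funext i''
  by_cases h1 : i'' = i
  · subst h1; simp [EE, h]
  · simp [EE, h1]

def z0 {m : ℕ} (a : Fin m) : Fin m := ⟨0, a.pos⟩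

def yy (φ : FDBlock s r →ₗ[ℂ] D) (g : Fin s → D) (c : Σ i : Fin s, Fin (r i)) : D :=
  g c.1 * φ (EE r c.1 c.2 (z0 c.2))

theorem yy_star (hφ : IsCompletelyPositive φ) {g : Fin s → D} (hg : ∀ i, star (g i) = g i)
    (c : Σ i : Fin s, Fin (r i)) :
    star (yy φ g c) = φ (EE r c.1 (z0 c.2) c.2) * g c.1 := by
  unfold yy
  rw [star_mul, hg, ← cp_star hφ, EE_star]

theorem yy_mul_star (hφ : IsCompletelyPositive φ) (ho : ∀ j, OrderZeroOn φ (blockSupp J j))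
    {g : Fin s → D} (hg : ∀ i, star (g i) = g i)
    (hc : ∀ i, ∀ x, Commute (φ (cUnit r J (J i))) x → Commute (g i) x)
    (i : Fin s) (a b : Fin (r i)) :
    yy φ g ⟨i, a⟩ * star (yy φ g ⟨i, b⟩) = g i * g i * φ (cUnit r J (J i)) * φ (EE r i a b) := by
  rw [yy_star hφ hg]
  dsimp only [yy]
  have h1 : φ (EE r i a (z0 a)) * φ (EE r i (z0 b) b) =
      φ (cUnit r J (J i)) * φ (EE r i a b) := by
    rw [oz_mul hφ (ho _) (EE_mem i _ _) (EE_mem i _ _), EE_mul]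
    simp [z0]
  have h2 : Commute (g i) (φ (cUnit r J (J i)) * φ (EE r i a b)) :=
    (hc i _ (Commute.refl _)).mul_right (hc i _ (oz_comm hφ (ho _) (EE_mem i a b)))
  calc _ = g i * (φ (EE r i a (z0 a)) * φ (EE r i (z0 b) b)) * g i := by noncomm_ring
    _ = g i * (φ (cUnit r J (J i)) * φ (EE r i a b) * g i) := by rw [h1]; noncomm_ring
    _ = _ := by rw [← h2.eq]; noncomm_ring

theorem star_yy_mul (hφ : IsCompletelyPositive φ) (ho : ∀ j, OrderZeroOn φ (blockSupp J j))
    {gg : Fin (n + 1) → D} (hg : ∀ i, star (gg i) = gg i)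
    (hc : ∀ j, ∀ x, Commute (φ (cUnit r J j)) x → Commute (gg j) x)
    (c d : Σ i : Fin s, Fin (r i)) (hcd : J c.1 = J d.1) :
    star (yy φ (fun i => gg (J i)) c) * yy φ (fun i => gg (J i)) d =
      if c = d then gg (J c.1) * gg (J c.1) * φ (cUnit r J (J c.1)) *
        φ (EE r c.1 (z0 c.2) (z0 c.2)) else 0 := by
  rw [yy_star hφ (fun i => hg (J i))]
  dsimp only [yy]
  rw [← hcd]
  have e : φ (EE r c.1 (z0 c.2) c.2) * gg (J c.1) * (gg (J c.1) * φ (EE r d.1 d.2 (z0 d.2))) =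
      gg (J c.1) * gg (J c.1) * (φ (cUnit r J (J c.1)) *
        φ (EE r c.1 (z0 c.2) c.2 * EE r d.1 d.2 (z0 d.2))) := by
    rw [← oz_mul hφ (ho _) (EE_mem c.1 _ _) (EE_mem' hcd.symm _ _)]
    have h2 : Commute (gg (J c.1)) (φ (EE r c.1 (z0 c.2) c.2)) :=
      hc _ _ (oz_comm hφ (ho _) (EE_mem c.1 _ _))
    have h3 := (h2.mul_left h2).eq
    calc _ = φ (EE r c.1 (z0 c.2) c.2) * (gg (J c.1) * gg (J c.1)) * φ (EE r d.1 d.2 (z0 d.2)) := by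
          noncomm_ring
      _ = _ := by rw [← h3]; noncomm_ring
  rw [e]
  obtain ⟨i, a⟩ := c
  obtain ⟨i', b⟩ := d
  by_cases hi : i = i'
  · subst hi
    dsimp only
    rw [EE_mul]
    by_cases hab : a = b
    · subst hab; simp [mul_assoc]
    · simp [hab]
  · have : (⟨i, a⟩ : Σ i : Fin s, Fin (r i)) ≠ ⟨i', b⟩ := fun h => hi (congrArg Sigma.fst h)
    rw [if_neg this]
    dsimp only
    rw [EE_mul_ne hi]; simp

theorem FD_sum (x : FDBlock s r) : x = ∑ i, ∑ a, ∑ b, x i a b • EE r i a b := by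
  conv_lhs => rw [← Finset.univ_sum_single x]
  refine Finset.sum_congr rfl fun i _ => ?_
  conv_lhs => rw [Matrix.matrix_eq_sum_single (x i)]
  rw [← LinearMap.coe_single (R := ℂ)]
  simp only [map_sum, EE]
  refine Finset.sum_congr rfl fun a _ => Finset.sum_congr rfl fun b _ => ?_
  rw [← LinearMap.coe_single (R := ℂ), ← map_smul]
  simp

theorem PhiM_yy (hφ : IsCompletelyPositive φ) (ho : ∀ j, OrderZeroOn φ (blockSupp J j))
    {gg : Fin (n + 1) → D} (hg : ∀ i, star (gg i) = gg i)
    (hc : ∀ j, ∀ x, Commute (φ (cUnit r J j)) x → Commute (gg j) x) (x : FDBlock s r) :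
    PhiM (yy φ (fun i => gg (J i))) (Matrix.blockDiagonal' x) =
      ∑ j, gg j * gg j * φ (cUnit r J j) * φ (cUnit r J j * x) := by
  have h1 : PhiM (yy φ (fun i => gg (J i))) (Matrix.blockDiagonal' x) =
      ∑ i, ∑ a, ∑ b, x i a b • (gg (J i) * gg (J i) * φ (cUnit r J (J i)) * φ (EE r i a b)) := by
    unfold PhiM
    rw [Fintype.sum_sigma]
    refine Finset.sum_congr rfl fun i _ => Finset.sum_congr rfl fun a _ => ?_
    rw [Fintype.sum_sigma, Finset.sum_eq_single i]
    · refine Finset.sum_congr rfl fun b _ => ?_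
      rw [Matrix.blockDiagonal'_apply_eq,
        yy_mul_star hφ ho (fun i => hg (J i)) (fun i => hc (J i))]
    · intro i' _ hi'
      refine Finset.sum_eq_zero fun b _ => ?_
      rw [Matrix.blockDiagonal'_apply_ne _ _ _ (Ne.symm hi'), zero_smul]
    · simp
  have h2 : ∀ j, cUnit r J j * x = ∑ i, ∑ a, ∑ b, x i a b • (if J i = j then EE r i a b else 0) := by
    intro j
    conv_lhs => rw [FD_sum (cUnit r J j * x)]
    refine Finset.sum_congr rfl fun i _ => Finset.sum_congr rfl fun a _ =>
      Finset.sum_congr rfl fun b _ => ?_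
    by_cases h : J i = j <;> simp [cUnit, h]
  rw [h1]
  simp only [h2, map_sum, map_smul, Finset.mul_sum, mul_smul_comm]
  symm
  refine Finset.sum_comm.trans (Finset.sum_congr rfl fun i _ => ?_)
  refine Finset.sum_comm.trans (Finset.sum_congr rfl fun a _ => ?_)
  refine Finset.sum_comm.trans (Finset.sum_congr rfl fun b _ => ?_)
  rw [← Finset.smul_sum]
  congr 1
  rw [Finset.sum_eq_single (J i)]
  · simp
  · intro j _ hj
    simp [Ne.symm hj]
  · simp

theorem sum_cUnit (r : Fin s → ℕ) (J : Fin s → Fin (n + 1)) : ∑ j, cUnit r J j = 1 := by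
  funext i
  simp [cUnit]

theorem norm_cUnit_le (j : Fin (n + 1)) : ‖cUnit r J j‖ ≤ 1 := by
  rw [pi_norm_le_iff_of_nonneg zero_le_one]
  intro i
  unfold cUnit
  split_ifs
  · rcases isEmpty_or_nonempty (Fin (r i)) with h | h
    · have : (1 : Matrix (Fin (r i)) (Fin (r i)) ℂ) = 0 := Subsingleton.elim _ _
      rw [this]; simp
    · exact CStarRing.norm_one.le
  · simp

theorem PhiM_yy_sub (hφ : IsCompletelyPositive φ) (hn : ∀ x, ‖φ x‖ ≤ ‖x‖)
    (ho : ∀ j, OrderZeroOn φ (blockSupp J j))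
    {gg : Fin (n + 1) → D} (hg : ∀ i, star (gg i) = gg i)
    (hc : ∀ j, ∀ x, Commute (φ (cUnit r J j)) x → Commute (gg j) x) {δ : ℝ} (hδ : 0 < δ)
    (hgn : ∀ j, ‖(1 - gg j * gg j * φ (cUnit r J j)) * (1 - gg j * gg j * φ (cUnit r J j)) *
      φ (cUnit r J j)‖ ≤ δ ^ 2) (x : FDBlock s r) :
    ‖PhiM (yy φ (fun i => gg (J i))) (Matrix.blockDiagonal' x) - φ x‖ ≤ (n + 1) * δ * ‖x‖ := by
  have hx : φ x = ∑ j, φ (cUnit r J j * x) := by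
    rw [← map_sum, ← Finset.sum_mul, sum_cUnit, one_mul]
  rw [PhiM_yy hφ ho hg hc, hx, ← Finset.sum_sub_distrib]
  refine (norm_sum_le _ _).trans ?_
  have : (n + 1) * δ * ‖x‖ = ∑ _j : Fin (n + 1), δ * ‖x‖ := by simp [mul_assoc]
  rw [this]
  refine Finset.sum_le_sum fun j _ => ?_
  set h := φ (cUnit r J j) with hh
  set u := cUnit r J j * x with hu
  have humem : u ∈ blockSupp J j := bs_mul_left cUnit_mem x
  set w := 1 - gg j * gg j * h with hw
  have hsah : star h = h := by
    rw [hh, ← cp_star hφ]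
    congr 1
    funext i
    by_cases e : J i = j <;> simp [cUnit, e]
  have hgh : Commute (gg j) h := hc j _ (Commute.refl _)
  have hsaw : star w = w := by
    simp only [hw, star_sub, star_one, star_mul, hg, hsah]
    rw [← mul_assoc, ← hgh.eq, mul_assoc, ← hgh.eq, mul_assoc]
  have e1 : gg j * gg j * h * φ u - φ u = - (w * φ u) := by rw [hw]; noncomm_ring
  rw [e1, norm_neg]
  have hunorm : ‖u‖ ≤ ‖x‖ := by
    calc ‖u‖ ≤ ‖cUnit r J j‖ * ‖x‖ := norm_mul_le _ _
      _ ≤ 1 * ‖x‖ := by gcongr; exact norm_cUnit_le j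
      _ = ‖x‖ := one_mul _
  have cwu : Commute w (φ (u * star u)) := by
    have hm : u * star u ∈ blockSupp J j := bs_mul_left humem _
    have c1 := oz_comm hφ (ho j) hm
    have c2 := hc j _ c1
    exact (Commute.one_left _).sub_left ((c2.mul_left c2).mul_left c1)
  have key : ‖w * φ u‖ ^ 2 ≤ (δ * ‖x‖) ^ 2 := by
    rw [sq, ← CStarRing.norm_self_mul_star, star_mul, hsaw, ← cp_star hφ]
    have : w * φ u * (φ (star u) * w) = w * w * h * φ (u * star u) := by
      calc _ = w * (φ u * φ (star u)) * w := by noncomm_ring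
        _ = w * (φ (u * star u) * h) * w := by rw [oz_mul' hφ (ho j) humem (bs_star humem)]
        _ = (w * φ (u * star u)) * (h * w) := by noncomm_ring
        _ = φ (u * star u) * (w * (h * w)) := by rw [cwu.eq]; noncomm_ring
        _ = φ (u * star u) * (w * w * h) := by
          have chw : Commute w h :=
            (Commute.one_left _).sub_left ((hgh.mul_left hgh).mul_left (Commute.refl _))
          rw [← chw.eq]; noncomm_ring
        _ = w * w * h * φ (u * star u) := by
          have hm : u * star u ∈ blockSupp J j := bs_mul_left humem _
          exact ((cwu.mul_left cwu).mul_left (oz_comm hφ (ho j) hm)).symm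
    rw [this]
    calc _ ≤ ‖w * w * h‖ * ‖φ (u * star u)‖ := norm_mul_le _ _
      _ ≤ δ ^ 2 * (‖x‖ * ‖x‖) := by
        gcongr
        · exact hgn j
        · refine (hn _).trans ((norm_mul_le _ _).trans ?_)
          rw [norm_star]; gcongr
      _ = _ := by ring
  exact (abs_le_of_sq_le_sq' key (by positivity)).2

end Step1


theorem norm_FD_one_le {s : ℕ} {r : Fin s → ℕ} : ‖(1 : FDBlock s r)‖ ≤ 1 := by
  have := norm_cUnit_le (r := r) (n := 0) (J := fun _ => 0) 0
  have e : cUnit r (fun _ => (0 : Fin (0 + 1))) 0 = 1 := by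
    funext i; simp [cUnit]
  rwa [e] at this

theorem step1_err {D : Type*} [CStarAlgebra D] [PartialOrder D] [StarOrderedRing D]
    {s : ℕ} {r : Fin s → ℕ}
    {φ : FDBlock s r →ₗ[ℂ] D} {ψ : D →ₗ[ℂ] FDBlock s r}
    (hφ : IsCompletelyPositive φ) (hψ : IsCompletelyPositive ψ)
    (hψn : ∀ x, ‖ψ x‖ ≤ ‖x‖) (hn : ∀ x, ‖φ x‖ ≤ ‖x‖)
    {y : (Σ i : Fin s, Fin (r i)) → D} {δ t B : ℝ} (hδ : 0 ≤ δ) (ht : 0 ≤ t) (hB : 1 ≤ B)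
    (hΦ : ∀ x : FDBlock s r, ‖PhiM y (Matrix.blockDiagonal' x) - φ x‖ ≤ δ * ‖x‖)
    (b : D) (hb : ‖b‖ ≤ B) (h1 : ‖φ (ψ b) - b‖ ≤ t) (h2 : ‖φ (ψ (star b)) - star b‖ ≤ t)
    (h3 : ‖φ (ψ (b * star b)) - b * star b‖ ≤ t) :
    rn (fun d => b * y d - ∑ c, Matrix.blockDiagonal' (ψ b) c d • y c) ^ 2 ≤
      4 * B ^ 2 * δ + (2 * B + 1) * t := by
  let _ : PartialOrder (FDBlock s r) := CStarAlgebra.spectralOrder (FDBlock s r)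
  have _ : StarOrderedRing (FDBlock s r) := CStarAlgebra.spectralOrderedRing (FDBlock s r)
  set X := ψ b with hX
  have hone : ‖(1 : D)‖ ≤ 1 := by
    rcases subsingleton_or_nontrivial D with h | h
    · rw [Subsingleton.elim (1 : D) 0]; simp
    · exact CStarRing.norm_one.le
  have hXn : ‖X‖ ≤ B := (hψn b).trans hb
  have hB0 : 0 ≤ B := by linarith
  rw [rn_sq, sum_RR]
  have es : star (Matrix.blockDiagonal' X) = Matrix.blockDiagonal' (star X) := by
    rw [Matrix.star_eq_conjTranspose, Matrix.blockDiagonal'_conjTranspose]; rfl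
  have em : Matrix.blockDiagonal' X * Matrix.blockDiagonal' (star X) =
      Matrix.blockDiagonal' (X * star X) := (Matrix.blockDiagonal'_mul _ _).symm
  have e1 : (1 : Matrix (Σ i : Fin s, Fin (r i)) (Σ i : Fin s, Fin (r i)) ℂ) =
      Matrix.blockDiagonal' (1 : FDBlock s r) := Matrix.blockDiagonal'_one.symm
  have hN : 0 ≤ b * PhiM y 1 * star b - b * PhiM y (star (Matrix.blockDiagonal' X)) -
      PhiM y (Matrix.blockDiagonal' X) * star b +
      PhiM y (Matrix.blockDiagonal' X * star (Matrix.blockDiagonal' X)) := by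
    rw [← sum_RR]
    exact Finset.sum_nonneg fun d _ => mul_star_self_nonneg _
  rw [es, em, e1] at *
  set N := b * PhiM y (Matrix.blockDiagonal' 1) * star b -
    b * PhiM y (Matrix.blockDiagonal' (star X)) -
      PhiM y (Matrix.blockDiagonal' X) * star b +
      PhiM y (Matrix.blockDiagonal' (X * star X)) with hNdef
  have hXs : ψ (star b) = star X := cp_star hψ b
  have hψ1 : ‖ψ 1‖ ≤ 1 := (hψn 1).trans hone
  have hφ1 : ‖φ 1‖ ≤ 1 := (hn 1).trans norm_FD_one_le
  have hK : 0 ≤ φ (ψ (b * star b)) - φ (X * star X) := by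
    rw [← map_sub]
    exact cp_nonneg' hφ (cp_kadison hψ hψ1 b)
  have hφ1' : 0 ≤ 1 - φ 1 := one_sub_nonneg_of_norm_le (by simpa using cp_nonneg hφ 1) hφ1
  have hP : 0 ≤ b * (1 - φ 1) * star b := by
    simpa using star_left_conjugate_nonneg hφ1' (star b)
  have hNle : N ≤ N + (b * (1 - φ 1) * star b + (φ (ψ (b * star b)) - φ (X * star X))) :=
    le_add_of_nonneg_right (add_nonneg hP hK)
  have e : N + (b * (1 - φ 1) * star b + (φ (ψ (b * star b)) - φ (X * star X))) =
      (b * (PhiM y (Matrix.blockDiagonal' 1) - φ 1) * star b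
        - b * (PhiM y (Matrix.blockDiagonal' (star X)) - φ (star X))
        - (PhiM y (Matrix.blockDiagonal' X) - φ X) * star b
        + (PhiM y (Matrix.blockDiagonal' (X * star X)) - φ (X * star X)))
      + ((φ (ψ (b * star b)) - b * star b) - b * (φ (star X) - star b)
        - (φ X - b) * star b) := by
    rw [hNdef]; noncomm_ring
  rw [e] at hNle
  refine (CStarAlgebra.norm_le_norm_of_nonneg_of_le hN hNle).trans ?_
  rw [hXs] at h2
  have n1 : ‖b * (PhiM y (Matrix.blockDiagonal' 1) - φ 1) * star b‖ ≤ B * (δ * 1) * B := by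
    refine (norm_mul_le _ _).trans ?_
    rw [norm_star]
    gcongr
    refine (norm_mul_le _ _).trans ?_
    gcongr
    refine (hΦ 1).trans ?_
    gcongr
    exact norm_FD_one_le
  have n2 : ‖b * (PhiM y (Matrix.blockDiagonal' (star X)) - φ (star X))‖ ≤ B * (δ * B) := by
    refine (norm_mul_le _ _).trans ?_
    gcongr
    refine (hΦ _).trans ?_
    rw [norm_star]
    gcongr
  have n3 : ‖(PhiM y (Matrix.blockDiagonal' X) - φ X) * star b‖ ≤ (δ * B) * B := by
    refine (norm_mul_le _ _).trans ?_
    rw [norm_star]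
    gcongr
    refine (hΦ _).trans ?_
    gcongr
  have n4 : ‖PhiM y (Matrix.blockDiagonal' (X * star X)) - φ (X * star X)‖ ≤ δ * (B * B) := by
    refine (hΦ _).trans ?_
    gcongr
    refine (norm_mul_le _ _).trans ?_
    rw [norm_star]
    gcongr
  have n5 : ‖b * (φ (star X) - star b)‖ ≤ B * t := by
    refine (norm_mul_le _ _).trans ?_
    gcongr
  have n6 : ‖(φ X - b) * star b‖ ≤ t * B := by
    refine (norm_mul_le _ _).trans ?_
    rw [norm_star]
    gcongr
  refine (norm_add_le _ _).trans ?_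
  have m1 := norm_add_le (b * (PhiM y (Matrix.blockDiagonal' 1) - φ 1) * star b
        - b * (PhiM y (Matrix.blockDiagonal' (star X)) - φ (star X))
        - (PhiM y (Matrix.blockDiagonal' X) - φ X) * star b)
        (PhiM y (Matrix.blockDiagonal' (X * star X)) - φ (X * star X))
  have m2 := norm_sub_le (b * (PhiM y (Matrix.blockDiagonal' 1) - φ 1) * star b
        - b * (PhiM y (Matrix.blockDiagonal' (star X)) - φ (star X)))
        ((PhiM y (Matrix.blockDiagonal' X) - φ X) * star b)
  have m3 := norm_sub_le (b * (PhiM y (Matrix.blockDiagonal' 1) - φ 1) * star b)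
        (b * (PhiM y (Matrix.blockDiagonal' (star X)) - φ (star X)))
  have m4 := norm_sub_le ((φ (ψ (b * star b)) - b * star b) - b * (φ (star X) - star b))
        ((φ X - b) * star b)
  have m5 := norm_sub_le (φ (ψ (b * star b)) - b * star b) (b * (φ (star X) - star b))
  nlinarith

theorem starP_of_DR (n : ℕ) (D : Type) [CStarAlgebra D] (h : DecompositionRankLE n D) :
    StarP n D := by
  classical
  let _ := CStarAlgebra.spectralOrder D
  have _ := CStarAlgebra.spectralOrderedRing D
  intro S ε hε
  obtain ⟨B, hB, hSB⟩ : ∃ B : ℝ, 1 ≤ B ∧ ∀ b ∈ S, ‖b‖ ≤ B := by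
    refine ⟨1 + ∑ b ∈ S, ‖b‖, ?_, fun b hb => ?_⟩
    · have := Finset.sum_nonneg (fun b (_ : b ∈ S) => norm_nonneg b); linarith
    · have := Finset.single_le_sum (f := fun b : D => ‖b‖) (fun b _ => norm_nonneg b) hb
      linarith
  obtain ⟨C, hC⟩ : ∃ C : ℝ, C = 4 * B ^ 2 * (n + 1) + 2 * B + 1 + (n + 1) + 1 := ⟨_, rfl⟩
  have hC0 : 0 < C := by rw [hC]; positivity
  obtain ⟨t, ht, ht1, ht2⟩ : ∃ t : ℝ, 0 < t ∧ C * t ≤ ε ∧ C * t ≤ ε ^ 2 := by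
    refine ⟨min ε (ε ^ 2) / C, by positivity, ?_, ?_⟩
    · rw [mul_div_cancel₀ _ hC0.ne']; exact min_le_left _ _
    · rw [mul_div_cancel₀ _ hC0.ne']; exact min_le_right _ _
  obtain ⟨s, r, J, ψ, φ, hψ, hφ, hψn, hn, ho, hS⟩ :=
    h (insert 1 (S ∪ S.image star ∪ S.image (fun b => b * star b))) t ht
  have hh0 : ∀ j, 0 ≤ φ (cUnit r J j) := by
    intro j
    have := cp_nonneg hφ (cUnit r J j)
    have e : star (cUnit r J j) * cUnit r J j = cUnit r J j := by
      funext i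
      by_cases e : J i = j <;> simp [cUnit, e]
    rwa [e] at this
  choose gg hg hc hgn using fun j => exists_g (hh0 j) (pow_pos ht 2)
  have hΦ : ∀ x : FDBlock s r, ‖PhiM (yy φ (fun i => gg (J i))) (Matrix.blockDiagonal' x) - φ x‖ ≤
      ((n + 1) * t) * ‖x‖ := fun x => PhiM_yy_sub hφ hn ho hg hc ht hgn x
  have hone : ‖(1 : D)‖ ≤ 1 := by
    rcases subsingleton_or_nontrivial D with h | h
    · rw [Subsingleton.elim (1 : D) 0]; simp
    · exact CStarRing.norm_one.le
  refine ⟨Σ i : Fin s, Fin (r i), Fin s, inferInstance, inferInstance, inferInstance,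
    inferInstance, Sigma.fst, J, yy φ (fun i => gg (J i)),
    fun i => if hr : 0 < r i then gg (J i) * gg (J i) * φ (cUnit r J (J i)) *
      φ (EE r i ⟨0, hr⟩ ⟨0, hr⟩) else 0, fun b => Matrix.blockDiagonal' (ψ b), ?_, ?_, ?_, ?_⟩
  · rintro b ⟨i, a⟩ ⟨i', a'⟩ hne
    exact Matrix.blockDiagonal'_apply_ne _ _ _ hne
  · intro c d hcd
    rw [star_yy_mul hφ ho hg hc c d hcd]
    by_cases e1 : c = d
    · rw [if_pos e1, if_pos e1]
      dsimp only
      rw [dif_pos c.2.pos]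
      rfl
    · rw [if_neg e1, if_neg e1]
  · have e1 : (1 : Matrix (Σ i : Fin s, Fin (r i)) (Σ i : Fin s, Fin (r i)) ℂ) =
      Matrix.blockDiagonal' (1 : FDBlock s r) := Matrix.blockDiagonal'_one.symm
    rw [← PhiM_one, e1]
    have k1 := hΦ 1
    have k2 : ‖1 - φ 1‖ ≤ t := by
      let _ : PartialOrder (FDBlock s r) := CStarAlgebra.spectralOrder (FDBlock s r)
      have _ : StarOrderedRing (FDBlock s r) := CStarAlgebra.spectralOrderedRing (FDBlock s r)
      have hψ1 : ‖ψ 1‖ ≤ 1 := (hψn 1).trans hone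
      have hφ1 : ‖φ 1‖ ≤ 1 := (hn 1).trans norm_FD_one_le
      have a1 : 0 ≤ 1 - φ 1 := one_sub_nonneg_of_norm_le (by simpa using cp_nonneg hφ 1) hφ1
      have a2 : 0 ≤ 1 - ψ 1 := one_sub_nonneg_of_norm_le (by simpa using cp_nonneg hψ 1) hψ1
      have a3 : 0 ≤ φ (1 - ψ 1) := cp_nonneg' hφ a2
      rw [map_sub] at a3
      have a4 : 1 - φ 1 ≤ 1 - φ (ψ 1) := sub_le_sub_left (sub_nonneg.1 a3) 1
      refine (CStarAlgebra.norm_le_norm_of_nonneg_of_le a1 a4).trans ?_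
      rw [norm_sub_rev]
      exact (hS 1 (by simp)).le
    have k3 := norm_FD_one_le (r := r)
    have k4 : ((n : ℝ) + 1) * t * ‖(1 : FDBlock s r)‖ ≤ (n + 1) * t * 1 := by gcongr
    have k5 : ‖PhiM (yy φ (fun i => gg (J i))) (Matrix.blockDiagonal' (1 : FDBlock s r)) - 1‖ ≤
      ‖PhiM (yy φ (fun i => gg (J i))) (Matrix.blockDiagonal' (1 : FDBlock s r)) - φ 1‖
        + ‖1 - φ 1‖ := by
      rw [norm_sub_rev 1]
      exact norm_sub_le_norm_sub_add_norm_sub _ _ _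
    have k6 : ((n : ℝ) + 1) * t + t ≤ C * t := by
      rw [hC]; nlinarith [mul_nonneg (sq_nonneg B) (by positivity : (0:ℝ) ≤ n + 1)]
    linarith
  · intro b hb
    have := step1_err hφ hψ hψn hn (by positivity : 0 ≤ ((n : ℝ) + 1) * t) ht.le hB hΦ b (hSB b hb)
      (hS b (by simp [hb])).le
      (hS (star b) (by simp [hb])).le (hS (b * star b) (by
        simp only [Finset.mem_insert, Finset.mem_union, Finset.mem_image]
        exact Or.inr (Or.inr ⟨b, hb, rfl⟩))).le
    refine (abs_le_of_sq_le_sq' (this.trans (le_trans ?_ ht2)) hε.le).2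
    rw [hC]
    have : 0 ≤ ((n : ℝ) + 1) * t + t := by positivity
    nlinarith

/-! ### Perturbation: exact square roots -/

section Pert
variable {M : Type*} [CStarAlgebra M] [PartialOrder M] [StarOrderedRing M]

theorem pert_H {a b r E : M} (hr : star r = r) (hra : r * r = a) (hab : a ≤ b)
    (hE : star E = E) : ‖r * (E * E) * r‖ ≤ ‖E * b * E‖ := by
  have e1 : r * (E * E) * r = star (E * r) * (E * r) := by
    rw [star_mul, hr, hE]; noncomm_ring
  have e2 : E * r * star (E * r) = E * a * E := by
    rw [star_mul, hr, hE, ← hra]; noncomm_ring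
  rw [e1, CStarRing.norm_star_mul_self, ← CStarRing.norm_self_mul_star, e2]
  apply CStarAlgebra.norm_le_norm_of_nonneg_of_le
  · rw [← e2]; exact mul_star_self_nonneg _
  · have := star_left_conjugate_le_conjugate hab E
    rwa [hE] at this

theorem exists_gs (σ : ℝ) (hσ : 0 < σ) : ∃ g : ℝ → ℝ, Continuous g ∧
    (∀ t, 0 ≤ t → g t * g t * (t + σ ^ 2) = 1 ∧ 0 < g t ∧ Real.sqrt t - σ ≤ t * g t ∧
      t * g t ≤ Real.sqrt t) := by
  refine ⟨fun t => (Real.sqrt (|t| + σ ^ 2))⁻¹, ?_, fun t ht => ?_⟩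
  · refine Continuous.inv₀ (by fun_prop) fun t => ?_
    have : 0 < |t| + σ ^ 2 := by positivity
    exact (Real.sqrt_pos.2 this).ne'
  · have h0 : 0 < t + σ ^ 2 := by positivity
    have h1 := Real.sqrt_pos.2 h0
    have h2 : Real.sqrt (t + σ ^ 2) ^ 2 = t + σ ^ 2 := Real.sq_sqrt h0.le
    have h3 : Real.sqrt t ^ 2 = t := Real.sq_sqrt ht
    have h4 := Real.sqrt_nonneg t
    simp only [abs_of_nonneg ht]
    set w := Real.sqrt (t + σ ^ 2)
    set v := Real.sqrt t
    have hwv : v ≤ w := Real.sqrt_le_sqrt (by nlinarith)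
    have hws : w ≤ v + σ := by
      by_contra hc
      push Not at hc
      nlinarith
    refine ⟨?_, inv_pos.2 h1, ?_, ?_⟩
    · rw [← h2]; field_simp
    · rw [← div_eq_mul_inv, le_div_iff₀ h1, ← h3]; nlinarith
    · rw [← div_eq_mul_inv, div_le_iff₀ h1, ← h3]; nlinarith

theorem exists_sqrt_el {a : M} (ha : 0 ≤ a) : ∃ r : M, 0 ≤ r ∧ star r = r ∧ r * r = a :=
  ⟨CFC.sqrt a, CFC.sqrt_nonneg a, (CFC.sqrt_nonneg a).isSelfAdjoint, CFC.sqrt_mul_sqrt_self a ha⟩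

theorem cfc_sandwich {b : M} (hb : IsSelfAdjoint b) {f : ℝ → ℝ} (hf : Continuous f) :
    cfc f b * b * cfc f b = cfc (fun t => f t * t * f t) b := by
  have hid : b = cfc (fun t : ℝ => t) b := (cfc_id' ℝ b).symm
  have : cfc f b * b = cfc (fun t => f t * t) b := by
    rw [cfc_mul .., ← hid]
  rw [this, ← cfc_mul ..]

/-- one step of the polar decomposition -/
theorem pert_step {X a : M} (ha : 0 ≤ a) (hab : a ≤ star X * X) {c : ℝ} (hc : 0 ≤ c)
    (hn : ‖star X * X - a‖ ≤ c) :
    ∃ u : ℕ → M, (∀ m, ‖u m - u (m + 1)‖ ≤ 1 * (1 / 2 : ℝ) ^ m) ∧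
      (∀ m, ‖a - star (u m) * u m‖ ≤ ((1 / 2 : ℝ) ^ m) ^ 2) ∧
      (∀ m, ‖u m - X‖ ≤ Real.sqrt (c + ((1 / 2 : ℝ) ^ m) ^ 2)) ∧
      ∀ R : M, R * X = X → ∀ m, R * u m = u m := by
  obtain ⟨r, hr0, hrs, hra⟩ := exists_sqrt_el ha
  obtain ⟨b, hb⟩ : ∃ b, b = star X * X := ⟨_, rfl⟩
  have hb0 : 0 ≤ b := hb ▸ star_mul_self_nonneg _
  have hbs : IsSelfAdjoint b := hb0.isSelfAdjoint
  rw [← hb] at hab hn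
  have hsp : ∀ x ∈ spectrum ℝ b, 0 ≤ x := fun x hx => spectrum_nonneg_of_nonneg hb0 hx
  choose g hgc hg using fun m : ℕ => exists_gs ((1 / 2 : ℝ) ^ m) (by positivity)
  have hid : b = cfc (fun t : ℝ => t) b := (cfc_id' ℝ b).symm
  have hsa : ∀ f : ℝ → ℝ, star (cfc f b) = cfc f b := fun f => (cfc_predicate f b : IsSelfAdjoint _)
  refine ⟨fun m => X * cfc (g m) b * r, fun m => ?_, fun m => ?_, fun m => ?_, fun R hR m => ?_⟩
  · have e : X * cfc (g m) b * r - X * cfc (g (m + 1)) b * r =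
        X * cfc (fun t => g m t - g (m + 1) t) b * r := by
      rw [cfc_sub (g m) (g (m + 1)) b (hgc _).continuousOn (hgc _).continuousOn]; noncomm_ring
    have hc' : Continuous fun t => g m t - g (m + 1) t := (hgc m).sub (hgc (m + 1))
    have hb1 : ∀ t, 0 ≤ t → |t * (g m t - g (m + 1) t)| ≤ (1 / 2 : ℝ) ^ m := by
      intro t ht
      obtain ⟨-, -, h1, h2⟩ := hg m t ht
      obtain ⟨-, -, h3, h4⟩ := hg (m + 1) t ht
      have : (1 / 2 : ℝ) ^ (m + 1) ≤ (1 / 2 : ℝ) ^ m :=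
        pow_le_pow_of_le_one (by norm_num) (by norm_num) (Nat.le_succ m)
      rw [abs_le]; constructor <;> nlinarith
    obtain ⟨h, hh⟩ : ∃ h : ℝ → ℝ, h = fun t => g m t - g (m + 1) t := ⟨_, rfl⟩
    rw [e, ← hh]
    rw [← hh] at hc'
    have hb2 : ∀ t, 0 ≤ t → |t * h t| ≤ (1 / 2 : ℝ) ^ m := by rw [hh]; exact hb1
    have e2 : star (X * cfc h b * r) * (X * cfc h b * r) =
        r * (cfc (fun t => h t * Real.sqrt t) b * cfc (fun t => h t * Real.sqrt t) b) * r := by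
      have : cfc (fun t => h t * Real.sqrt t) b * cfc (fun t => h t * Real.sqrt t) b =
          cfc h b * b * cfc h b := by
        rw [cfc_sandwich hbs hc', ← cfc_mul ..]
        apply cfc_congr
        intro t ht
        have := Real.mul_self_sqrt (hsp t ht)
        dsimp only
        linear_combination (h t * h t) * this
      rw [this, star_mul, star_mul, hsa, hrs, hb]; noncomm_ring
    have e3 : ‖X * cfc h b * r‖ ^ 2 ≤ ((1 / 2 : ℝ) ^ m) ^ 2 := by
      rw [sq, ← CStarRing.norm_star_mul_self, e2]
      refine (pert_H hrs hra hab (hsa _)).trans ?_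
      rw [cfc_sandwich hbs (by fun_prop)]
      apply norm_cfc_le (by positivity)
      intro t ht
      have h0 := hsp t ht
      have := Real.mul_self_sqrt h0
      have e4 : h t * Real.sqrt t * t * (h t * Real.sqrt t) = (t * h t) ^ 2 := by
        linear_combination (h t * h t * t) * this
      rw [e4, Real.norm_eq_abs, abs_of_nonneg (sq_nonneg _), ← sq_abs]
      have := hb2 t h0
      gcongr
    rw [one_mul]
    exact (abs_le_of_sq_le_sq' e3 (by positivity)).2
  · obtain ⟨σ, hσ, hσ0⟩ : ∃ σ : ℝ, σ = (1 / 2 : ℝ) ^ m ∧ 0 < σ := ⟨_, rfl, by positivity⟩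
    rw [← hσ]
    have e : a - star (X * cfc (g m) b * r) * (X * cfc (g m) b * r) =
        r * (cfc (fun t => σ * g m t) b * cfc (fun t => σ * g m t) b) * r := by
      have : cfc (fun t => σ * g m t) b * cfc (fun t => σ * g m t) b =
          1 - cfc (g m) b * b * cfc (g m) b := by
        have hcg := hgc m
        rw [cfc_sandwich hbs hcg, ← cfc_mul .., ← cfc_const_one ℝ b, ← cfc_sub ..]
        apply cfc_congr
        intro t ht
        have := (hg m t (hsp t ht)).1
        dsimp only
        rw [← hσ] at this
        linear_combination this
      rw [this, star_mul, star_mul, hsa, hrs, hb, ← hra]; noncomm_ring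
    rw [e]
    have hcg := hgc m
    refine (pert_H hrs hra hab (hsa _)).trans ?_
    rw [cfc_sandwich hbs (by fun_prop)]
    apply norm_cfc_le (by positivity)
    intro t ht
    have h0 := hsp t ht
    have := (hg m t h0).1
    rw [← hσ] at this
    have e4 : σ * g m t * t * (σ * g m t) = σ ^ 2 * (g m t * g m t * t) := by ring
    have h5 : 0 ≤ g m t * g m t * t := mul_nonneg (mul_self_nonneg _) h0
    rw [e4, Real.norm_eq_abs, abs_of_nonneg (by positivity)]
    have h6 : g m t * g m t * t ≤ 1 := by nlinarith [mul_self_nonneg (g m t), sq_nonneg σ, mul_nonneg (mul_self_nonneg (g m t)) (sq_nonneg σ)]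
    nlinarith [sq_nonneg σ]
  · obtain ⟨σ, hσ, hσ0⟩ : ∃ σ : ℝ, σ = (1 / 2 : ℝ) ^ m ∧ 0 < σ := ⟨_, rfl, by positivity⟩
    rw [← hσ]
    have hcg := hgc m
    have hf : ∃ f : ℝ → ℝ, Continuous f ∧ (∀ t, 0 ≤ t → 0 ≤ f t ∧ f t * f t = t + σ ^ 2) ∧
        ∀ t, 0 ≤ t → g m t * f t = 1 := by
      refine ⟨fun t => Real.sqrt (t + σ ^ 2), by fun_prop, fun t ht => ⟨Real.sqrt_nonneg _,
        Real.mul_self_sqrt (by positivity)⟩, fun t ht => ?_⟩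
      obtain ⟨h1, h2, -, -⟩ := hg m t ht
      rw [← hσ] at h1
      have h3 : (g m t * Real.sqrt (t + σ ^ 2)) * (g m t * Real.sqrt (t + σ ^ 2)) = 1 := by
        have := Real.mul_self_sqrt (by positivity : 0 ≤ t + σ ^ 2)
        linear_combination h1 + g m t * g m t * this
      have h4 : 0 ≤ g m t * Real.sqrt (t + σ ^ 2) := by positivity
      dsimp only
      nlinarith
    obtain ⟨f, hfc, hf, hgf⟩ := hf
    have hf0 : 0 ≤ cfc f b := cfc_nonneg fun t ht => (hf t (hsp t ht)).1
    have hff : cfc f b * cfc f b = b + algebraMap ℝ M (σ ^ 2) := by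
      conv_rhs => rw [hid]
      rw [← cfc_mul .., ← cfc_const (σ ^ 2) b, ← cfc_add ..]
      exact cfc_congr fun t ht => (hf t (hsp t ht)).2
    have hgf' : cfc (g m) b * cfc f b = 1 := by
      rw [← cfc_mul .., ← cfc_const_one ℝ b]
      exact cfc_congr fun t ht => hgf t (hsp t ht)
    have e1 : X * cfc (g m) b * r - X = X * cfc (g m) b * (r - cfc f b) := by
      rw [mul_sub, mul_assoc X (cfc (g m) b) (cfc f b), hgf', mul_one]
    have e2 : ‖X * cfc (g m) b‖ ≤ 1 := by
      have : ‖X * cfc (g m) b‖ ^ 2 ≤ 1 := by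
        rw [sq, ← CStarRing.norm_star_mul_self, star_mul, hsa]
        have : cfc (g m) b * star X * (X * cfc (g m) b) = cfc (g m) b * b * cfc (g m) b := by
          rw [hb]; noncomm_ring
        rw [this]
        rw [cfc_sandwich hbs hcg]
        apply norm_cfc_le (by positivity)
        intro t ht
        have h0 := hsp t ht
        have := (hg m t h0).1
        have h5 : 0 ≤ g m t * g m t * t := mul_nonneg (mul_self_nonneg _) h0
        have e4 : g m t * t * g m t = g m t * g m t * t := by ring
        rw [e4, Real.norm_eq_abs, abs_of_nonneg h5]
        nlinarith [mul_nonneg (mul_self_nonneg (g m t)) (sq_nonneg ((1 / 2 : ℝ) ^ m))]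
      nlinarith [norm_nonneg (X * cfc (g m) b)]
    have e3 : ‖r - cfc f b‖ ≤ Real.sqrt (c + σ ^ 2) := by
      have hs0 : 0 ≤ c + σ ^ 2 := by positivity
      obtain ⟨q, hq⟩ : ∃ q, q = Real.sqrt (c + σ ^ 2) := ⟨_, rfl⟩
      have hq0 : 0 ≤ q := hq ▸ Real.sqrt_nonneg _
      have hqq : q * q = c + σ ^ 2 := hq ▸ Real.mul_self_sqrt hs0
      rw [← hq]
      have hσM : (0 : M) ≤ algebraMap ℝ M (σ ^ 2) := algebraMap_nonneg M (sq_nonneg σ)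
      have hqM : (0 : M) ≤ algebraMap ℝ M q := algebraMap_nonneg M hq0
      have k1 : r ≤ cfc f b := by
        have := CFC.sqrt_le_sqrt a (b + algebraMap ℝ M (σ ^ 2)) (hab.trans (le_add_of_nonneg_right hσM))
        rwa [CFC.sqrt_unique hra hr0, CFC.sqrt_unique hff hf0] at this
      have k2 : cfc f b ≤ r + algebraMap ℝ M q := by
        have hsq : (r + algebraMap ℝ M q) * (r + algebraMap ℝ M q) =
            a + 2 • (r * algebraMap ℝ M q) + algebraMap ℝ M (c + σ ^ 2) := by
          rw [← hqq, map_mul, ← hra]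
          have : algebraMap ℝ M q * r = r * algebraMap ℝ M q := Algebra.commutes q r
          rw [mul_add, add_mul, add_mul, this]; abel
        have k3 : b + algebraMap ℝ M (σ ^ 2) ≤ a + 2 • (r * algebraMap ℝ M q) +
            algebraMap ℝ M (c + σ ^ 2) := by
          have k4 : b - a ≤ algebraMap ℝ M c := by
            have : IsSelfAdjoint (b - a) := hbs.sub ha.isSelfAdjoint
            exact (IsSelfAdjoint.le_algebraMap_norm_self this).trans (algebraMap_mono M hn)
          have k5 : 0 ≤ 2 • (r * algebraMap ℝ M q) := by
            apply nsmul_nonneg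
            rw [← Algebra.commutes, ← Algebra.smul_def]; exact smul_nonneg hq0 hr0
          rw [map_add]
          calc b + algebraMap ℝ M (σ ^ 2) = a + 0 + ((b - a) + algebraMap ℝ M (σ ^ 2)) := by abel
            _ ≤ _ := by gcongr
        have := CFC.sqrt_le_sqrt _ _ k3
        rwa [CFC.sqrt_unique hsq (add_nonneg hr0 hqM), CFC.sqrt_unique hff hf0] at this
      rw [norm_sub_rev]
      refine (CStarAlgebra.norm_le_iff_le_algebraMap _ hq0 (sub_nonneg.2 k1)).2 ?_
      rw [sub_le_iff_le_add, add_comm]; exact k2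
    rw [e1]
    refine (norm_mul_le _ _).trans ?_
    nlinarith [norm_nonneg (r - cfc f b)]
  · simp only [← mul_assoc, hR]

theorem pert_douglas {X a : M} (ha : 0 ≤ a) (hab : a ≤ star X * X) {c : ℝ} (hc : 0 ≤ c)
    (hn : ‖star X * X - a‖ ≤ c) :
    ∃ u : M, star u * u = a ∧ ‖u - X‖ ≤ Real.sqrt c ∧ ∀ R : M, R * X = X → R * u = u := by
  obtain ⟨u, h1, h2, h3, h4⟩ := pert_step ha hab hc hn
  have hp : Tendsto (fun m : ℕ => ((1 / 2 : ℝ) ^ m) ^ 2) atTop (𝓝 0) := by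
    have := tendsto_pow_atTop_nhds_zero_of_lt_one (r := (1 / 2 : ℝ)) (by norm_num) (by norm_num)
    simpa using this.pow 2
  have hcau : CauchySeq u := cauchySeq_of_le_geometric (1 / 2) 1 (by norm_num) (fun m => by
    rw [dist_eq_norm]; exact h1 m)
  obtain ⟨v, hv⟩ := cauchySeq_tendsto_of_complete hcau
  refine ⟨v, ?_, ?_, fun R hR => ?_⟩
  · have t1 : Tendsto (fun m => a - star (u m) * u m) atTop (𝓝 (a - star v * v)) :=
      tendsto_const_nhds.sub (hv.star.mul hv)
    have t2 : Tendsto (fun m => a - star (u m) * u m) atTop (𝓝 0) :=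
      squeeze_zero_norm h2 hp
    exact (sub_eq_zero.1 (tendsto_nhds_unique t1 t2)).symm
  · have t1 : Tendsto (fun m => ‖u m - X‖) atTop (𝓝 ‖v - X‖) := (hv.sub_const X).norm
    have t2 : Tendsto (fun m : ℕ => Real.sqrt (c + ((1 / 2 : ℝ) ^ m) ^ 2)) atTop
        (𝓝 (Real.sqrt (c + 0))) := (Real.continuous_sqrt.tendsto _).comp (hp.const_add c)
    rw [add_zero] at t2
    exact le_of_tendsto_of_tendsto' t1 t2 h3
  · have t1 : Tendsto (fun m => R * u m) atTop (𝓝 (R * v)) := hv.const_mul R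
    simp only [h4 R hR] at t1
    exact tendsto_nhds_unique t1 hv

def eP (δ t : ℝ) : ℝ := min 1 (max 0 ((t - δ) / δ))
def fP (δ t : ℝ) : ℝ := eP δ t * (t - δ) * eP δ t

theorem eP_cont (δ : ℝ) : Continuous (eP δ) := by unfold eP; fun_prop
theorem fP_cont (δ : ℝ) : Continuous (fP δ) := by unfold fP; have := eP_cont δ; fun_prop
theorem eP_nonneg (δ t : ℝ) : 0 ≤ eP δ t := le_min zero_le_one (le_max_left _ _)
theorem eP_le (δ t : ℝ) : eP δ t ≤ 1 := min_le_left _ _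
theorem eP_zero {δ t : ℝ} (hδ : 0 < δ) (ht : t ≤ δ) : eP δ t = 0 := by
  have : (t - δ) / δ ≤ 0 := div_nonpos_of_nonpos_of_nonneg (by linarith) hδ.le
  simp [eP, max_eq_left this]
theorem eP_one {δ t : ℝ} (hδ : 0 < δ) (ht : 2 * δ ≤ t) : eP δ t = 1 := by
  have : 1 ≤ (t - δ) / δ := by rw [le_div_iff₀ hδ]; linarith
  exact min_eq_left (this.trans (le_max_right _ _))
theorem fP_nonneg {δ : ℝ} (hδ : 0 < δ) (t : ℝ) : 0 ≤ fP δ t := by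
  rcases le_total t δ with h | h
  · simp [fP, eP_zero hδ h]
  · exact mul_nonneg (mul_nonneg (eP_nonneg _ _) (by linarith)) (eP_nonneg _ _)
theorem fP_zero {δ : ℝ} (hδ : 0 < δ) : fP δ 0 = 0 := by simp [fP, eP_zero hδ hδ.le]

theorem pert {Y K : M} (hK : 0 ≤ K) {δ : ℝ} (hδ : 0 < δ) (h : ‖star Y * Y - K‖ ≤ δ) :
    ∃ Z : M, star Z * Z = cfc (fP δ) K ∧ ‖Z - Y‖ ≤ 4 * Real.sqrt δ ∧
      ∀ R : M, R * Y = Y → R * Z = Z := by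
  have hKs : IsSelfAdjoint K := hK.isSelfAdjoint
  have hsp : ∀ x ∈ spectrum ℝ K, 0 ≤ x := fun x hx => spectrum_nonneg_of_nonneg hK hx
  have hec := eP_cont δ
  obtain ⟨e, he⟩ : ∃ e, e = cfc (eP δ) K := ⟨_, rfl⟩
  have hes : star e = e := by rw [he]; exact (cfc_predicate (eP δ) K : IsSelfAdjoint _)
  have hen : ‖e‖ ≤ 1 := by
    rw [he]; apply norm_cfc_le zero_le_one
    intro t _; rw [Real.norm_eq_abs, abs_of_nonneg (eP_nonneg _ _)]; exact eP_le _ _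
  have hone : ‖(1 - e)‖ ≤ 1 := by
    rw [he, ← cfc_const_one ℝ K, ← cfc_sub ..]; apply norm_cfc_le zero_le_one
    intro t _; rw [Real.norm_eq_abs, abs_le]
    constructor <;> linarith [eP_nonneg δ t, eP_le δ t]
  have ha : e * (K - algebraMap ℝ M δ) * e = cfc (fP δ) K := by
    have : K - algebraMap ℝ M δ = cfc (fun t => t - δ) K := by
      rw [cfc_sub .., cfc_id' ℝ K, cfc_const δ K]
    rw [he, this, ← cfc_mul .., ← cfc_mul ..]
    rfl
  have ha0 : 0 ≤ cfc (fP δ) K := cfc_nonneg fun t _ => fP_nonneg hδ t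
  have hX : star (Y * e) * (Y * e) = e * (star Y * Y) * e := by
    rw [star_mul, hes]; noncomm_ring
  have hT : K - algebraMap ℝ M δ ≤ star Y * Y := by
    have s1 : IsSelfAdjoint (star Y * Y - K) := (IsSelfAdjoint.star_mul_self Y).sub hKs
    have s2 := IsSelfAdjoint.neg_algebraMap_norm_le_self s1
    have s3 := algebraMap_mono M h
    have s4 : -algebraMap ℝ M δ ≤ star Y * Y - K := (neg_le_neg s3).trans s2
    calc K - algebraMap ℝ M δ = -algebraMap ℝ M δ + K := by abel
      _ ≤ _ := le_sub_iff_add_le.1 s4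
  have hab : cfc (fP δ) K ≤ star (Y * e) * (Y * e) := by
    rw [hX, ← ha]
    have := star_left_conjugate_le_conjugate hT e
    rwa [hes] at this
  have hδn : ‖algebraMap ℝ M δ‖ ≤ δ := by
    rw [Algebra.algebraMap_eq_smul_one, norm_smul, Real.norm_eq_abs, abs_of_pos hδ]
    have hone : ‖(1 : M)‖ ≤ 1 := by
      rcases subsingleton_or_nontrivial M with h | h
      · rw [Subsingleton.elim (1 : M) 0]; simp
      · exact CStarRing.norm_one.le
    nlinarith
  have hn : ‖star (Y * e) * (Y * e) - cfc (fP δ) K‖ ≤ 2 * δ := by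
    have : star (Y * e) * (Y * e) - cfc (fP δ) K =
        e * ((star Y * Y - K) + algebraMap ℝ M δ) * e := by
      rw [hX, ← ha]; noncomm_ring
    rw [this]
    have h1 := norm_mul_le (e * ((star Y * Y - K) + algebraMap ℝ M δ)) e
    have h2 := norm_mul_le e ((star Y * Y - K) + algebraMap ℝ M δ)
    have h3 := norm_add_le (star Y * Y - K) (algebraMap ℝ M δ)
    have h4 := norm_nonneg e
    have h5 : ‖e‖ * ‖(star Y * Y - K) + algebraMap ℝ M δ‖ ≤ 1 * (2 * δ) := by gcongr; linarith
    nlinarith [norm_nonneg (e * ((star Y * Y - K) + algebraMap ℝ M δ))]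
  obtain ⟨u, h1, h2, h3⟩ := pert_douglas ha0 hab (by positivity) hn
  have hYe : ‖Y * e - Y‖ ≤ 2 * Real.sqrt δ := by
    have e1 : ‖Y * (1 - e)‖ ^ 2 ≤ 3 * δ := by
      rw [sq, ← CStarRing.norm_star_mul_self, star_mul, star_sub, star_one, hes]
      have : (1 - e) * star Y * (Y * (1 - e)) = (1 - e) * (star Y * Y - K) * (1 - e) +
        (1 - e) * K * (1 - e) := by noncomm_ring
      rw [this]
      have k1 : ‖(1 - e) * (star Y * Y - K) * (1 - e)‖ ≤ 1 * δ * 1 := by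
        refine (norm_mul_le _ _).trans (mul_le_mul ((norm_mul_le _ _).trans ?_) hone (norm_nonneg _) (by positivity))
        gcongr
      have k2 : ‖(1 - e) * K * (1 - e)‖ ≤ 2 * δ := by
        have : 1 - e = cfc (fun t => 1 - eP δ t) K := by
          rw [cfc_sub .., ← he, cfc_const_one ℝ K]
        rw [this, cfc_sandwich hKs (by fun_prop)]
        apply norm_cfc_le (by positivity)
        intro t ht
        have ht0 := hsp t ht
        have p1 := eP_nonneg δ t
        have p2 := eP_le δ t
        have p3 : 0 ≤ 1 - eP δ t := by linarith
        rw [Real.norm_eq_abs, abs_of_nonneg (by positivity)]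
        rcases le_total (2 * δ) t with q | q
        · rw [eP_one hδ q]; simp; positivity
        · calc (1 - eP δ t) * t * (1 - eP δ t) ≤ 1 * (2 * δ) * 1 := by gcongr <;> linarith
            _ = _ := by ring
      linarith [norm_add_le ((1 - e) * (star Y * Y - K) * (1 - e)) ((1 - e) * K * (1 - e))]
    have e2 : Y * e - Y = -(Y * (1 - e)) := by noncomm_ring
    rw [e2, norm_neg]
    refine (abs_le_of_sq_le_sq' (e1.trans ?_) (by positivity)).2
    rw [mul_pow, Real.sq_sqrt hδ.le]; linarith
  refine ⟨u, h1, ?_, fun R hR => h3 R (by rw [← mul_assoc, hR])⟩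
  have k : Real.sqrt (2 * δ) ≤ 2 * Real.sqrt δ := by
    rw [Real.sqrt_le_left (by positivity), mul_pow, Real.sq_sqrt hδ.le]; linarith
  linarith [norm_sub_le_norm_sub_add_norm_sub u (Y * e) Y]

end Pert

/-! ### Exactification -/

section Exact
variable {ι : Type*} [Fintype ι] [DecidableEq ι] {D : Type*} [CStarAlgebra D]

theorem exists_aq [PartialOrder D] [StarOrderedRing D] {h : D} (hh : 0 ≤ h) {σ : ℝ} (hσ : 0 < σ) :
    ∃ a q : D, star a = a ∧ star q = q ∧ a * h * a + q * q = 1 ∧ ‖q * h * q‖ ≤ σ ^ 2 := by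
  have hbs : IsSelfAdjoint h := hh.isSelfAdjoint
  have hsp : ∀ x ∈ spectrum ℝ h, 0 ≤ x := fun x hx => spectrum_nonneg_of_nonneg hh hx
  have hsa : ∀ f : ℝ → ℝ, star (cfc f h) = cfc f h := fun f => (cfc_predicate f h : IsSelfAdjoint _)
  obtain ⟨g, hcg, hg⟩ := exists_gs σ hσ
  refine ⟨cfc g h, cfc (fun t => σ * g t) h, hsa _, hsa _, ?_, ?_⟩
  · rw [cfc_sandwich hbs hcg, ← cfc_mul .., ← cfc_add .., ← cfc_const_one ℝ h]
    apply cfc_congr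
    intro t ht
    have := (hg t (hsp t ht)).1
    dsimp only
    linear_combination this
  · rw [cfc_sandwich hbs (by fun_prop)]
    apply norm_cfc_le (by positivity)
    intro t ht
    have h0 := hsp t ht
    have := (hg t h0).1
    have e4 : σ * g t * t * (σ * g t) = σ ^ 2 * (g t * g t * t) := by ring
    have h5 : 0 ≤ g t * g t * t := mul_nonneg (mul_self_nonneg _) h0
    rw [e4, Real.norm_eq_abs, abs_of_nonneg (by positivity)]
    have h6 : g t * g t * t ≤ 1 := by nlinarith [mul_nonneg (mul_self_nonneg (g t)) (sq_nonneg σ)]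
    nlinarith [sq_nonneg σ]

theorem rn_mul_right (R v : ι → D) (hv : ∀ c, ‖v c‖ ≤ 1) : rn (fun c => R c * v c) ≤ rn R := by
  let _ := CStarAlgebra.spectralOrder D
  have _ := CStarAlgebra.spectralOrderedRing D
  apply Real.sqrt_le_sqrt
  apply CStarAlgebra.norm_le_norm_of_nonneg_of_le
  · exact Finset.sum_nonneg fun c _ => mul_star_self_nonneg _
  · apply Finset.sum_le_sum
    intro c _
    have h1 : v c * star (v c) ≤ 1 := by
      rw [← CStarAlgebra.norm_le_one_iff_of_nonneg _ (mul_star_self_nonneg _),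
        CStarRing.norm_self_mul_star]
      have := hv c
      nlinarith [norm_nonneg (v c)]
    have := star_right_conjugate_le_conjugate h1 (R c)
    rw [mul_one] at this
    rw [star_mul]
    simpa [mul_assoc] using this

variable [PartialOrder D] [StarOrderedRing D]

theorem rn_row_le (W : CStarMatrix (Option ι) (Option ι) D) :
    rn (fun c => W none (some c)) ≤ ‖W‖ := by
  have h1 : ‖∑ c, W none (some c) * star (W none (some c))‖ ≤ ‖W‖ ^ 2 := by
    have e : (W * star W) none none = W none none * star (W none none) +
        ∑ c, W none (some c) * star (W none (some c)) := by
      rw [CStarMatrix.mul_apply, Fintype.sum_option]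
      simp [CStarMatrix.star_apply]
    rw [sq, ← CStarRing.norm_self_mul_star (x := W)]
    refine le_trans ?_ (CStarMatrix.norm_entry_le_norm (M := W * star W) (i := none) (j := none))
    rw [e]
    apply CStarAlgebra.norm_le_norm_of_nonneg_of_le
    · exact Finset.sum_nonneg fun c _ => mul_star_self_nonneg _
    · exact le_add_of_nonneg_left (mul_star_self_nonneg _)
  exact (Real.sqrt_le_left (norm_nonneg _)).2 h1

theorem cfc_hom {N M : Type*} [CStarAlgebra N] [CStarAlgebra M] (θ : N →⋆ₙₐ[ℂ] M)
    {f : ℝ → ℝ} (hf : Continuous f) (h0 : f 0 = 0) (k : N) (hk : IsSelfAdjoint k) :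
    cfc f (θ k) = θ (cfc f k) := by
  have hd : IsSelfAdjoint (θ k) := hk.map θ
  rw [← cfcₙ_eq_cfc (a := k) (f := f), ← cfcₙ_eq_cfc (a := θ k) (f := f)]
  symm
  exact NonUnitalStarAlgHomClass.map_cfcₙ (S := ℂ) θ f k (hφ :=
    AddMonoidHomClass.continuous_of_bound θ 1 (fun x => by
      simpa using NonUnitalStarAlgHom.norm_apply_le θ x))

theorem pert_hom {N M : Type*} [CStarAlgebra N] [CStarAlgebra M] [PartialOrder M] [StarOrderedRing M]
    (θ : N →⋆ₙₐ[ℂ] M) (k : N) (w : N) (hk : k = star w * w)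
    (Y : M) {δ : ℝ} (hδ : 0 < δ) (h : ‖star Y * Y - θ k‖ ≤ δ) :
    ∃ (Z : M) (k' : N), star Z * Z = θ k' ∧ ‖Z - Y‖ ≤ 4 * Real.sqrt δ ∧
      (∀ R : M, R * Y = Y → R * Z = Z) ∧
      ∀ {E : Type _} [CStarAlgebra E] (ρ : N →⋆ₙₐ[ℂ] E), ρ k' = cfc (fP δ) (ρ k) := by
  have hks : IsSelfAdjoint k := hk ▸ IsSelfAdjoint.star_mul_self w
  have h0 : 0 ≤ θ k := by rw [hk, map_mul, map_star]; exact star_mul_self_nonneg _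
  obtain ⟨Z, h1, h2, h3⟩ := pert h0 hδ h
  refine ⟨Z, cfc (fP δ) k, ?_, h2, h3, fun ρ => (cfc_hom ρ (fP_cont δ) (fP_zero hδ) k hks).symm⟩
  rw [h1, cfc_hom θ (fP_cont δ) (fP_zero hδ) k hks]

def evM (c : ι) : (ι → D) →⋆ₙₐ[ℂ] D where
  toFun k := k c
  map_smul' _ _ := rfl
  map_zero' := rfl
  map_add' _ _ := rfl
  map_mul' _ _ := rfl
  map_star' _ := rfl

theorem pert_dg (k w : ι → D) (hk : ∀ c, k c = star (w c) * w c)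
    (Y : CStarMatrix (Option ι) (Option ι) D) {δ : ℝ} (hδ : 0 < δ)
    (h : ‖star Y * Y - dgM (ι := ι) (D := D) k‖ ≤ δ) :
    ∃ Z : CStarMatrix (Option ι) (Option ι) D,
      star Z * Z = dgM (ι := ι) (D := D) (fun c => cfc (fP δ) (k c)) ∧
      ‖Z - Y‖ ≤ 4 * Real.sqrt δ ∧ (∀ R, R * Y = Y → R * Z = Z) := by
  obtain ⟨Z, k', h1, h2, h3, h4⟩ := pert_hom (dgM (ι := ι) (D := D)) k w (funext hk) Y hδ h
  refine ⟨Z, ?_, h2, h3⟩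
  have : k' = fun c => cfc (fP δ) (k c) := by
    funext c
    exact h4 (evM c)
  rw [h1, this]

theorem exact_rows {n : ℕ} {I : Type*} (blk : ι → I) (col : I → Fin (n + 1)) (y : ι → D)
    (w : I → D) (p : D) (hp : ∀ c, p * y c = y c) {δ : ℝ} (hδ : 0 < δ)
    (hg : ∀ i, ‖star (rowM (fun c => if col (blk c) = i then y c else 0)) *
        rowM (fun c => if col (blk c) = i then y c else 0) -
        dgM (ι := ι) (D := D) (fun c => if col (blk c) = i then star (w (blk c)) * w (blk c) else 0)‖ ≤ δ) :
    ∃ (z : ι → D) (h : I → D), (∀ i, 0 ≤ h i) ∧ (∀ c, p * z c = z c) ∧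
      (∀ c d, col (blk c) = col (blk d) → star (z c) * z d = if c = d then h (blk c) else 0) ∧
      rn (fun c => z c - y c) ≤ (n + 1) * (4 * Real.sqrt δ) := by
  choose Z hZ1 hZ2 hZ3 using fun i => pert_dg (fun c => if col (blk c) = i then star (w (blk c)) * w (blk c) else 0)
    (fun c => if col (blk c) = i then w (blk c) else 0) (fun c => by split_ifs <;> simp) _ hδ (hg i)
  have hZp : ∀ i, cornM (ι := ι) p * Z i = Z i := fun i => by
    apply hZ3
    rw [← rowM_mul_left]
    congr 1
    funext c
    split_ifs
    · exact hp c
    · simp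
  have hZp0 : ∀ i c b, Z i (some c) b = 0 := fun i c b => by
    rw [← hZp i]
    change (cornMf (ι := ι) p * Z i) (some c) b = 0
    simp [CStarMatrix.mul_apply]
  have hZp1 : ∀ i b, p * Z i none b = Z i none b := fun i b => by
    conv_rhs => rw [← hZp i]
    change _ = (cornMf (ι := ι) p * Z i) none b
    simp [CStarMatrix.mul_apply, Fintype.sum_option]
  refine ⟨fun c => Z (col (blk c)) none (some c), fun i => cfc (fP δ) (star (w i) * w i),
    fun i => cfc_nonneg fun t _ => fP_nonneg hδ t, fun c => hZp1 _ _, fun c d hcd => ?_, ?_⟩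
  · have h1 : (star (Z (col (blk c))) * Z (col (blk c))) (some c) (some d) =
        star (Z (col (blk c)) none (some c)) * Z (col (blk c)) none (some d) := by
      rw [CStarMatrix.mul_apply, Fintype.sum_option]
      simp [CStarMatrix.star_apply, hZp0]
    dsimp only
    rw [← hcd, ← h1, hZ1]
    change subMf _ (some c) (some d) = _
    simp
  · have e : (fun c => Z (col (blk c)) none (some c) - y c) = fun c => ∑ i ∈ (Finset.univ : Finset (Fin (n + 1))),
        if col (blk c) = i then (Z i - rowM (fun c => if col (blk c) = i then y c else 0)) none (some c) else 0 := by
      funext c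
      rw [Finset.sum_eq_single (col (blk c))]
      · simp
      · intro i _ hi; rw [if_neg (Ne.symm hi)]
      · simp
    rw [e]
    refine (rn_sum_le _ _).trans ?_
    have : ∀ i ∈ (Finset.univ : Finset (Fin (n + 1))), rn (fun c => if col (blk c) = i then (Z i - rowM (fun c => if col (blk c) = i then y c else 0)) none (some c) else 0) ≤ 4 * Real.sqrt δ := by
      intro i _
      exact (rn_mask_le _ _).trans ((rn_row_le _).trans (hZ2 i))
    refine (Finset.sum_le_sum this).trans ?_
    simp

theorem color_sum_le {n : ℕ} {I : Type*} (blk : ι → I) (col : I → Fin (n + 1)) (z q : ι → D)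
    (h : I → D) (hq : ∀ c, star (q c) = q c)
    (hz : ∀ c d, col (blk c) = col (blk d) → star (z c) * z d = if c = d then h (blk c) else 0)
    {η : ℝ} (hη : 0 ≤ η) (hb : ∀ c, ‖q c * h (blk c) * q c‖ ≤ η) :
    ‖∑ c, z c * (q c * q c) * star (z c)‖ ≤ (n + 1) * η := by
  have e : ∑ c, z c * (q c * q c) * star (z c) = ∑ i : Fin (n + 1),
      ∑ c, (if col (blk c) = i then z c * q c else 0) * star (if col (blk c) = i then z c * q c else 0) := by
    rw [Finset.sum_comm]
    refine Finset.sum_congr rfl fun c _ => ?_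
    rw [Finset.sum_eq_single (col (blk c))]
    · simp [hq, mul_assoc]
    · intro i _ hi; rw [if_neg (Ne.symm hi)]; simp
    · simp
  rw [e]
  have : ∀ i ∈ (Finset.univ : Finset (Fin (n + 1))), ‖∑ c, (if col (blk c) = i then z c * q c else 0) * star (if col (blk c) = i then z c * q c else 0)‖ ≤ η := by
    intro i _
    rw [← rn_sq, ← norm_rowM, sq, ← CStarRing.norm_star_mul_self, star_rowM_mul]
    have e2 : subMf (fun c d => star (if col (blk c) = i then z c * q c else 0) * (if col (blk d) = i then z d * q d else 0))
        = dgM (ι := ι) (D := D) (fun c => if col (blk c) = i then q c * h (blk c) * q c else 0) := by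
      change _ = subMf _
      congr 1
      funext c d
      by_cases hc : col (blk c) = i
      · by_cases hd : col (blk d) = i
        · have := hz c d (hc.trans hd.symm)
          rw [if_pos hc, if_pos hd, star_mul, hq]
          have e3 : q c * star (z c) * (z d * q d) = q c * (star (z c) * z d) * q d := by noncomm_ring
          rw [e3, this]
          by_cases hcd : c = d
          · subst hcd; simp [hc]
          · simp [hcd]
        · rw [if_neg hd, mul_zero]
          by_cases hcd : c = d
          · subst hcd; exact absurd hc hd
          · simp [hcd]
      · simp [hc]
    rw [e2]
    refine (NonUnitalStarAlgHom.norm_apply_le _ _).trans ?_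
    refine (pi_norm_le_iff_of_nonneg hη).2 fun c => ?_
    split_ifs
    · exact hb c
    · simpa using hη
  refine (norm_sum_le_of_le _ this).trans ?_
  simp

theorem cornerize {n : ℕ} {I : Type*} (blk : ι → I) (col : I → Fin (n + 1)) (z : ι → D)
    (h : I → D) (h0 : ∀ i, 0 ≤ h i) (p : D) (hps : star p = p) (hp : ∀ c, p * z c = z c)
    (hz : ∀ c d, col (blk c) = col (blk d) → star (z c) * z d = if c = d then h (blk c) else 0)
    {σ : ℝ} (hσ : 0 < σ) :
    ∃ (y : ι → D) (k : I → D), (∀ c, p * y c = y c) ∧ (∀ c, y c * p = y c) ∧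
      (∀ c d, col (blk c) = col (blk d) → star (y c) * y d = if c = d then k (blk c) else 0) ∧
      ‖∑ c, y c * star (y c) - ∑ c, z c * star (z c)‖ ≤ (n + 1) * σ ^ 2 ∧
      ∀ (b : D) (X : Matrix ι ι ℂ), (∀ c d, blk c ≠ blk d → X c d = 0) →
        rn (fun d => b * y d - ∑ c, X c d • y c) ≤ rn (fun d => b * z d - ∑ c, X c d • z c) := by
  classical
  choose a q ha hq haq hn using fun i => exists_aq (h0 i) hσ
  have hv : ∃ v : I → D, (∀ c, v (blk c) * star (v (blk c)) = a (blk c) * h (blk c) * a (blk c)) ∧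
      (∀ i, v i * p = v i) := by
    refine ⟨fun i => if hi : ∃ c, blk c = i then a i * star (z hi.choose) else 0, fun c => ?_, fun i => ?_⟩
    · have hi : ∃ c', blk c' = blk c := ⟨c, rfl⟩
      dsimp only
      rw [dif_pos hi, star_mul, ha, star_star]
      have e := hz hi.choose hi.choose rfl
      rw [if_pos rfl, hi.choose_spec] at e
      rw [← e]; noncomm_ring
    · dsimp only
      split_ifs with hi
      · have := congrArg star (hp hi.choose)
        rw [star_mul, hps] at this
        rw [mul_assoc, this]
      · simp
  obtain ⟨v, hv1, hv2⟩ := hv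
  have hvn : ∀ c, ‖v (blk c)‖ ≤ 1 := by
    intro c
    have h1 : ‖v (blk c)‖ * ‖v (blk c)‖ ≤ 1 := by
      rw [← CStarRing.norm_self_mul_star, CStarAlgebra.norm_le_one_iff_of_nonneg _ (mul_star_self_nonneg _), hv1,
        ← haq (blk c)]
      apply le_add_of_nonneg_right
      have := star_mul_self_nonneg (q (blk c))
      rwa [hq] at this
    nlinarith [norm_nonneg (v (blk c))]
  refine ⟨fun c => z c * v (blk c), fun i => star (v i) * h i * v i, fun c => ?_, fun c => ?_,
    fun c d hcd => ?_, ?_, fun b X hX => ?_⟩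
  · rw [← mul_assoc, hp]
  · rw [mul_assoc, hv2]
  · have e3 : star (z c * v (blk c)) * (z d * v (blk d)) = star (v (blk c)) * (star (z c) * z d) * v (blk d) := by
      rw [star_mul]; noncomm_ring
    rw [e3, hz c d hcd]
    by_cases h : c = d
    · subst h; simp
    · simp [h]
  · rw [← norm_neg, neg_sub, ← Finset.sum_sub_distrib]
    have e : ∀ c, z c * star (z c) - z c * v (blk c) * star (z c * v (blk c)) =
        z c * (q (blk c) * q (blk c)) * star (z c) := by
      intro c
      have e1 : q (blk c) * q (blk c) = 1 - v (blk c) * star (v (blk c)) := by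
        rw [hv1, ← haq (blk c)]; abel
      rw [e1, star_mul]; noncomm_ring
    simp only [e]
    exact color_sum_le blk col z (fun c => q (blk c)) h (fun c => hq _) hz (by positivity) (fun c => hn _)
  · have e : (fun d => b * (z d * v (blk d)) - ∑ c, X c d • (z c * v (blk c))) =
        fun d => (b * z d - ∑ c, X c d • z c) * v (blk d) := by
      funext d
      rw [sub_mul, Finset.sum_mul, mul_assoc]
      congr 1
      refine Finset.sum_congr rfl fun c _ => ?_
      by_cases hcd : blk c = blk d
      · rw [hcd, smul_mul_assoc]
      · rw [hX c d hcd]; simp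
    rw [e]
    exact rn_mul_right _ _ (fun c => hvn c)

end Exact

/-! ### From approximate data in a corner to the exact property -/

theorem exists_norm_bound {D : Type*} [NormedAddCommGroup D] (S : Finset D) :
    ∃ L : ℝ, 1 ≤ L ∧ ∀ b ∈ S, ‖b‖ ≤ L := by
  refine ⟨1 + ∑ b ∈ S, ‖b‖, ?_, fun b hb => ?_⟩
  · have := Finset.sum_nonneg (fun b (_ : b ∈ S) => norm_nonneg b); linarith
  · have := Finset.single_le_sum (f := fun b : D => ‖b‖) (fun b _ => norm_nonneg b) hb
    linarith

theorem norm_proj_le {D : Type*} [CStarAlgebra D] {p : D} (hp : p * p = p) (hs : star p = p) :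
    ‖p‖ ≤ 1 := by
  have : ‖p‖ * ‖p‖ = ‖p‖ := by rw [← CStarRing.norm_star_mul_self, hs, hp]
  nlinarith [norm_nonneg p]

/-- stability of the approximation estimates -/
theorem rn_le_of_near {ι D : Type*} [Fintype ι] [DecidableEq ι] [CStarAlgebra D]
    (y z : ι → D) (b : D) (X : Matrix ι ι ℂ) :
    rn (fun d => b * z d - ∑ c, X c d • z c) ≤ rn (fun d => b * y d - ∑ c, X c d • y c) +
      (‖b‖ * rn (fun c => z c - y c) + rn (fun c => z c - y c) * ‖X‖) := by
  have e : (fun d => b * z d - ∑ c, X c d • z c) = fun d => (b * y d - ∑ c, X c d • y c) +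
      (b * (z d - y d) - ∑ c, X c d • (z c - y c)) := by
    funext d
    simp only [smul_sub, Finset.sum_sub_distrib, mul_sub]
    abel
  rw [e]
  refine (rn_add_le _ _).trans (add_le_add le_rfl ?_)
  refine (rn_sub_le _ _).trans (add_le_add ?_ ?_)
  · exact rn_mul_left b _
  · exact rn_mul_sc X _

theorem sum_near {ι D : Type*} [Fintype ι] [DecidableEq ι] [CStarAlgebra D] (y z : ι → D) :
    ‖∑ c, z c * star (z c) - ∑ c, y c * star (y c)‖ ≤
      rn (fun c => z c - y c) * (rn (fun c => z c - y c) + 2 * rn y) := by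
  have e : ∑ c, z c * star (z c) - ∑ c, y c * star (y c) =
      ∑ c, (z c - y c) * star (z c - y c) + (∑ c, (z c - y c) * star (y c) +
        ∑ c, y c * star (z c - y c)) := by
    rw [← Finset.sum_sub_distrib, ← Finset.sum_add_distrib, ← Finset.sum_add_distrib]
    refine Finset.sum_congr rfl fun c _ => ?_
    rw [star_sub]; noncomm_ring
  rw [e]
  have h1 := norm_sum_mul_star_le (fun c => z c - y c) (fun c => z c - y c)
  have h2 := norm_sum_mul_star_le (fun c => z c - y c) y
  have h3 := norm_sum_mul_star_le y (fun c => z c - y c)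
  refine (norm_add_le _ _).trans ?_
  have h4 := norm_add_le (∑ c, (z c - y c) * star (y c)) (∑ c, y c * star (z c - y c))
  nlinarith

theorem rn_le_two {ι D : Type*} [Fintype ι] [DecidableEq ι] [CStarAlgebra D] (y : ι → D) {p : D} (hp : ‖p‖ ≤ 1)
    {ε : ℝ} (hε : ε ≤ 1) (h : ‖∑ c, y c * star (y c) - p‖ ≤ ε) : rn y ≤ 2 := by
  have h1 : rn y ^ 2 ≤ 2 := by
    rw [rn_sq]
    have := norm_sub_norm_le (∑ c, y c * star (y c)) p
    linarith
  nlinarith [rn_nonneg y]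

theorem lemmaQ (n : ℕ) {B B' : Type} [CStarAlgebra B] [CStarAlgebra B'] [PartialOrder B]
    [StarOrderedRing B] (j : B' →⋆ₙₐ[ℂ] B) (hj : Function.Injective j) (p : B) (hp1 : j 1 = p)
    (hr : ∀ x, p * x * p = x → ∃ x', j x' = x)
    (H : ∀ (S : Finset B') (ε : ℝ), 0 < ε → ∃ (ι I : Type) (_ : Fintype ι) (_ : DecidableEq ι)
      (_ : Fintype I) (_ : DecidableEq I) (blk : ι → I) (col : I → Fin (n + 1))
      (y : ι → B) (w : I → B) (X : B' → Matrix ι ι ℂ),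
      (∀ b c d, blk c ≠ blk d → X b c d = 0) ∧ (∀ c, p * y c = y c) ∧
      (∀ i, ‖star (rowM (fun c => if col (blk c) = i then y c else 0)) *
        rowM (fun c => if col (blk c) = i then y c else 0) -
        dgM (ι := ι) (D := B)
          (fun c => if col (blk c) = i then star (w (blk c)) * w (blk c) else 0)‖ ≤ ε) ∧
      ‖∑ c, y c * star (y c) - p‖ ≤ ε ∧
      ∀ b ∈ S, ‖X b‖ ≤ ‖b‖ ∧ rn (fun d => j b * y d - ∑ c, X b c d • y c) ≤ ε) :
    StarP n B' := by
  intro S ε hε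
  obtain ⟨L, hL, hSL⟩ := exists_norm_bound S
  have hpp : p * p = p := by rw [← hp1, ← map_mul, mul_one]
  have hps : star p = p := by rw [← hp1, ← map_star, star_one]
  obtain ⟨C, hC⟩ : ∃ C : ℝ, C = ((n : ℝ) + 1) * 4 := ⟨_, rfl⟩
  have hC0 : 0 < C := by rw [hC]; positivity
  -- choose the square root of the small parameter
  obtain ⟨t, ht0, ht1, ht2⟩ : ∃ t : ℝ, 0 < t ∧ t ≤ 1 ∧ (C * (C + 4 + 2 * L) + 1 + C) * t ≤ ε := by
    have hK : 0 < C * (C + 4 + 2 * L) + 1 + C := by positivity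
    refine ⟨min 1 (ε / (C * (C + 4 + 2 * L) + 1 + C)), by positivity, min_le_left _ _, ?_⟩
    calc _ ≤ (C * (C + 4 + 2 * L) + 1 + C) * (ε / (C * (C + 4 + 2 * L) + 1 + C)) := by
          gcongr; exact min_le_right _ _
      _ = ε := by field_simp
  have htt : t ^ 2 ≤ t := by nlinarith
  obtain ⟨ι, I, _, _, _, _, blk, col, y, w, X, hX, hpy, hg, hq, hS⟩ := H S (t ^ 2) (by positivity)
  obtain ⟨z, h, h0, hpz, hz, hzy⟩ := exact_rows blk col y w p hpy (by positivity) hg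
  rw [Real.sqrt_sq ht0.le] at hzy
  have hzy' : rn (fun c => z c - y c) ≤ C * t := by rw [hC]; linarith
  obtain ⟨y', k', hpy', hyp', hy', hq', hX'⟩ := cornerize blk col z h h0 p hps hpz hz ht0
  have hlift : ∀ c, ∃ u, j u = y' c := fun c => hr _ (by rw [hpy', hyp'])
  choose u hu using hlift
  have hk : ∀ c, ∃ v, j v = k' (blk c) := fun c => by
    have := hy' c c rfl
    rw [if_pos rfl] at this
    exact ⟨star (u c) * u c, by rw [map_mul, map_star, hu, this]⟩
  have hyn : rn y ≤ 2 := rn_le_two y (norm_proj_le hpp hps) (htt.trans ht1) hq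
  have hjn : ∀ b, ‖j b‖ = ‖b‖ := fun b => (NonUnitalStarAlgHom.norm_map j hj b)
  have hrn : ∀ R : ι → B', rn R = rn (fun c => j (R c)) := by
    intro R
    unfold rn
    have : ∑ c, j (R c) * star (j (R c)) = j (∑ c, R c * star (R c)) := by
      simp [map_sum, map_mul, map_star]
    rw [this, hjn]
  have hk2 : ∃ k : I → B', ∀ c, j (k (blk c)) = k' (blk c) := by
    classical
    refine ⟨fun i => if hi : ∃ c, blk c = i then (hk hi.choose).choose else 0, fun c => ?_⟩
    have hi : ∃ c', blk c' = blk c := ⟨c, rfl⟩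
    dsimp only
    rw [dif_pos hi, (hk hi.choose).choose_spec, hi.choose_spec]
  obtain ⟨k, hk⟩ := hk2
  refine ⟨ι, I, inferInstance, inferInstance, inferInstance, inferInstance, blk, col, u, k, X, hX,
    fun c d hcd => ?_, ?_, fun b hb => ?_⟩
  · apply hj
    rw [map_mul, map_star, hu, hu, hy' c d hcd]
    split_ifs
    · rw [hk]
    · rw [map_zero]
  · rw [← hjn, map_sub, map_sum, hp1]
    simp only [map_mul, map_star, hu]
    have h1 := sum_near y z
    have h2 : rn (fun c => z c - y c) * (rn (fun c => z c - y c) + 2 * rn y) ≤ (C * t) * (C * 1 + 2 * 2) := by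
      have := rn_nonneg (fun c => z c - y c)
      have := rn_nonneg y
      gcongr
      exact hzy'.trans (by gcongr)
    have h3 := norm_sub_le_norm_sub_add_norm_sub (∑ c, y' c * star (y' c)) (∑ c, z c * star (z c)) p
    have h4 := norm_sub_le_norm_sub_add_norm_sub (∑ c, z c * star (z c)) (∑ c, y c * star (y c)) p
    have h5 : ((n : ℝ) + 1) * t ^ 2 ≤ C * t := by
      rw [hC]; nlinarith [Nat.cast_nonneg (α := ℝ) n]
    nlinarith [mul_pos hC0 ht0]
  · obtain ⟨hXb, hrb⟩ := hS b hb
    rw [hrn]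
    have e : (fun c => j (b * u c - ∑ c', X b c' c • u c')) = fun d => j b * y' d - ∑ c, X b c d • y' c := by
      funext d
      simp [map_sub, map_mul, map_sum, hu]
    rw [e]
    refine (hX' (j b) (X b) (hX b)).trans ((rn_le_of_near y z (j b) (X b)).trans ?_)
    rw [hjn]
    have hbL := hSL b hb
    have h2 : ‖b‖ * rn (fun c => z c - y c) ≤ L * (C * t) :=
      mul_le_mul hbL hzy' (rn_nonneg _) (by positivity)
    have h3 : rn (fun c => z c - y c) * ‖X b‖ ≤ (C * t) * L :=
      mul_le_mul hzy' (hXb.trans hbL) (norm_nonneg _) (by positivity)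
    nlinarith [mul_pos hC0 ht0]

/-! ### Canonical index sets and discarding small blocks -/

theorem exists_sigma {κ I : Type} [Fintype κ] [Fintype I] [DecidableEq I] (blk : κ → I) :
    ∃ (s : ℕ) (r : Fin s → ℕ) (e : Fin s ≃ I) (f : (Σ i, Fin (r i)) ≃ κ),
      ∀ c, blk (f c) = e c.1 := by
  let e := (Fintype.equivFin I).symm
  refine ⟨Fintype.card I, fun i => Fintype.card {c // blk c = e i}, e,
    (Equiv.sigmaCongrRight fun i => (Fintype.equivFin {c // blk c = e i}).symm).trans
      ((Equiv.sigmaCongrLeft (β := fun i => {c // blk c = i}) e).trans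
        (Equiv.sigmaFiberEquiv blk)), fun c => ?_⟩
  exact ((Fintype.equivFin {c' // blk c' = e c.1}).symm c.2).2

theorem sum_sub_ite {κ D : Type*} [Fintype κ] [AddCommMonoid D] (Q : κ → Prop) [DecidablePred Q]
    (F : κ → D) : ∑ c : {c // Q c}, F c = ∑ c, if Q c then F c else 0 := by
  rw [← Finset.sum_filter]
  exact (Finset.sum_subtype (p := Q) (Finset.univ.filter Q) (fun c => by simp) F).symm

theorem starC (n : ℕ) {D : Type} [CStarAlgebra D] (h : StarP n D) (S : Finset D) {ε η : ℝ}
    (hε : 0 < ε) (hη : 0 < η) :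
    ∃ (s : ℕ) (r : Fin s → ℕ) (J : Fin s → Fin (n + 1)) (y : (Σ i, Fin (r i)) → D) (k : Fin s → D)
      (X : D → FDBlock s r),
      (∀ c d, J c.1 = J d.1 → star (y c) * y d = if c = d then k c.1 else 0) ∧
      (∀ c : (Σ i, Fin (r i)), η ≤ ‖k c.1‖) ∧
      ‖∑ c, y c * star (y c) - 1‖ ≤ ε + (n + 1) * η ∧
      ∀ b ∈ S, rn (fun d => b * y d - ∑ c, Matrix.blockDiagonal' (X b) c d • y c) ≤ ε := by
  classical
  let _ := CStarAlgebra.spectralOrder D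
  have _ := CStarAlgebra.spectralOrderedRing D
  obtain ⟨ι, I, _, _, _, _, blk, col, y, k, X, hX, ho, hs, hS⟩ := h S ε hε
  obtain ⟨s, r, e, f, hf⟩ := exists_sigma (fun c : {c : ι // η ≤ ‖k (blk c)‖} => blk c)
  have hfi : Function.Injective (fun c => (f c : ι)) := Subtype.val_injective.comp f.injective
  refine ⟨s, r, fun i => col (e i), fun c => y (f c), fun i => k (e i),
    fun b i => Matrix.of fun a a' => X b (f ⟨i, a⟩) (f ⟨i, a'⟩), fun c d hcd => ?_, fun c => ?_, ?_,
    fun b hb => ?_⟩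
  · have := ho (f c) (f d) (by rw [hf, hf]; exact hcd)
    rw [this, hf]
    exact if_congr (by rw [Subtype.val_inj, f.injective.eq_iff]) rfl rfl
  · dsimp only
    rw [← hf]; exact (f c).2
  · have h1 : ∑ c, y (f c) * star (y (f c)) =
        ∑ c, if η ≤ ‖k (blk c)‖ then y c * star (y c) else 0 := by
      rw [f.sum_comp (fun c => y c * star (y c)), sum_sub_ite _ (fun c => y c * star (y c))]
    have h2 := color_sum_le blk col y (fun c => if η ≤ ‖k (blk c)‖ then 0 else 1) k
      (fun c => by split_ifs <;> simp) ho hη.le (fun c => by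
        split_ifs with h
        · simpa using hη.le
        · simpa using (not_le.1 h).le)
    have h3 : ∑ c, y (f c) * star (y (f c)) = ∑ c, y c * star (y c) - ∑ c,
        y c * ((if η ≤ ‖k (blk c)‖ then 0 else 1) * (if η ≤ ‖k (blk c)‖ then 0 else 1)) * star (y c) := by
      rw [h1, ← Finset.sum_sub_distrib]
      refine Finset.sum_congr rfl fun c _ => ?_
      split_ifs <;> simp
    rw [h3, sub_right_comm]
    exact (norm_sub_le _ _).trans (add_le_add hs h2)
  · refine le_trans (le_of_eq (rn_congr fun d => ?_)) ((rn_comp_le (fun d => b * y d - ∑ c, X b c d • y c)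
      (fun c => (f c : ι)) hfi).trans (hS b hb))
    dsimp only
    congr 1
    have h1 : ∑ c, X b c (f d) • y c = ∑ c, X b (f c) (f d) • y (f c) := by
      rw [f.sum_comp (fun c => X b c (f d) • y c)]
      rw [sum_sub_ite _ (fun c => X b c (f d) • y c)]
      refine Finset.sum_congr rfl fun c _ => ?_
      split_ifs with hc
      · rfl
      rw [hX, zero_smul]
      intro hc'
      exact hc (by rw [hc']; exact (f d).2)
    rw [h1]
    refine Finset.sum_congr rfl fun c _ => ?_
    congr 1
    obtain ⟨i, a⟩ := c
    obtain ⟨i', a'⟩ := d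
    by_cases hi : i = i'
    · subst hi
      rw [Matrix.blockDiagonal'_apply_eq]; rfl
    · rw [Matrix.blockDiagonal'_apply_ne _ _ _ hi, hX]
      rw [hf, hf]
      exact fun h => hi (e.injective h)

/-! ### Normalized states -/

theorem exists_state {D : Type*} [CStarAlgebra D] (z : D) {η : ℝ} (hη : 0 < η)
    (h : η ≤ ‖star z * z‖) :
    ∃ ω : D →ₗ[ℂ] ℂ, (∀ a, 0 ≤ ω (star a * a)) ∧ ω (star z * z) = 1 ∧
      (∀ a, ω (star a) = star (ω a)) ∧ ∀ a, (ω (star a * a)).re ≤ ‖a‖ ^ 2 / η := by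
  let _ := CStarAlgebra.spectralOrder D
  have _ := CStarAlgebra.spectralOrderedRing D
  obtain ⟨k, hk⟩ : ∃ k, k = star z * z := ⟨_, rfl⟩
  have hk0 : 0 ≤ k := hk ▸ star_mul_self_nonneg z
  rw [← hk] at h ⊢
  have hkp : 0 < ‖k‖ := hη.trans_le h
  have : Nontrivial D := ⟨⟨k, 0, norm_pos_iff.1 hkp⟩⟩
  have hn : ‖1 + k‖ = 1 + ‖k‖ := by
    refine le_antisymm ((norm_add_le _ _).trans (by rw [norm_one])) ?_
    have h1 : k ≤ algebraMap ℝ D (‖1 + k‖ - 1) := by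
      have := IsSelfAdjoint.le_algebraMap_norm_self (IsSelfAdjoint.of_nonneg (add_nonneg zero_le_one hk0))
      rw [map_sub, map_one]
      exact le_sub_iff_add_le'.2 this
    have h2 : 1 ≤ ‖1 + k‖ := by
      rw [← norm_one (α := D)]
      exact CStarAlgebra.norm_le_norm_of_nonneg_of_le zero_le_one (le_add_of_nonneg_right hk0)
    have := (CStarAlgebra.norm_le_iff_le_algebraMap k (sub_nonneg.2 h2) hk0).2 h1
    linarith
  obtain ⟨f, hf1, hf⟩ := exists_dual_vector ℂ (1 + k) (by
    intro h0; rw [hn] at h0; linarith)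
  have hfb : ∀ a, ‖f a‖ ≤ ‖a‖ := fun a => by simpa [hf1] using f.le_opNorm a
  have hre : ∀ a, |(f a).re| ≤ ‖a‖ := fun a => (Complex.abs_re_le_norm _).trans (hfb a)
  have hsum : (f 1).re + (f k).re = 1 + ‖k‖ := by
    rw [hn] at hf
    have := congrArg Complex.re hf
    rw [map_add] at this
    simpa using this
  have hr1 : (f 1).re = 1 ∧ (f k).re = ‖k‖ := by
    have h1 := (abs_le.1 (hre 1)).2
    have h2 := (abs_le.1 (hre k)).2
    rw [norm_one] at h1
    constructor <;> linarith
  -- hermitian part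
  let g : D →ₗ[ℂ] ℂ :=
    { toFun := fun a => (f a + star (f (star a))) / 2
      map_add' := fun a b => by simp only [map_add, star_add]; ring
      map_smul' := fun t a => by simp [star_smul, smul_eq_mul]; ring }
  have hg : ∀ a, g a = (f a + star (f (star a))) / 2 := fun a => rfl
  have hgs : ∀ a, g (star a) = star (g a) := fun a => by
    rw [hg, hg, star_div₀, star_add, star_star, star_star, add_comm]; simp
  have hgsa : ∀ a, star a = a → g a = ((f a).re : ℂ) := fun a ha => by
    rw [hg, ha]
    have := Complex.add_conj (f a)
    rw [Complex.star_def, this]; push_cast; ring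
  have hpos : ∀ a : D, 0 ≤ a → 0 ≤ (f a).re := by
    intro a ha
    by_cases ha0 : a = 0
    · simp [ha0]
    have hap : 0 < ‖a‖ := norm_pos_iff.2 ha0
    have h1 : ‖algebraMap ℝ D ‖a‖ - a‖ ≤ ‖a‖ := by
      have hsa := IsSelfAdjoint.le_algebraMap_norm_self (IsSelfAdjoint.of_nonneg ha)
      rw [CStarAlgebra.norm_le_iff_le_algebraMap _ (norm_nonneg _) (sub_nonneg.2 hsa)]
      exact sub_le_self _ ha
    have h2 := (abs_le.1 ((hre _).trans h1)).2
    rw [map_sub, Algebra.algebraMap_eq_smul_one] at h2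
    have h3 : f (‖a‖ • (1 : D)) = (‖a‖ : ℂ) * f 1 := by
      rw [← Complex.coe_smul, map_smul]; rfl
    rw [h3] at h2
    simp [hr1.1] at h2
    exact h2
  refine ⟨((‖k‖ : ℂ)⁻¹) • g, fun a => ?_, ?_, fun a => ?_, fun a => ?_⟩
  · rw [LinearMap.smul_apply, hgsa _ (by simp), smul_eq_mul, ← Complex.ofReal_inv, ← Complex.ofReal_mul]
    exact Complex.zero_le_real.2 (mul_nonneg (by positivity) (hpos _ (star_mul_self_nonneg a)))
  · rw [LinearMap.smul_apply, hgsa _ (IsSelfAdjoint.of_nonneg hk0), hr1.2, smul_eq_mul]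
    exact inv_mul_cancel₀ (by exact_mod_cast hkp.ne')
  · rw [LinearMap.smul_apply, LinearMap.smul_apply, hgs, star_smul]
    simp
  · rw [LinearMap.smul_apply, hgsa _ (by simp), smul_eq_mul, ← Complex.ofReal_inv, ← Complex.ofReal_mul,
      Complex.ofReal_re, inv_mul_eq_div]
    have := (abs_le.1 (hre (star a * a))).2
    rw [CStarRing.norm_star_mul_self, ← sq] at this
    gcongr

/-! ### Refined data -/

section Refined
open scoped MatrixOrder Matrix
variable {s : ℕ} {r : Fin s → ℕ} {D : Type*} [CStarAlgebra D]

theorem pos_factor {m : Type*} [Fintype m] [DecidableEq m] {M : Matrix m m ℂ} (hM : M.PosSemidef) :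
    ∃ B : Matrix m m ℂ, M = star B * B :=
  CStarAlgebra.nonneg_iff_eq_star_mul_self.1 (Matrix.nonneg_iff_posSemidef.2 hM)

def psiM (y : (Σ i, Fin (r i)) → D) (ω : Fin s → D →ₗ[ℂ] ℂ) : D →ₗ[ℂ] FDBlock s r where
  toFun a i := Matrix.of fun c d => ω i (star (y ⟨i, c⟩) * a * y ⟨i, d⟩)
  map_add' a b := by
    funext i; ext c d; simp [mul_add, add_mul]
  map_smul' t a := by
    funext i; ext c d; simp

theorem psiM_apply (y : (Σ i, Fin (r i)) → D) (ω : Fin s → D →ₗ[ℂ] ℂ) (a : D) (i : Fin s)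
    (c d : Fin (r i)) : psiM y ω a i c d = ω i (star (y ⟨i, c⟩) * a * y ⟨i, d⟩) := rfl

theorem psiM_one (y : (Σ i, Fin (r i)) → D) (ω : Fin s → D →ₗ[ℂ] ℂ)
    (h3 : ∀ i c d, ω i (star (y ⟨i, c⟩) * y ⟨i, d⟩) = if c = d then 1 else 0) :
    psiM y ω 1 = 1 := by
  funext i; ext c d
  rw [psiM_apply, mul_one, h3, Pi.one_apply, Matrix.one_apply]

theorem psiM_cp (y : (Σ i, Fin (r i)) → D) (ω : Fin s → D →ₗ[ℂ] ℂ)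
    (h1 : ∀ i a, 0 ≤ ω i (star a * a)) (h2 : ∀ i a, ω i (star a) = star (ω i a)) :
    IsCompletelyPositive (psiM y ω) := by
  rintro k x ⟨z, rfl⟩
  have hM : ∀ i, ∃ B : Matrix (Fin (r i) × Fin k) (Fin (r i) × Fin k) ℂ,
      (Matrix.of fun u v => ω i (star (y ⟨i, u.1⟩) * (star z * z) u.2 v.2 * y ⟨i, v.1⟩)) = star B * B := by
    intro i
    apply pos_factor
    have e : ∀ u v : Fin (r i) × Fin k, ω i (star (y ⟨i, u.1⟩) * (star z * z) u.2 v.2 * y ⟨i, v.1⟩) =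
        ∑ m, ω i (star (z m u.2 * y ⟨i, u.1⟩) * (z m v.2 * y ⟨i, v.1⟩)) := by
      intro u v
      rw [Matrix.mul_apply, Finset.mul_sum, Finset.sum_mul, map_sum]
      refine Finset.sum_congr rfl fun m _ => ?_
      rw [Matrix.star_apply, star_mul]
      simp only [mul_assoc]
    rw [Matrix.posSemidef_iff_dotProduct_mulVec]
    constructor
    · ext u v
      rw [Matrix.conjTranspose_apply, Matrix.of_apply, Matrix.of_apply, e, e, star_sum]
      refine Finset.sum_congr rfl fun m _ => ?_
      rw [← h2, star_mul, star_star]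
    · intro t
      have : star t ⬝ᵥ (Matrix.of fun u v => ω i (star (y ⟨i, u.1⟩) * (star z * z) u.2 v.2 * y ⟨i, v.1⟩)) *ᵥ t =
          ∑ m, ω i (star (∑ u, t u • (z m u.2 * y ⟨i, u.1⟩)) * (∑ v, t v • (z m v.2 * y ⟨i, v.1⟩))) := by
        simp only [dotProduct, Matrix.mulVec, Matrix.of_apply, e, Pi.star_apply, star_sum, star_smul,
          Finset.sum_mul, Finset.mul_sum, map_sum, smul_mul_smul_comm, map_smul, smul_eq_mul]
        rw [Finset.sum_comm]
        rw [Finset.sum_congr rfl fun u _ => Finset.sum_comm]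
        rw [Finset.sum_comm]
        refine Finset.sum_congr rfl fun m _ => ?_
        refine Finset.sum_congr rfl fun u _ => Finset.sum_congr rfl fun v _ => ?_
        ring
      rw [this]
      exact Finset.sum_nonneg fun m _ => h1 _ _
  choose B hB using hM
  refine ⟨Matrix.of fun p q i => Matrix.of fun c d => B i (c, p) (d, q), ?_⟩
  ext p q i c d
  have := congrFun (congrFun (hB i) (c, p)) (d, q)
  simp only [Matrix.of_apply] at this
  rw [Matrix.map_apply, psiM_apply, this]
  simp only [Matrix.mul_apply, Finset.sum_apply, Pi.mul_apply, Matrix.star_apply, Matrix.of_apply,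
    Matrix.sum_apply, Pi.star_apply]
  rw [Fintype.sum_prod_type, Finset.sum_comm]

theorem bessel {m : ℕ} (y : Fin m → D) (ω : D →ₗ[ℂ] ℂ)
    (h1 : ∀ a, 0 ≤ ω (star a * a)) (h2 : ∀ a, ω (star a) = star (ω a))
    (h3 : ∀ c d, ω (star (y c) * y d) = if c = d then 1 else 0) (a : D) :
    ∑ c, ‖ω (star (y c) * a)‖ ^ 2 ≤ (ω (star a * a)).re := by
  obtain ⟨W, hW⟩ : ∃ W : Fin m → ℂ, W = fun c => ω (star (y c) * a) := ⟨_, rfl⟩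
  have h := h1 (a - ∑ c, W c • y c)
  have e1 : ω (star (∑ c, W c • y c) * a) = ∑ c, star (W c) * W c := by
    simp [star_sum, Finset.sum_mul, hW]
  have e2 : ω (star a * ∑ c, W c • y c) = ∑ c, star (W c) * W c := by
    have := h2 (star (∑ c, W c • y c) * a)
    rw [star_mul, star_star] at this
    rw [this, e1]
    simp [mul_comm]
  have e3 : ω (star (∑ c, W c • y c) * ∑ c, W c • y c) = ∑ c, star (W c) * W c := by
    simp only [star_sum, star_smul, Finset.sum_mul, Finset.mul_sum, smul_mul_smul_comm, map_sum, map_smul, h3]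
    simp
  have e : star (a - ∑ c, W c • y c) * (a - ∑ c, W c • y c) = star a * a - star a * ∑ c, W c • y c -
      star (∑ c, W c • y c) * a + star (∑ c, W c • y c) * ∑ c, W c • y c := by
    rw [star_sub]; noncomm_ring
  rw [e, map_add, map_sub, map_sub, e1, e2, e3] at h
  have h' := (Complex.le_def.1 h).1
  have e4 : (∑ c, star (W c) * W c).re = ∑ c, ‖ω (star (y c) * a)‖ ^ 2 := by
    rw [Complex.re_sum]
    refine Finset.sum_congr rfl fun c _ => ?_
    rw [hW]
    rw [Complex.star_def, ← Complex.normSq_eq_conj_mul_self, Complex.ofReal_re, Complex.normSq_eq_norm_sq]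
  simp only [Complex.add_re, Complex.sub_re, e4, Complex.zero_re] at h'
  linarith

theorem norm_comb_le {ι : Type*} [Fintype ι] [DecidableEq ι] (R : ι → D) (u : ι → ℂ) :
    ‖∑ d, u d • R d‖ ^ 2 ≤ rn R ^ 2 * ∑ d, ‖u d‖ ^ 2 := by
  have h := norm_sum_mul_star_le R (fun d => star (u d) • (1 : D))
  have e : ∑ d, R d * star (star (u d) • (1 : D)) = ∑ d, u d • R d := by simp
  rw [e] at h
  have h2 : rn (fun d => star (u d) • (1 : D)) ^ 2 ≤ ∑ d, ‖u d‖ ^ 2 := by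
    rw [rn_sq]
    refine (norm_sum_le _ _).trans (Finset.sum_le_sum fun d _ => ?_)
    have h1 : ‖(1 : D)‖ ≤ 1 := norm_proj_le (one_mul 1) (star_one _)
    rw [CStarRing.norm_self_mul_star, norm_smul, norm_star, ← sq, mul_pow]
    have : ‖(1 : D)‖ ^ 2 ≤ 1 := pow_le_one₀ (norm_nonneg _) h1
    nlinarith [sq_nonneg ‖u d‖]
  calc _ ≤ (rn R * rn (fun d => star (u d) • (1 : D))) ^ 2 := by gcongr
    _ ≤ _ := by rw [mul_pow]; gcongr

theorem bes_norm {m : ℕ} (y : Fin m → D) (ω : D →ₗ[ℂ] ℂ) {η : ℝ} (hη : 0 < η)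
    (h1 : ∀ a, 0 ≤ ω (star a * a)) (h2 : ∀ a, ω (star a) = star (ω a))
    (h3 : ∀ c d, ω (star (y c) * y d) = if c = d then 1 else 0)
    (h4 : ∀ a, (ω (star a * a)).re ≤ ‖a‖ ^ 2 / η) (R : Fin m → D) :
    Real.sqrt η * ‖Matrix.of fun c d => ω (star (y c) * R d)‖ ≤ rn R := by
  obtain ⟨t, ht⟩ : ∃ t, t = Real.sqrt η := ⟨_, rfl⟩
  have ht0 : 0 < t := ht ▸ Real.sqrt_pos.2 hη
  have htt : t ^ 2 = η := by rw [ht]; exact Real.sq_sqrt hη.le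
  rw [← ht, ← le_div_iff₀' ht0, Matrix.l2_opNorm_def]
  refine ContinuousLinearMap.opNorm_le_bound _ (div_nonneg (rn_nonneg _) ht0.le) fun u => ?_
  refine abs_le_of_sq_le_sq' ?_ (by have := rn_nonneg R; positivity) |>.2
  rw [EuclideanSpace.norm_sq_eq]
  have e : ∀ c, ((Matrix.toEuclideanLin.trans LinearMap.toContinuousLinearMap)
      (Matrix.of fun c d => ω (star (y c) * R d)) u) c = ω (star (y c) * ∑ d, u d • R d) := by
    intro c
    simp [Finset.mul_sum, Matrix.mulVec, dotProduct, mul_comm]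
  simp only [e]
  refine (bessel y ω h1 h2 h3 _).trans ((h4 _).trans ?_)
  rw [div_le_iff₀ hη]
  refine (norm_comb_le R (fun d => u d)).trans ?_
  rw [mul_pow, div_pow, htt, EuclideanSpace.norm_sq_eq]
  apply le_of_eq
  field_simp

end Refined

/-! ### Refined approximation property -/

section Refined2

theorem ucp_norm_le {F D : Type*} [CStarAlgebra F] [CStarAlgebra D] (φ : F →ₗ[ℂ] D)
    (hφ : IsCompletelyPositive φ) (h1 : ‖φ 1‖ ≤ 1) (a : F) : ‖φ a‖ ≤ ‖a‖ := by
  let _ := CStarAlgebra.spectralOrder D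
  have _ := CStarAlgebra.spectralOrderedRing D
  let _ := CStarAlgebra.spectralOrder F
  have _ := CStarAlgebra.spectralOrderedRing F
  have h2 := sub_nonneg.1 (cp_kadison hφ h1 a)
  have h3 : ‖φ a‖ ^ 2 ≤ ‖φ (a * star a)‖ := by
    rw [sq, ← CStarRing.norm_self_mul_star]
    exact CStarAlgebra.norm_le_norm_of_nonneg_of_le (mul_star_self_nonneg _) h2
  have h4 : φ (a * star a) ≤ (‖a‖ ^ 2 : ℝ) • φ 1 := by
    have h5 := IsSelfAdjoint.le_algebraMap_norm_self (IsSelfAdjoint.mul_star_self a)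
    have h6 := cp_nonneg' hφ (sub_nonneg.2 h5)
    rw [map_sub, Algebra.algebraMap_eq_smul_one, CStarRing.norm_self_mul_star, ← sq,
      ← Complex.coe_smul, map_smul, Complex.coe_smul] at h6
    exact sub_nonneg.1 h6
  have h0 : 0 ≤ φ (a * star a) := cp_nonneg' hφ (mul_star_self_nonneg _)
  have h7 := CStarAlgebra.norm_le_norm_of_nonneg_of_le h0 h4
  rw [norm_smul, Real.norm_of_nonneg (by positivity)] at h7
  have h8 : ‖φ a‖ ^ 2 ≤ ‖a‖ ^ 2 := by nlinarith [sq_nonneg ‖a‖]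
  exact abs_le_of_sq_le_sq' h8 (norm_nonneg _) |>.2

variable {s : ℕ} {r : Fin s → ℕ}

def bdH (s : ℕ) (r : Fin s → ℕ) :
    FDBlock s r →⋆ₙₐ[ℂ] Matrix (Σ i, Fin (r i)) (Σ i, Fin (r i)) ℂ where
  toFun Z := Matrix.blockDiagonal' Z
  map_smul' t Z := Matrix.blockDiagonal'_smul t Z
  map_zero' := Matrix.blockDiagonal'_zero
  map_add' Z W := Matrix.blockDiagonal'_add Z W
  map_mul' Z W := Matrix.blockDiagonal'_mul Z W
  map_star' Z := (Matrix.blockDiagonal'_conjTranspose Z).symm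

theorem bdH_apply (Z : FDBlock s r) : bdH s r Z = Matrix.blockDiagonal' Z := rfl

theorem norm_bdH_le (Z : FDBlock s r) : ‖bdH s r Z‖ ≤ ‖Z‖ := NonUnitalStarAlgHom.norm_apply_le _ _

theorem bdH_eq (Z : FDBlock s r) (i : Fin s) (a b : Fin (r i)) : bdH s r Z ⟨i, a⟩ ⟨i, b⟩ = Z i a b :=
  Matrix.blockDiagonal'_apply_eq _ _ _ _

theorem bdH_ne (Z : FDBlock s r) (c d : Σ i, Fin (r i)) (h : c.1 ≠ d.1) : bdH s r Z c d = 0 :=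
  Matrix.blockDiagonal'_apply_ne _ _ _ h

/-- one column of a block diagonal combination -/
theorem bdH_sum {D : Type*} [AddCommMonoid D] [Module ℂ D] (Z : FDBlock s r) (y : (Σ i, Fin (r i)) → D)
    (i : Fin s) (d : Fin (r i)) :
    ∑ c, bdH s r Z c ⟨i, d⟩ • y c = ∑ c, Z i c d • y ⟨i, c⟩ := by
  rw [Fintype.sum_sigma, Finset.sum_eq_single i]
  · simp [bdH_eq]
  · intro i' _ hi
    exact Finset.sum_eq_zero fun c _ => by rw [bdH_ne _ _ _ hi, zero_smul]
  · simp

def StarR (n : ℕ) (D : Type) [CStarAlgebra D] : Prop :=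
  ∀ (S : Finset D) (ε : ℝ), 0 < ε → ∃ (s : ℕ) (r : Fin s → ℕ) (J : Fin s → Fin (n + 1))
    (y : (Σ i, Fin (r i)) → D) (k : Fin s → D) (ψ : D →ₗ[ℂ] FDBlock s r) (δ : ℝ),
    IsCompletelyPositive ψ ∧ ψ 1 = 1 ∧
    (∀ c d, J c.1 = J d.1 → star (y c) * y d = if c = d then k c.1 else 0) ∧
    ‖∑ c, y c * star (y c) - 1‖ ≤ ε ∧ 0 < δ ∧ δ ≤ 1 ∧
    (∀ Z : FDBlock s r, δ * ‖Z‖ ≤ rn (fun d => ∑ c, bdH s r Z c d • y c)) ∧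
    ∀ b ∈ S, rn (fun d => b * y d - ∑ c, bdH s r (ψ b) c d • y c) ≤ ε * δ

theorem starR_of_starP (n : ℕ) {D : Type} [CStarAlgebra D] (h : StarP n D) : StarR n D := by
  classical
  intro S ε₁ hε₁
  obtain ⟨ε, hε, hε1, hεle⟩ : ∃ ε : ℝ, 0 < ε ∧ ε ≤ 1 ∧ ε ≤ ε₁ :=
    ⟨min ε₁ 1, by positivity, min_le_right _ _, min_le_left _ _⟩
  obtain ⟨δ, hδ0, hδ1, hδ2⟩ : ∃ δ : ℝ, 0 < δ ∧ δ ≤ 1 ∧ (n + 1) * δ ^ 2 ≤ ε / 2 := by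
    have hq : 0 < ε / (2 * (n + 1)) := by positivity
    refine ⟨min 1 (ε / (2 * (n + 1))), by positivity, min_le_left _ _, ?_⟩
    have h1 : min 1 (ε / (2 * ((n : ℝ) + 1))) ≤ 1 := min_le_left _ _
    have h2 : min 1 (ε / (2 * ((n : ℝ) + 1))) ≤ ε / (2 * (n + 1)) := min_le_right _ _
    have h0 : 0 < min 1 (ε / (2 * ((n : ℝ) + 1))) := by positivity
    calc ((n : ℝ) + 1) * min 1 (ε / (2 * (n + 1))) ^ 2 ≤ (n + 1) * (ε / (2 * (n + 1))) := by
          gcongr; nlinarith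
      _ = ε / 2 := by field_simp
  obtain ⟨s, r, J, y, k, X, ho, hk, hs, hS⟩ := starC n h S (ε := ε * δ ^ 2 / 3) (η := δ ^ 2)
    (by positivity) (by positivity)
  have hδδ : δ ^ 2 ≤ 1 := pow_le_one₀ hδ0.le hδ1
  have hω : ∀ i, ∃ ω : D →ₗ[ℂ] ℂ, (∀ a, 0 ≤ ω (star a * a)) ∧ (∀ a, ω (star a) = star (ω a)) ∧
      (∀ c d, ω (star (y ⟨i, c⟩) * y ⟨i, d⟩) = if c = d then 1 else 0) ∧
      ∀ a, (ω (star a * a)).re ≤ ‖a‖ ^ 2 / δ ^ 2 := by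
    intro i
    by_cases hi : Nonempty (Fin (r i))
    · obtain ⟨c0⟩ := hi
      have hkc := ho ⟨i, c0⟩ ⟨i, c0⟩ rfl
      rw [if_pos rfl] at hkc
      obtain ⟨ω, h1, h2, h3, h4⟩ := exists_state (y ⟨i, c0⟩) (η := δ ^ 2) (by positivity)
        (by rw [hkc]; exact hk ⟨i, c0⟩)
      refine ⟨ω, h1, h3, fun c d => ?_, h4⟩
      rw [ho ⟨i, c⟩ ⟨i, d⟩ rfl]
      by_cases hcd : c = d
      · subst hcd
        rw [if_pos rfl, if_pos rfl, ← hkc, h2]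
      · rw [if_neg hcd, if_neg, map_zero]
        intro h
        exact hcd (eq_of_heq (Sigma.mk.inj h).2)
    · refine ⟨0, fun a => by simp, fun a => by simp, fun c => (hi ⟨c⟩).elim, fun a => ?_⟩
      simp only [LinearMap.zero_apply, Complex.zero_re]
      positivity
  choose ω h1 h2 h3 h4 using hω
  have hbes : ∀ (R : (Σ i, Fin (r i)) → D) (i : Fin s),
      δ * ‖Matrix.of fun c d => ω i (star (y ⟨i, c⟩) * R ⟨i, d⟩)‖ ≤ rn R := by
    intro R i
    have := bes_norm (fun c => y ⟨i, c⟩) (ω i) (η := δ ^ 2) (by positivity) (h1 i) (h2 i) (h3 i) (h4 i)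
      (fun d => R ⟨i, d⟩)
    rw [Real.sqrt_sq hδ0.le] at this
    refine this.trans (rn_comp_le R (fun d : Fin (r i) => (⟨i, d⟩ : Σ i, Fin (r i))) ?_)
    intro a b hab
    exact eq_of_heq (Sigma.mk.inj hab).2
  have hε3 : ε * δ ^ 2 / 3 ≤ ε / 2 := by nlinarith
  have hsum : ‖∑ c, y c * star (y c) - 1‖ ≤ ε := by linarith
  refine ⟨s, r, J, y, k, psiM y ω, δ, psiM_cp y ω h1 h2, psiM_one y ω h3, ho, hsum.trans hεle, hδ0, hδ1,
    fun Z => ?_, fun b hb => ?_⟩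
  · rw [← le_div_iff₀' hδ0, pi_norm_le_iff_of_nonneg (div_nonneg (rn_nonneg _) hδ0.le)]
    intro i
    rw [le_div_iff₀' hδ0]
    refine le_trans (le_of_eq ?_) (hbes (fun d => ∑ c, bdH s r Z c d • y c) i)
    congr 2
    ext c d
    rw [Matrix.of_apply, bdH_sum, Finset.mul_sum, map_sum]
    simp [h3]
  · have hXψ : δ * ‖psiM y ω b - X b‖ ≤ ε * δ ^ 2 / 3 := by
      refine le_trans ?_ (hS b hb)
      rw [← le_div_iff₀' hδ0, pi_norm_le_iff_of_nonneg (div_nonneg (rn_nonneg _) hδ0.le)]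
      intro i
      rw [le_div_iff₀' hδ0]
      refine le_trans (le_of_eq ?_) (hbes _ i)
      congr 2
      ext c d
      have := bdH_sum (X b) y i d
      rw [bdH_apply] at this
      rw [Matrix.of_apply, this, mul_sub, Finset.mul_sum, map_sub, map_sum, Pi.sub_apply, Matrix.sub_apply,
        psiM_apply, mul_assoc]
      simp [h3]
    have hyn : rn y ≤ 2 := rn_le_two y (norm_proj_le (one_mul 1) (star_one _)) hε1 hsum
    have e : (fun d => b * y d - ∑ c, bdH s r (psiM y ω b) c d • y c) = fun d =>
        (b * y d - ∑ c, Matrix.blockDiagonal' (X b) c d • y c) -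
          ∑ c, (bdH s r (psiM y ω b - X b)) c d • y c := by
      funext d
      rw [map_sub]
      simp only [Matrix.sub_apply, sub_smul, Finset.sum_sub_distrib, bdH_apply]
      abel
    rw [e]
    have h5 := (rn_sub_le (fun d => b * y d - ∑ c, Matrix.blockDiagonal' (X b) c d • y c)
      (fun d => ∑ c, (bdH s r (psiM y ω b - X b)) c d • y c))
    have h6 := rn_mul_sc (bdH s r (psiM y ω b - X b)) y
    have h7 : ‖psiM y ω b - X b‖ ≤ ε * δ / 3 := by
      have : δ * ‖psiM y ω b - X b‖ ≤ δ * (ε * δ / 3) := by linarith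
      exact le_of_mul_le_mul_left this hδ0
    have h8 : rn y * ‖bdH s r (psiM y ω b - X b)‖ ≤ 2 * (ε * δ / 3) :=
      mul_le_mul hyn ((norm_bdH_le _).trans h7) (norm_nonneg _) (by norm_num)
    have h9 := hS b hb
    have h10 : ε * δ ^ 2 ≤ ε * δ := by nlinarith [mul_pos hε hδ0]
    have h11 : ε * δ ≤ ε₁ * δ := by gcongr
    linarith

end Refined2

/-! ### From the refined property to decomposition rank -/

theorem gram_pos_aux {M : Type*} [CStarAlgebra M] {κ : Type*} [Fintype κ] (T : κ → M) :
    ∃ Y : M, ∑ m, star (T m) * T m = star Y * Y := by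
  let _ := CStarAlgebra.spectralOrder M
  have _ := CStarAlgebra.spectralOrderedRing M
  exact CStarAlgebra.nonneg_iff_eq_star_mul_self.1 (Finset.sum_nonneg fun m _ => star_mul_self_nonneg _)

theorem gram_pos {D κ : Type*} [CStarAlgebra D] [Fintype κ] {k : ℕ} (w : κ → Fin k → D) :
    IsPosElem (Matrix.of fun p q => ∑ m, star (w m p) * w m q) := by
  let _ := CStarAlgebra.spectralOrder D
  have _ := CStarAlgebra.spectralOrderedRing D
  rcases k with _ | k
  · exact ⟨0, by ext p; exact p.elim0⟩
  obtain ⟨Y, hY⟩ := gram_pos_aux (M := CStarMatrix (Fin (k + 1)) (Fin (k + 1)) D)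
    (fun m => CStarMatrix.ofMatrix (Matrix.of fun p q => if p = 0 then w m q else 0))
  refine ⟨CStarMatrix.ofMatrix.symm Y, ?_⟩
  ext p q
  have h := congrFun (congrFun hY p) q
  have e1 : (star (CStarMatrix.ofMatrix.symm Y) * CStarMatrix.ofMatrix.symm Y) p q = (star Y * Y) p q := by
    rfl
  rw [e1, ← h, Matrix.of_apply]
  have e2 : (∑ m, star (CStarMatrix.ofMatrix (Matrix.of fun p q => if p = 0 then w m q else 0)) *
      CStarMatrix.ofMatrix (Matrix.of fun p q => if p = 0 then w m q else 0) :
        CStarMatrix (Fin (k + 1)) (Fin (k + 1)) D) p q = ∑ m,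
      (star (CStarMatrix.ofMatrix (Matrix.of fun p q => if p = 0 then w m q else 0)) *
      CStarMatrix.ofMatrix (Matrix.of fun p q => if p = 0 then w m q else 0) :
        CStarMatrix (Fin (k + 1)) (Fin (k + 1)) D) p q :=
    Matrix.sum_apply p q Finset.univ (fun m => (CStarMatrix.ofMatrix.symm
      (star (CStarMatrix.ofMatrix (Matrix.of fun p q => if p = 0 then w m q else 0)) *
      CStarMatrix.ofMatrix (Matrix.of fun p q => if p = 0 then w m q else 0) :
        CStarMatrix (Fin (k + 1)) (Fin (k + 1)) D)))
  rw [e2]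
  refine Finset.sum_congr rfl fun m _ => ?_
  rw [CStarMatrix.mul_apply, Finset.sum_eq_single 0]
  · simp [CStarMatrix.star_apply]
  · intro i _ hi
    simp [CStarMatrix.star_apply, hi]
  · simp

section Step3
variable {s : ℕ} {r : Fin s → ℕ} {D : Type*} [CStarAlgebra D]

def phiM (y : (Σ i, Fin (r i)) → D) (t : ℝ) : FDBlock s r →ₗ[ℂ] D where
  toFun x := (t ^ 2 : ℝ) • PhiM y (bdH s r x)
  map_add' a b := by
    simp only [PhiM, map_add, Matrix.add_apply, add_smul, Finset.sum_add_distrib, smul_add]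
  map_smul' z a := by
    simp only [PhiM, map_smul, Matrix.smul_apply, smul_assoc, ← Finset.smul_sum, RingHom.id_apply]
    rw [smul_comm]

theorem phiM_apply (y : (Σ i, Fin (r i)) → D) (t : ℝ) (x : FDBlock s r) :
    phiM y t x = (t ^ 2 : ℝ) • PhiM y (bdH s r x) := rfl

theorem phiM_cp (y : (Σ i, Fin (r i)) → D) (t : ℝ) : IsCompletelyPositive (phiM y t) := by
  rintro k x ⟨z, rfl⟩
  have h := gram_pos (fun (m : Fin k × (Σ i, Fin (r i))) (q : Fin k) =>
    (t : ℂ) • ∑ b, bdH s r (z m.1 q) m.2 b • star (y b))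
  convert h using 1
  ext p q
  rw [Matrix.map_apply, Matrix.of_apply, phiM_apply, Matrix.mul_apply, map_sum, Fintype.sum_prod_type]
  have e : PhiM y (∑ m, bdH s r (star z p m * z m q)) = ∑ m, PhiM y (bdH s r (star z p m * z m q)) := by
    simp only [PhiM, Matrix.sum_apply, Finset.sum_smul]
    rw [Finset.sum_comm]
    rw [Finset.sum_congr rfl fun u _ => Finset.sum_comm]
    rw [Finset.sum_comm]
    refine Finset.sum_congr rfl fun m _ => Finset.sum_comm
  rw [e, Finset.smul_sum]
  refine Finset.sum_congr rfl fun m _ => ?_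
  rw [Matrix.star_apply, map_mul, map_star]
  simp only [PhiM, Matrix.mul_apply, Finset.sum_smul, star_smul, smul_mul_smul_comm, star_sum, star_star,
    Finset.sum_mul, Finset.mul_sum, Matrix.star_apply]
  have ht : star (t : ℂ) * (t : ℂ) = ((t ^ 2 : ℝ) : ℂ) := by
    rw [Complex.star_def, Complex.conj_ofReal]; push_cast; ring
  rw [← Finset.smul_sum, ht, Complex.coe_smul]
  congr 1
  rw [Finset.sum_congr rfl fun u _ => Finset.sum_comm]
  rw [Finset.sum_comm]
  refine Finset.sum_congr rfl fun m _ => Finset.sum_comm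

theorem phiM_oz {n : ℕ} (y : (Σ i, Fin (r i)) → D) (t : ℝ) (J : Fin s → Fin (n + 1)) (k : Fin s → D)
    (ho : ∀ c d, J c.1 = J d.1 → star (y c) * y d = if c = d then k c.1 else 0) (j : Fin (n + 1)) :
    OrderZeroOn (phiM y t) (blockSupp J j) := by
  have key : ∀ e ∈ blockSupp (r := r) J j, ∀ f ∈ blockSupp (r := r) J j, e * f = 0 →
      phiM y t e * phiM y t f = 0 := by
    intro e he f hf hef
    have hsupp : ∀ x ∈ blockSupp (r := r) J j, ∀ c d : (Σ i, Fin (r i)), J c.1 ≠ j → bdH s r x c d = 0 := by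
      intro x hx c d hc
      obtain ⟨i, c⟩ := c
      obtain ⟨i', d⟩ := d
      by_cases h : i = i'
      · subst h
        rw [bdH_eq, hx i hc]; rfl
      · exact bdH_ne _ _ _ h
    have h0 : bdH s r e * bdH s r f = 0 := by rw [← map_mul, hef, map_zero]
    rw [phiM_apply, phiM_apply, smul_mul_smul_comm]
    have : PhiM y (bdH s r e) * PhiM y (bdH s r f) = ∑ c, ∑ d', (bdH s r e * bdH s r f) c d' •
        (y c * k c.1 * star (y d')) := by
      rw [show PhiM y (bdH s r e) = ∑ c, ∑ d, bdH s r e c d • (y c * star (y d)) from rfl, Finset.sum_mul]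
      refine Finset.sum_congr rfl fun c _ => ?_
      simp only [Matrix.mul_apply, Finset.sum_smul]
      rw [Finset.sum_comm, Finset.sum_mul]
      refine Finset.sum_congr rfl fun d _ => ?_
      rw [show PhiM y (bdH s r f) = ∑ c, ∑ d, bdH s r f c d • (y c * star (y d)) from rfl, Finset.mul_sum]
      by_cases hcd : c.1 = d.1
      swap
      · simp [bdH_ne e c d hcd]
      by_cases hj : J d.1 = j
      swap
      · have : bdH s r e c d = 0 := hsupp e he c d (by rwa [hcd])
        simp [this]
      rw [Finset.sum_eq_single d]
      · rw [Finset.mul_sum]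
        refine Finset.sum_congr rfl fun d' _ => ?_
        rw [smul_mul_smul_comm]
        congr 1
        have := ho d d rfl
        rw [if_pos rfl, ← hcd] at this
        rw [← this]
        simp only [mul_assoc]
      · intro c' _ hc'
        rw [Finset.mul_sum]
        refine Finset.sum_eq_zero fun d' _ => ?_
        by_cases hj' : J c'.1 = j
        · have := ho d c' (by rw [hj, hj'])
          rw [if_neg (Ne.symm hc')] at this
          rw [smul_mul_smul_comm, mul_assoc, ← mul_assoc (star (y d)), this]
          simp
        · rw [hsupp f hf c' d' hj']
          simp
      · simp
    rw [this, h0]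
    simp
  exact fun e he f hf h1 h2 => ⟨key e he f hf h1, key f hf e he h2⟩

end Step3

theorem dr_of_starR (n : ℕ) {D : Type} [CStarAlgebra D] (h : StarR n D) : DecompositionRankLE n D := by
  intro S ε hε
  obtain ⟨L, hL, hSL⟩ := exists_norm_bound S
  obtain ⟨e, he, he1, hee⟩ : ∃ e : ℝ, 0 < e ∧ e ≤ 1 ∧ 5 * L * e ≤ ε := by
    refine ⟨min 1 (ε / (5 * L)), by positivity, min_le_left _ _, ?_⟩
    calc 5 * L * min 1 (ε / (5 * L)) ≤ 5 * L * (ε / (5 * L)) := by gcongr; exact min_le_right _ _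
      _ = ε := by field_simp
  obtain ⟨s, r, J, y, k, ψ, δ, hcp, h1, ho, hs, hδ0, hδ1, -, hS⟩ := h S e he
  have hone : ‖(1 : D)‖ ≤ 1 := norm_proj_le (one_mul 1) (star_one _)
  have hyn : rn y ≤ 2 := rn_le_two y hone he1 hs
  have hyn2 : rn y ^ 2 ≤ 1 + e := by
    rw [rn_sq]
    have := norm_sub_norm_le (∑ c, y c * star (y c)) 1
    linarith
  obtain ⟨t, ht0, ht⟩ : ∃ t : ℝ, 0 ≤ t ∧ t ^ 2 = (1 + e)⁻¹ :=
    ⟨Real.sqrt (1 + e)⁻¹, Real.sqrt_nonneg _, Real.sq_sqrt (by positivity)⟩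
  have hn1 : ‖ψ 1‖ ≤ 1 := by rw [h1]; exact norm_FD_one_le
  refine ⟨s, r, J, ψ, phiM y t, hcp, phiM_cp y t, ucp_norm_le ψ hcp hn1, fun x => ?_,
    phiM_oz y t J k ho, fun b hb => ?_⟩
  · rw [phiM_apply, norm_smul, Real.norm_of_nonneg (by positivity), ht]
    have h2 := norm_PhiM_le y (bdH s r x)
    have h3 := norm_bdH_le x
    have h4 : rn y ^ 2 * ‖bdH s r x‖ ≤ (1 + e) * ‖x‖ := by gcongr
    rw [inv_mul_le_iff₀ (by positivity)]
    exact h2.trans h4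
  · have e1 : PhiM y (bdH s r (ψ b)) - b = b * (∑ c, y c * star (y c) - 1) -
        ∑ d, (b * y d - ∑ c, bdH s r (ψ b) c d • y c) * star (y d) := by
      have : PhiM y (bdH s r (ψ b)) = ∑ d, (∑ c, bdH s r (ψ b) c d • y c) * star (y d) := by
        simp only [PhiM, Finset.sum_mul, smul_mul_assoc]
        exact Finset.sum_comm
      rw [this]
      simp only [sub_mul, Finset.sum_sub_distrib, mul_sub, Finset.mul_sum, mul_one, mul_assoc]
      abel
    have h2 : ‖PhiM y (bdH s r (ψ b)) - b‖ ≤ L * e + e * 2 := by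
      rw [e1]
      refine (norm_sub_le _ _).trans (add_le_add ?_ ?_)
      · exact (norm_mul_le _ _).trans (mul_le_mul (hSL b hb) hs (norm_nonneg _) (by positivity))
      · refine (norm_sum_mul_star_le _ _).trans (mul_le_mul ?_ hyn (rn_nonneg _) he.le)
        refine (hS b hb).trans ?_
        nlinarith
    have ht1 : t ^ 2 ≤ 1 := by rw [ht]; exact inv_le_one_of_one_le₀ (by linarith)
    have ht2 : 1 - t ^ 2 ≤ e := by
      rw [ht]
      have : (1 - e) ≤ (1 + e)⁻¹ := by
        rw [← one_div, le_div_iff₀ (by positivity)]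
        nlinarith
      linarith
    have e2 : phiM y t (ψ b) - b = (t ^ 2 : ℝ) • (PhiM y (bdH s r (ψ b)) - b) - (1 - t ^ 2 : ℝ) • b := by
      rw [phiM_apply, sub_smul, smul_sub, one_smul]; abel
    rw [e2]
    refine lt_of_le_of_lt (norm_sub_le _ _) ?_
    rw [norm_smul, norm_smul, Real.norm_of_nonneg (by positivity), Real.norm_of_nonneg (by linarith)]
    have h3 : t ^ 2 * ‖PhiM y (bdH s r (ψ b)) - b‖ ≤ 1 * (L * e + e * 2) :=
      mul_le_mul ht1 h2 (norm_nonneg _) zero_le_one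
    have h4 : (1 - t ^ 2) * ‖b‖ ≤ e * L := mul_le_mul ht2 (hSL b hb) (norm_nonneg _) he.le
    nlinarith [mul_pos he (by linarith : 0 < L)]

/-! ### Permanence properties -/

theorem starP_local (n : ℕ) (D : Type) [CStarAlgebra D]
    (H : ∀ (S : Finset D) (ε : ℝ), 0 < ε → ∃ (B : CStarAlg), StarP n B.carrier ∧
      ∃ θ : B.carrier →⋆ₐ[ℂ] D, ∀ a ∈ S, ∃ b, ‖a - θ b‖ < ε) : StarP n D := by
  classical
  intro S ε₁ hε₁
  obtain ⟨ε, hε, hε1, hεle⟩ : ∃ ε : ℝ, 0 < ε ∧ ε ≤ 1 ∧ ε ≤ ε₁ :=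
    ⟨min ε₁ 1, by positivity, min_le_right _ _, min_le_left _ _⟩
  obtain ⟨B, hB, θ, hθ⟩ := H S (ε / 4) (by positivity)
  have hb : ∀ a, ∃ b, a ∈ S → ‖a - θ b‖ < ε / 4 := fun a => by
    by_cases ha : a ∈ S
    · obtain ⟨b, hb⟩ := hθ a ha; exact ⟨b, fun _ => hb⟩
    · exact ⟨0, fun h => (ha h).elim⟩
  choose b hb using hb
  obtain ⟨ι, I, _, _, _, _, blk, col, y, k, X, hX, ho, hs, hS⟩ := hB (S.image b) (ε / 2) (by positivity)
  have hsum : ‖∑ c, θ (y c) * star (θ (y c)) - 1‖ ≤ ε / 2 := by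
    have : ∑ c, θ (y c) * star (θ (y c)) - 1 = θ (∑ c, y c * star (y c) - 1) := by
      simp [map_sub, map_sum, map_mul, map_star]
    rw [this]
    exact (NonUnitalStarAlgHom.norm_apply_le θ _).trans hs
  refine ⟨ι, I, inferInstance, inferInstance, inferInstance, inferInstance, blk, col,
    fun c => θ (y c), fun i => θ (k i), fun a => X (b a), fun a => hX _, fun c d hcd => ?_, ?_, fun a ha => ?_⟩
  · dsimp only
    rw [← map_star, ← map_mul, ho c d hcd]
    split_ifs <;> simp
  · linarith
  · have hyn : rn (fun c => θ (y c)) ≤ 2 := rn_le_two _ (norm_proj_le (one_mul 1) (star_one _))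
      (by linarith : ε / 2 ≤ 1) hsum
    have e : (fun d => a * θ (y d) - ∑ c, X (b a) c d • θ (y c)) = fun d =>
        (a - θ (b a)) * θ (y d) + θ (b a * y d - ∑ c, X (b a) c d • y c) := by
      funext d
      simp only [map_sub, map_mul, map_sum, map_smul, sub_mul]
      abel
    rw [e]
    have h1 := rn_add_le (fun d => (a - θ (b a)) * θ (y d))
      (fun d => θ (b a * y d - ∑ c, X (b a) c d • y c))
    have h2 := rn_mul_left (a - θ (b a)) (fun d => θ (y d))
    have h3 := rn_map (θ : B.carrier →⋆ₙₐ[ℂ] D) (fun d => b a * y d - ∑ c, X (b a) c d • y c)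
    have h4 := hS (b a) (Finset.mem_image_of_mem b ha)
    have h5 : ‖a - θ (b a)‖ * rn (fun d => θ (y d)) ≤ ε / 4 * 2 :=
      mul_le_mul (hb a ha).le hyn (rn_nonneg _) (by positivity)
    have h6 : rn (fun d => θ (b a * y d - ∑ c, X (b a) c d • y c)) ≤ ε / 2 := h3.trans h4
    linarith

theorem starP_iso (n : ℕ) {B D : Type} [CStarAlgebra B] [CStarAlgebra D] (h : StarP n B)
    (θ : B ≃⋆ₐ[ℂ] D) : StarP n D :=
  starP_local n D fun _ ε hε => ⟨⟨B⟩, h, (θ : B →⋆ₐ[ℂ] D), fun a _ => ⟨θ.symm a, by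
    have : (θ : B →⋆ₐ[ℂ] D) (θ.symm a) = a := θ.apply_symm_apply a
    rw [this]; simpa using hε⟩⟩

theorem rn_prod_le {ι B₁ B₂ : Type*} [Fintype ι] [DecidableEq ι] [CStarAlgebra B₁] [CStarAlgebra B₂]
    (R : ι → B₁ × B₂) {ε : ℝ} (h1 : rn (fun c => (R c).1) ≤ ε) (h2 : rn (fun c => (R c).2) ≤ ε) :
    rn R ≤ ε := by
  have h0 : 0 ≤ ε := (rn_nonneg _).trans h1
  refine Real.sqrt_le_iff.2 ⟨h0, ?_⟩
  rw [Prod.norm_def, Prod.fst_sum, Prod.snd_sum]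
  refine max_le ?_ ?_
  · have := rn_sq (fun c => (R c).1)
    refine this.symm.le.trans ?_
    have := rn_nonneg (fun c => (R c).1)
    gcongr
  · have := rn_sq (fun c => (R c).2)
    refine this.symm.le.trans ?_
    have := rn_nonneg (fun c => (R c).2)
    gcongr

theorem rn_inl {ι κ D : Type*} [Fintype ι] [Fintype κ] [DecidableEq ι] [DecidableEq κ] [CStarAlgebra D]
    (R : ι ⊕ κ → D) (h : ∀ c, R (Sum.inr c) = 0) : rn R = rn (fun c => R (Sum.inl c)) := by
  unfold rn; rw [Fintype.sum_sum_type]; simp [h]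

theorem rn_inr {ι κ D : Type*} [Fintype ι] [Fintype κ] [DecidableEq ι] [DecidableEq κ] [CStarAlgebra D]
    (R : ι ⊕ κ → D) (h : ∀ c, R (Sum.inl c) = 0) : rn R = rn (fun c => R (Sum.inr c)) := by
  unfold rn; rw [Fintype.sum_sum_type]; simp [h]

theorem starP_prod (n : ℕ) {B₁ B₂ : Type} [CStarAlgebra B₁] [CStarAlgebra B₂] (h₁ : StarP n B₁)
    (h₂ : StarP n B₂) : StarP n (B₁ × B₂) := by
  classical
  intro S ε hε
  obtain ⟨ι₁, I₁, _, _, _, _, blk₁, col₁, y₁, k₁, X₁, hX₁, ho₁, hs₁, hS₁⟩ := h₁ (S.image Prod.fst) ε hε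
  obtain ⟨ι₂, I₂, _, _, _, _, blk₂, col₂, y₂, k₂, X₂, hX₂, ho₂, hs₂, hS₂⟩ := h₂ (S.image Prod.snd) ε hε
  refine ⟨ι₁ ⊕ ι₂, I₁ ⊕ I₂, inferInstance, inferInstance, inferInstance, inferInstance, Sum.map blk₁ blk₂,
    Sum.elim col₁ col₂, Sum.elim (fun c => (y₁ c, 0)) (fun c => (0, y₂ c)),
    Sum.elim (fun c => (k₁ c, 0)) (fun c => (0, k₂ c)),
    fun b => Matrix.fromBlocks (X₁ b.1) 0 0 (X₂ b.2), ?_, ?_, ?_, fun b hb => ?_⟩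
  · rintro b (c | c) (d | d) h
    · exact hX₁ _ _ _ fun h' => h (by simp [h'])
    · rfl
    · rfl
    · exact hX₂ _ _ _ fun h' => h (by simp [h'])
  · rintro (c | c) (d | d) h
    · have := ho₁ c d h
      simp only [Sum.elim_inl, Sum.map_inl, Sum.inl.injEq]
      ext
      · simp [this]; split_ifs <;> rfl
      · simp; split_ifs <;> rfl
    · ext <;> simp
    · ext <;> simp
    · have := ho₂ c d h
      simp only [Sum.elim_inr, Sum.map_inr, Sum.inr.injEq]
      ext
      · simp; split_ifs <;> rfl
      · simp [this]; split_ifs <;> rfl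
  · rw [Prod.norm_def, Prod.fst_sub, Prod.snd_sub, Prod.fst_sum, Prod.snd_sum, Fintype.sum_sum_type,
      Fintype.sum_sum_type]
    simpa using ⟨hs₁, hs₂⟩
  · apply rn_prod_le
    · rw [rn_inl _ (fun c => by simp [Prod.fst_sum])]
      refine le_of_eq_of_le (rn_congr fun d => ?_) (hS₁ b.1 (Finset.mem_image_of_mem _ hb))
      simp [Prod.fst_sum]
    · rw [rn_inr _ (fun c => by simp [Prod.snd_sum])]
      refine le_of_eq_of_le (rn_congr fun d => ?_) (hS₂ b.2 (Finset.mem_image_of_mem _ hb))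
      simp [Prod.snd_sum]

theorem starP_matrix (n K : ℕ) {B B' : Type} [CStarAlgebra B] [CStarAlgebra B'] (h : StarP n B)
    (θ : B' ≃⋆ₐ[ℂ] Matrix (Fin (K + 1)) (Fin (K + 1)) B) : StarP n B' := by
  classical
  let E : Fin (K + 1) → Fin (K + 1) → B →ₗ[ℂ] B' := fun u v =>
    { toFun := fun b => θ.symm (Matrix.single u v b)
      map_add' := fun a b => by rw [Matrix.single_add, map_add]
      map_smul' := fun t a => by rw [← Matrix.smul_single, map_smul]; rfl }
  have hE : ∀ u v b, E u v b = θ.symm (Matrix.single u v b) := fun _ _ _ => rfl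
  have hEs : ∀ u v b, star (E u v b) = E v u (star b) := fun u v b => by
    rw [hE, hE, ← map_star]
    congr 1
    ext p q
    simp only [Matrix.star_apply, Matrix.single_apply]
    split_ifs with h1 h2 h2
    · rfl
    · exact (h2 ⟨h1.2, h1.1⟩).elim
    · exact (h1 ⟨h2.2, h2.1⟩).elim
    · simp
  have hEm : ∀ u v w a b, E u v a * E v w b = E u w (a * b) := fun u v w a b => by
    rw [hE, hE, hE, ← map_mul, Matrix.single_mul_single_same]
  have hEm0 : ∀ u v v' w a b, v ≠ v' → E u v a * E v' w b = 0 := fun u v v' w a b hv => by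
    rw [hE, hE, ← map_mul, Matrix.single_mul_single_of_ne (h := hv), map_zero]
  have hdec : ∀ b, b = ∑ u, ∑ v, E u v (θ b u v) := fun b => by
    simp only [hE]
    simp only [← map_sum]
    rw [← Matrix.matrix_eq_sum_single, θ.symm_apply_apply]
  -- the diagonal embeddings
  let μ : Fin (K + 1) → B →⋆ₙₐ[ℂ] B' := fun u =>
    { toFun := fun b => E u u b
      map_smul' := fun t a => map_smul _ _ _
      map_zero' := map_zero _
      map_add' := fun a b => map_add _ _ _
      map_mul' := fun a b => (hEm u u u a b).symm
      map_star' := fun a => (hEs u u a).symm }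
  have hμ : ∀ u b, ‖E u u b‖ ≤ ‖b‖ := fun u b => NonUnitalStarAlgHom.norm_apply_le (μ u) b
  have hone : ∑ u, E u u 1 = 1 := by
    have h1 := hdec 1
    rw [map_one] at h1
    rw [h1]
    refine Finset.sum_congr rfl fun u _ => ?_
    rw [Finset.sum_eq_single u]
    · simp
    · intro v _ hv; rw [Matrix.one_apply_ne hv.symm, map_zero]
    · simp
  intro S ε hε
  obtain ⟨ι, I, _, _, _, _, blk, col, y, k, X, hX, ho, hs, hS⟩ :=
    h ((S ×ˢ (Finset.univ : Finset (Fin (K + 1) × Fin (K + 1)))).image (fun t => θ t.1 t.2.1 t.2.2))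
      (ε / ((K + 1) * (K + 1))) (by positivity)
  have hKK : ((K : ℝ) + 1) * (ε / ((K + 1) * (K + 1))) ≤ ε := by
    rw [← mul_div_assoc, div_le_iff₀ (by positivity)]
    have : (0 : ℝ) ≤ K := Nat.cast_nonneg _
    nlinarith [mul_nonneg hε.le this, mul_nonneg (mul_nonneg hε.le this) this]
  refine ⟨ι × Fin (K + 1), I, inferInstance, inferInstance, inferInstance, inferInstance,
    fun c => blk c.1, col, fun c => E c.2 0 (y c.1), fun i => E 0 0 (k i),
    fun b => Matrix.of fun c d => X (θ b c.2 d.2) c.1 d.1, fun b c d hcd => ?_, fun c d hcd => ?_, ?_,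
    fun b hb => ?_⟩
  · exact hX _ _ _ hcd
  · dsimp only
    rw [hEs]
    by_cases h2 : c.2 = d.2
    · rw [h2, hEm, ho _ _ hcd]
      by_cases h1 : c.1 = d.1
      · rw [if_pos h1, if_pos (Prod.ext h1 h2)]
      · rw [if_neg h1, if_neg (fun h => h1 (by rw [h])), map_zero]
    · rw [hEm0 _ _ _ _ _ _ h2, if_neg (fun h => h2 (by rw [h]))]
  · have e : ∑ c : ι × Fin (K + 1), E c.2 0 (y c.1) * star (E c.2 0 (y c.1)) - 1 =
        ∑ u, E u u (∑ c, y c * star (y c) - 1) := by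
      simp only [hEs, hEm, map_sub, Finset.sum_sub_distrib, hone, map_sum]
      rw [Fintype.sum_prod_type, Finset.sum_comm]
    rw [e]
    refine (norm_sum_le _ _).trans ((Finset.sum_le_sum fun u _ => (hμ u _).trans hs).trans ?_)
    simpa using hKK
  · have e : (fun d : ι × Fin (K + 1) => b * E d.2 0 (y d.1) - ∑ c : ι × Fin (K + 1),
        (Matrix.of fun c d : ι × Fin (K + 1) => X (θ b c.2 d.2) c.1 d.1) c d • E c.2 0 (y c.1)) =
        fun d => ∑ t : Fin (K + 1) × Fin (K + 1), if d.2 = t.2 then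
          E t.1 0 (θ b t.1 t.2 * y d.1 - ∑ c, X (θ b t.1 t.2) c d.1 • y c) else 0 := by
      funext d
      rw [Fintype.sum_prod_type, Fintype.sum_prod_type, Finset.sum_comm (s := (Finset.univ : Finset ι))]
      simp only [Matrix.of_apply, Finset.sum_ite_eq, Finset.mem_univ, if_true, map_sub, map_sum, map_smul,
        Finset.sum_sub_distrib]
      congr 1
      conv_lhs => rw [hdec b]
      rw [Finset.sum_mul]
      refine Finset.sum_congr rfl fun u _ => ?_
      rw [Finset.sum_mul, Finset.sum_eq_single d.2]
      · rw [hEm]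
      · intro v _ hv; rw [hEm0 _ _ _ _ _ _ hv]
      · simp
    rw [e]
    refine (rn_sum_le _ _).trans ?_
    have : ∀ t ∈ (Finset.univ : Finset (Fin (K + 1) × Fin (K + 1))),
        rn (fun d : ι × Fin (K + 1) => if d.2 = t.2 then
          E t.1 0 (θ b t.1 t.2 * y d.1 - ∑ c, X (θ b t.1 t.2) c d.1 • y c) else 0) ≤
          ε / ((K + 1) * (K + 1)) := by
      intro t _
      refine le_trans ?_ (hS (θ b t.1 t.2) (Finset.mem_image.2 ⟨(b, t), by simp [hb], rfl⟩))
      apply Real.sqrt_le_sqrt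
      refine le_trans (le_of_eq ?_) (hμ t.1 _)
      congr 1
      rw [Fintype.sum_prod_type, map_sum]
      refine Finset.sum_congr rfl fun c _ => ?_
      rw [Finset.sum_eq_single t.2]
      · dsimp only
        rw [if_pos rfl, hEs, hEm]
      · intro v _ hv; dsimp only; rw [if_neg hv, zero_mul]
      · simp
    refine (Finset.sum_le_sum this).trans ?_
    simp
    apply le_of_eq
    field_simp

/-! ### Rotating the frame so that a given projection acts diagonally -/

section Rot

def actR {ι D : Type*} [Fintype ι] [AddCommMonoid D] [Module ℂ D] (y : ι → D) (X : Matrix ι ι ℂ) : ι → D :=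
  fun d => ∑ c, X c d • y c

theorem actR_actR {ι D : Type*} [Fintype ι] [AddCommMonoid D] [Module ℂ D] (y : ι → D)
    (X W : Matrix ι ι ℂ) : actR (actR y X) W = actR y (X * W) := by
  funext d
  simp only [actR, Matrix.mul_apply, Finset.sum_smul, Finset.smul_sum, smul_smul]
  rw [Finset.sum_comm]
  exact Finset.sum_congr rfl fun a _ => Finset.sum_congr rfl fun b _ => by rw [mul_comm]

theorem actR_one {ι D : Type*} [Fintype ι] [DecidableEq ι] [AddCommMonoid D] [Module ℂ D] (y : ι → D) :
    actR y (1 : Matrix ι ι ℂ) = y := by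
  funext d
  simp [actR, Matrix.one_apply]

theorem actR_sub {ι D : Type*} [Fintype ι] [AddCommGroup D] [Module ℂ D] (y z : ι → D)
    (X : Matrix ι ι ℂ) : actR (fun d => y d - z d) X = fun d => actR y X d - actR z X d := by
  funext d
  simp [actR, smul_sub]

theorem actR_subm {ι D : Type*} [Fintype ι] [AddCommGroup D] [Module ℂ D] (y : ι → D)
    (X W : Matrix ι ι ℂ) : actR y (X - W) = fun d => actR y X d - actR y W d := by
  funext d
  simp [actR, sub_smul]

theorem actR_mulL {ι D : Type*} [Fintype ι] [CStarAlgebra D] (b : D) (y : ι → D)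
    (X : Matrix ι ι ℂ) : actR (fun d => b * y d) X = fun d => b * actR y X d := by
  funext d
  simp [actR, Finset.mul_sum]

theorem rn_actR {ι D : Type*} [Fintype ι] [DecidableEq ι] [CStarAlgebra D] (y : ι → D)
    (X : Matrix ι ι ℂ) : rn (actR y X) ≤ rn y * ‖X‖ := rn_mul_sc X y

theorem actR_sum_star {ι D : Type*} [Fintype ι] [DecidableEq ι] [CStarAlgebra D] (y : ι → D)
    (X : Matrix ι ι ℂ) (hX : X * star X = 1) :
    ∑ d, actR y X d * star (actR y X d) = ∑ c, y c * star (y c) := by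
  simp only [actR, star_sum, star_smul, Finset.sum_mul_sum, smul_mul_smul_comm]
  rw [Finset.sum_comm]
  refine Finset.sum_congr rfl fun a _ => ?_
  rw [Finset.sum_comm]
  have : ∀ b, ∑ d, (X a d * star (X b d)) • (y a * star (y b)) = ((1 : Matrix ι ι ℂ) a b) • (y a * star (y b)) := by
    intro b
    rw [← Finset.sum_smul, ← hX, Matrix.mul_apply]
    rfl
  simp only [this, Matrix.one_apply]
  simp

theorem rot_data (n : ℕ) {D : Type} [CStarAlgebra D] (h : StarR n D) (p : D) (hp : p * p = p)
    (hs : star p = p) (S : Finset D) (ε : ℝ) (hε : 0 < ε) :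
    ∃ (s : ℕ) (r : Fin s → ℕ) (J : Fin s → Fin (n + 1)) (z : (Σ i, Fin (r i)) → D) (k : Fin s → D)
      (X : D → FDBlock s r) (lam : (Σ i, Fin (r i)) → ℝ),
      (∀ b, ‖X b‖ ≤ ‖b‖) ∧
      (∀ c d, J c.1 = J d.1 → star (z c) * z d = if c = d then k c.1 else 0) ∧
      ‖∑ c, z c * star (z c) - 1‖ ≤ ε ∧
      (∀ b ∈ S, rn (fun d => b * z d - ∑ c, bdH s r (X b) c d • z c) ≤ ε) ∧
      rn (fun d => p * z d - (lam d : ℂ) • z d) ≤ ε ∧ ∀ c, |lam c - lam c ^ 2| ≤ 3 * ε := by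
  classical
  obtain ⟨s, r, J, y, k, ψ, δ, hcp, h1, ho, hsum, hδ0, hδ1, hlow, hS⟩ := h (insert p S) ε hε
  have hψ : ∀ b, ‖ψ b‖ ≤ ‖b‖ := fun b => ucp_norm_le ψ hcp (by rw [h1]; exact norm_FD_one_le) b
  have hH : star (ψ p) = ψ p := by rw [← cp_star hcp, hs]
  have hHi : ∀ i, (ψ p i).IsHermitian := fun i => congrFun hH i
  have hpn := norm_proj_le hp hs
  let U : FDBlock s r := fun i => ((hHi i).eigenvectorUnitary : Matrix (Fin (r i)) (Fin (r i)) ℂ)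
  have hU1 : star U * U = 1 := funext fun i => Unitary.coe_star_mul_self (hHi i).eigenvectorUnitary
  have hU2 : U * star U = 1 := funext fun i => Unitary.coe_mul_star_self (hHi i).eigenvectorUnitary
  have hUn : ‖U‖ ≤ 1 := by
    have : ‖U‖ * ‖U‖ ≤ 1 := by
      rw [← CStarRing.norm_star_mul_self, hU1]; exact norm_FD_one_le
    nlinarith [norm_nonneg U]
  have hUsn : ‖star U‖ ≤ 1 := by rwa [norm_star]
  have hconj : ∀ Z : FDBlock s r, ‖star U * Z * U‖ ≤ ‖Z‖ := fun Z => by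
    calc _ ≤ ‖star U‖ * ‖Z‖ * ‖U‖ := (norm_mul_le _ _).trans (by gcongr; exact norm_mul_le _ _)
      _ ≤ 1 * ‖Z‖ * 1 := by gcongr
      _ = _ := by ring
  have hb1 : bdH s r (1 : FDBlock s r) = 1 := Matrix.blockDiagonal'_one
  let V := bdH s r U
  have hV1 : star V * V = 1 := by rw [← map_star, ← map_mul, hU1, hb1]
  have hV2 : V * star V = 1 := by rw [← map_star, ← map_mul, hU2, hb1]
  have hVn : ‖V‖ ≤ 1 := (norm_bdH_le _).trans hUn
  let lam : (Σ i, Fin (r i)) → ℝ := fun c => (hHi c.1).eigenvalues c.2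
  have hdiag : ∀ i, (star U * ψ p * U) i = Matrix.diagonal (fun a => (lam ⟨i, a⟩ : ℂ)) := fun i => by
    have := (hHi i).conjStarAlgAut_star_eigenvectorUnitary
    rw [Unitary.conjStarAlgAut_star_apply] at this
    exact this
  have hres : ∀ b ∈ insert p S, rn (fun d => b * actR y V d - actR (actR y V) (bdH s r (star U * ψ b * U)) d) ≤ ε := by
    intro b hb
    have e : (fun d => b * actR y V d - actR (actR y V) (bdH s r (star U * ψ b * U)) d) =
        actR (fun d => b * y d - actR y (bdH s r (ψ b)) d) V := by
      rw [actR_sub, actR_mulL, actR_actR, actR_actR]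
      have : V * bdH s r (star U * ψ b * U) = bdH s r (ψ b) * V := by
        rw [← map_mul, ← map_mul, ← mul_assoc, ← mul_assoc, hU2, one_mul]
      rw [this]
    rw [e]
    have h3 : rn (fun d => b * y d - actR y (bdH s r (ψ b)) d) ≤ ε * δ := hS b hb
    refine (rn_actR _ _).trans ?_
    have := rn_nonneg (fun d => b * y d - actR y (bdH s r (ψ b)) d)
    nlinarith [norm_nonneg V, mul_pos hε hδ0]
  refine ⟨s, r, J, actR y V, k, fun b => star U * ψ b * U, lam, fun b => (hconj _).trans (hψ b), ?_, ?_, ?_, ?_, ?_⟩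
  · intro c d hcd
    have e1 : star (actR y V c) * actR y V d = ∑ a, ∑ b, (star (V a c) * V b d) • (star (y a) * y b) := by
      simp only [actR, star_sum, star_smul, Finset.sum_mul_sum, smul_mul_smul_comm]
    have e2 : ∀ a b, (star (V a c) * V b d) • (star (y a) * y b) =
        if a = b then (star (V a c) * V a d) • k c.1 else 0 := by
      intro a b
      by_cases ha : a.1 = c.1
      · by_cases hb : b.1 = d.1
        · rw [ho a b (by rw [ha, hb, hcd])]
          by_cases hab : a = b
          · subst hab; rw [if_pos rfl, if_pos rfl, ha]
          · rw [if_neg hab, if_neg hab, smul_zero]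
        · have : V b d = 0 := bdH_ne _ _ _ hb
          rw [this, mul_zero, zero_smul]
          split_ifs with hab
          · rw [hab, this, mul_zero, zero_smul]
          · rfl
      · have : V a c = 0 := bdH_ne _ _ _ ha
        rw [this]; simp
    rw [e1]
    simp only [e2, Finset.sum_ite_eq, Finset.mem_univ, if_true]
    rw [← Finset.sum_smul]
    have e3 : ∑ a, star (V a c) * V a d = (1 : Matrix (Σ i, Fin (r i)) (Σ i, Fin (r i)) ℂ) c d := by
      rw [← hV1, Matrix.mul_apply]; rfl
    rw [e3, Matrix.one_apply]
    split_ifs <;> simp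
  · rw [actR_sum_star y V hV2]; exact hsum
  · exact fun b hb => hres b (Finset.mem_insert_of_mem hb)
  · refine le_trans (le_of_eq ?_) (hres p (Finset.mem_insert_self _ _))
    congr 1
    funext d
    congr 1
    have : bdH s r (star U * ψ p * U) = Matrix.diagonal (fun c => (lam c : ℂ)) := by
      rw [bdH_apply, show star U * ψ p * U = fun i => Matrix.diagonal (fun a => (lam ⟨i, a⟩ : ℂ)) from funext hdiag]
      exact Matrix.blockDiagonal'_diagonal _
    rw [this]
    simp [actR, Matrix.diagonal_apply]
  · have hHH : ‖ψ p - ψ p * ψ p‖ ≤ 3 * ε := by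
      let R := fun d => p * y d - actR y (bdH s r (ψ p)) d
      have hR : rn R ≤ ε * δ := hS p (Finset.mem_insert_self _ _)
      have e : actR y (bdH s r (ψ p - ψ p * ψ p)) = fun d => (p * R d - R d) + actR R (bdH s r (ψ p)) d := by
        rw [map_sub, map_mul, actR_subm, ← actR_actR, actR_sub, actR_mulL]
        funext d
        simp only [R]
        rw [mul_sub, ← mul_assoc, hp]
        abel
      have h4 := hlow (ψ p - ψ p * ψ p)
      change _ ≤ rn (actR y (bdH s r (ψ p - ψ p * ψ p))) at h4
      rw [e] at h4
      have h5 := rn_add_le (fun d => p * R d - R d) (actR R (bdH s r (ψ p)))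
      have h6 := rn_sub_le (fun d => p * R d) R
      have h7 := rn_mul_left p R
      have h8 := rn_actR R (bdH s r (ψ p))
      have h9 : ‖bdH s r (ψ p)‖ ≤ 1 := (norm_bdH_le _).trans ((hψ p).trans hpn)
      have h10 := rn_nonneg R
      have h11 : δ * ‖ψ p - ψ p * ψ p‖ ≤ δ * (3 * ε) := by nlinarith
      exact le_of_mul_le_mul_left h11 hδ0
    intro c
    have e : (star U * (ψ p - ψ p * ψ p) * U) = star U * ψ p * U - (star U * ψ p * U) * (star U * ψ p * U) := by
      have : (star U * ψ p * U) * (star U * ψ p * U) = star U * ψ p * (U * star U) * ψ p * U := by noncomm_ring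
      rw [this, hU2]; noncomm_ring
    have h5 := (norm_le_pi_norm _ c.1).trans ((hconj _).trans hHH)
    rw [e, Pi.sub_apply, Pi.mul_apply (star U * ψ p * U) (star U * ψ p * U), hdiag, Matrix.diagonal_mul_diagonal, Matrix.diagonal_sub,
      Matrix.l2_opNorm_diagonal] at h5
    have h6 := (norm_le_pi_norm _ c.2).trans h5
    rw [← Complex.ofReal_mul, ← Complex.ofReal_sub, Complex.norm_real, Real.norm_eq_abs] at h6
    rw [sq]; exact h6

end Rot

/-! ### Corners -/

section Corner

theorem norm_submat_le {ι : Type*} [Fintype ι] [DecidableEq ι] (Q : ι → Prop) [DecidablePred Q]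
    (X : Matrix ι ι ℂ) : ‖(Matrix.of fun c d : {c // Q c} => X c.1 d.1)‖ ≤ ‖X‖ := by
  let V : Matrix ι {c // Q c} ℂ := Matrix.of fun c d => if c = d.1 then 1 else 0
  have hV1 : V.conjTranspose * V = 1 := by
    ext c d
    simp [V, Matrix.mul_apply, Matrix.conjTranspose_apply, Matrix.one_apply, Subtype.ext_iff, apply_ite]
    split_ifs with hcd
    · exact hcd.symm
    · exact fun h => hcd h.symm
  have h1 : ‖(1 : Matrix {c // Q c} {c // Q c} ℂ)‖ ≤ 1 := by
    rw [← Matrix.diagonal_one, Matrix.l2_opNorm_diagonal, pi_norm_le_iff_of_nonneg zero_le_one]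
    simp
  have hVn : ‖V‖ ≤ 1 := by
    have h2 := Matrix.l2_opNorm_conjTranspose_mul_self V
    rw [hV1] at h2
    nlinarith [norm_nonneg V]
  have e : (Matrix.of fun c d : {c // Q c} => X c.1 d.1) = V.conjTranspose * X * V := by
    ext c d
    simp [V, Matrix.mul_apply, Matrix.conjTranspose_apply, apply_ite]
  rw [e]
  calc _ ≤ ‖V.conjTranspose‖ * ‖X‖ * ‖V‖ := (Matrix.l2_opNorm_mul _ _).trans
        (mul_le_mul_of_nonneg_right (Matrix.l2_opNorm_mul _ _) (norm_nonneg _))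
    _ ≤ 1 * ‖X‖ * 1 := by rw [Matrix.l2_opNorm_conjTranspose]; gcongr
    _ = _ := by ring

theorem rn_scale_le {ι D : Type*} [Fintype ι] [DecidableEq ι] [CStarAlgebra D] (y : ι → D) (t : ι → ℝ) {a : ℝ}
    (ha : 0 ≤ a) (h : ∀ c, |t c| ≤ a) : rn (fun c => (t c : ℂ) • y c) ≤ rn y * a := by
  have e : (fun c => (t c : ℂ) • y c) = fun d => ∑ c, (Matrix.diagonal fun c => (t c : ℂ)) c d • y c := by
    funext d
    simp [Matrix.diagonal_apply]
  rw [e]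
  refine (rn_mul_sc _ _).trans ?_
  refine mul_le_mul_of_nonneg_left ?_ (rn_nonneg _)
  rw [Matrix.l2_opNorm_diagonal, pi_norm_le_iff_of_nonneg ha]
  intro c
  simpa using h c

theorem lam_high {l e : ℝ} (h : |l - l ^ 2| ≤ 3 * e) (hl : 1 / 2 ≤ l) : |l - 1| ≤ 6 * e := by
  have : |l - l ^ 2| = l * |l - 1| := by
    rw [show l - l ^ 2 = -(l * (l - 1)) by ring, abs_neg, abs_mul, abs_of_nonneg (by linarith)]
  nlinarith [abs_nonneg (l - 1)]

theorem lam_low {l e : ℝ} (h : |l - l ^ 2| ≤ 3 * e) (hl : ¬ 1 / 2 ≤ l) : |l| ≤ 6 * e := by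
  have : |l - l ^ 2| = |l| * (1 - l) := by
    rw [show l - l ^ 2 = l * (1 - l) by ring, abs_mul, abs_of_nonneg (a := 1 - l) (by linarith)]
  nlinarith [abs_nonneg l]

theorem starP_corner (n : ℕ) {B B' : Type} [CStarAlgebra B] [CStarAlgebra B'] (h : StarP n B)
    (p : B) (hpp : p * p = p) (hps : star p = p) (j : B' →⋆ₙₐ[ℂ] B) (hj : Function.Injective j)
    (hp1 : j 1 = p) (hr : ∀ x, p * x * p = x → ∃ x', j x' = x) : StarP n B' := by
  classical
  let _ := CStarAlgebra.spectralOrder B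
  have _ := CStarAlgebra.spectralOrderedRing B
  refine lemmaQ n j hj p hp1 hr fun S ε hε => ?_
  obtain ⟨L, hL, hSL⟩ := exists_norm_bound S
  obtain ⟨e, he0, he1, heL⟩ : ∃ e : ℝ, 0 < e ∧ e ≤ 1 ∧ 200 * L * e ≤ ε := by
    have hK : 0 < 200 * L := by positivity
    refine ⟨min 1 (ε / (200 * L)), by positivity, min_le_left _ _, ?_⟩
    calc _ ≤ 200 * L * (ε / (200 * L)) := by gcongr; exact min_le_right _ _
      _ = ε := by field_simp
  have hLe : e ≤ L * e := by nlinarith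
  have hee : e ^ 2 ≤ e := by nlinarith
  obtain ⟨s, r, J, z, k, X, lam, hX, ho, hsum, hS, hpz, hlam⟩ :=
    rot_data n (starR_of_starP n h) p hpp hps (S.image j) e he0
  have hpn := norm_proj_le hpp hps
  have hzn : rn z ≤ 2 := rn_le_two z (norm_proj_le (one_mul 1) (star_one _)) he1 hsum
  let Q : (Σ i, Fin (r i)) → Prop := fun c => 1 / 2 ≤ lam c
  -- kept columns are almost fixed by p
  have hkeep : rn (fun c : {c // Q c} => p * z c.1 - z c.1) ≤ 13 * e := by
    have e1 : (fun c : {c // Q c} => p * z c.1 - z c.1) = fun c : {c // Q c} =>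
        (p * z c.1 - (lam c.1 : ℂ) • z c.1) + ((lam c.1 - 1 : ℝ) : ℂ) • z c.1 := by
      funext c
      push_cast
      rw [sub_smul, one_smul]; abel
    rw [e1]
    refine (rn_add_le _ _).trans ?_
    have h1 := (rn_comp_le (fun c => p * z c - (lam c : ℂ) • z c) (fun c : {c // Q c} => c.1)
      Subtype.val_injective).trans hpz
    have h2 := rn_scale_le (fun c : {c // Q c} => z c.1) (fun c => lam c.1 - 1) (a := 6 * e) (by positivity)
      (fun c => lam_high (hlam c.1) c.2)
    have h3 := rn_comp_le z (fun c : {c // Q c} => c.1) Subtype.val_injective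
    have h4 : rn (fun c : {c // Q c} => z c.1) * (6 * e) ≤ 2 * (6 * e) := by gcongr; linarith
    linarith
  -- dropped columns are almost killed by p
  have hdrop : rn (fun c => if Q c then 0 else p * z c) ≤ 13 * e := by
    have e1 : (fun c => if Q c then 0 else p * z c) = fun c =>
        (if ¬ Q c then p * z c - (lam c : ℂ) • z c else 0) +
          ((if Q c then 0 else lam c : ℝ) : ℂ) • z c := by
      funext c
      by_cases hc : Q c <;> simp [hc]
    rw [e1]
    refine (rn_add_le _ _).trans ?_
    have h1 := (rn_mask_le (fun c => p * z c - (lam c : ℂ) • z c) (fun c => ¬ Q c)).trans hpz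
    have h2 := rn_scale_le z (fun c => if Q c then 0 else lam c) (a := 6 * e) (by positivity)
      (fun c => by
        by_cases hc : Q c
        · simp only [hc, if_true, abs_zero]; positivity
        · simp only [hc, if_false]; exact lam_low (hlam c) hc)
    have h4 : rn z * (6 * e) ≤ 2 * (6 * e) := by gcongr
    linarith
  -- representatives
  have hw : ∃ w : Fin s → B, ∀ c : {c // Q c}, star (w c.1.1) * w c.1.1 = k c.1.1 := by
    refine ⟨fun i => if hi : ∃ c : {c // Q c}, c.1.1 = i then z hi.choose.1 else 0, fun c => ?_⟩
    have hi : ∃ c' : {c // Q c}, c'.1.1 = c.1.1 := ⟨c, rfl⟩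
    dsimp only
    rw [dif_pos hi, ho _ _ rfl, if_pos rfl, hi.choose_spec]
  obtain ⟨w, hw⟩ := hw
  refine ⟨{c // Q c}, Fin s, inferInstance, inferInstance, inferInstance, inferInstance,
    fun c => c.1.1, J, fun c => p * z c.1, w,
    fun b => Matrix.of fun c d => bdH s r (X (j b)) c.1 d.1, fun b c d hcd => ?_, fun c => ?_,
    fun i => ?_, ?_, fun b hb => ⟨?_, ?_⟩⟩
  · exact bdH_ne _ _ _ hcd
  · dsimp only
    rw [← mul_assoc, hpp]
  · dsimp only
    have e1 : star (rowM (fun c : {c // Q c} => if J c.1.1 = i then p * z c.1 else 0)) *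
        rowM (fun c : {c // Q c} => if J c.1.1 = i then p * z c.1 else 0) -
        dgM (ι := {c // Q c}) (D := B)
          (fun c => if J c.1.1 = i then star (w c.1.1) * w c.1.1 else 0) =
        star (rowM (fun c : {c // Q c} => if J c.1.1 = i then z c.1 else 0)) *
        rowM (fun c : {c // Q c} => if J c.1.1 = i then p * z c.1 - z c.1 else 0) := by
      rw [star_rowM_mul, star_rowM_mul]
      change _ - subMf _ = _
      ext u v
      cases u with
      | none => cases v <;> simp
      | some c =>
        cases v with
        | none => simp
        | some d =>
          rw [CStarMatrix.sub_apply]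
          simp only [subMf_ss]
          rw [hw]
          by_cases hc : J c.1.1 = i
          · by_cases hd : J d.1.1 = i
            · simp only [hc, hd, if_true]
              rw [star_mul, hps, mul_assoc, ← mul_assoc p, hpp, mul_sub, ho _ _ (hc.trans hd.symm)]
              simp only [Subtype.ext_iff]
            · have : c ≠ d := fun h => hd (h ▸ hc)
              simp [hd, this]
          · simp [hc]
    rw [e1]
    refine (norm_mul_le _ _).trans ?_
    rw [norm_star, norm_rowM, norm_rowM]
    have h1 := (rn_mask_le (fun c : {c // Q c} => z c.1) (fun c => J c.1.1 = i)).trans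
      ((rn_comp_le z (fun c : {c // Q c} => c.1) Subtype.val_injective).trans hzn)
    have h2 := (rn_mask_le (fun c : {c // Q c} => p * z c.1 - z c.1) (fun c => J c.1.1 = i)).trans hkeep
    have h3 := mul_le_mul h1 h2 (rn_nonneg _) (by norm_num)
    refine h3.trans ?_
    linarith
  · dsimp only
    have e1 : ∑ c : {c // Q c}, p * z c.1 * star (p * z c.1) - p =
        p * (∑ c, z c * star (z c) - 1) * p - ∑ c, (if Q c then 0 else p * z c) * star (if Q c then 0 else p * z c) := by
      rw [sum_sub_ite Q (fun c => p * z c * star (p * z c))]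
      have h5 : p * (∑ c, z c * star (z c) - 1) * p = ∑ c, p * z c * star (p * z c) - p := by
        rw [mul_sub, sub_mul, mul_one, hpp, Finset.mul_sum, Finset.sum_mul]
        congr 1
        refine Finset.sum_congr rfl fun c _ => ?_
        rw [star_mul, hps]; noncomm_ring
      rw [h5, sub_right_comm, ← Finset.sum_sub_distrib]
      congr 1
      refine Finset.sum_congr rfl fun c _ => ?_
      by_cases hc : Q c <;> simp [hc]
    rw [e1]
    have h1 : ‖p * (∑ c, z c * star (z c) - 1) * p‖ ≤ e := by
      calc _ ≤ ‖p‖ * ‖∑ c, z c * star (z c) - 1‖ * ‖p‖ := (norm_mul_le _ _).trans (by gcongr; exact norm_mul_le _ _)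
        _ ≤ 1 * e * 1 := by gcongr
        _ = e := by ring
    have h2 := norm_sum_mul_star_le (fun c => if Q c then 0 else p * z c) (fun c => if Q c then 0 else p * z c)
    have h3 := rn_nonneg (fun c => if Q c then 0 else p * z c)
    refine (norm_sub_le _ _).trans ?_
    nlinarith
  · refine (norm_submat_le Q _).trans ((norm_bdH_le _).trans ((hX _).trans ?_))
    rw [NonUnitalStarAlgHom.norm_map j hj]
  · have hjb : ‖j b‖ ≤ L := by rw [NonUnitalStarAlgHom.norm_map j hj]; exact hSL b hb
    have hpj : j b * p = j b := by rw [← hp1, ← map_mul, mul_one]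
    have hjp : p * j b = j b := by rw [← hp1, ← map_mul, one_mul]
    have e1 : (fun d : {c // Q c} => j b * (p * z d.1) - ∑ c : {c // Q c},
        (Matrix.of fun c d : {c // Q c} => bdH s r (X (j b)) c.1 d.1) c d • (p * z c.1)) =
        fun d : {c // Q c} => (p * (j b * z d.1 - ∑ c, bdH s r (X (j b)) c d.1 • z c)) +
          ∑ c, bdH s r (X (j b)) c d.1 • (if Q c then 0 else p * z c) := by
      funext d
      simp only [Matrix.of_apply]
      rw [sum_sub_ite Q (fun c => bdH s r (X (j b)) c d.1 • (p * z c)), ← mul_assoc, hpj, mul_sub, ← mul_assoc,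
        hjp, Finset.mul_sum, sub_add, ← Finset.sum_sub_distrib]
      congr 1
      refine Finset.sum_congr rfl fun c _ => ?_
      by_cases hc : Q c <;> simp [hc]
    rw [e1]
    refine (rn_add_le _ _).trans ?_
    have h1 := (rn_comp_le (fun d => p * (j b * z d - ∑ c, bdH s r (X (j b)) c d • z c))
      (fun c : {c // Q c} => c.1) Subtype.val_injective).trans (rn_mul_left p _)
    have h2 := (rn_comp_le (fun d => ∑ c, bdH s r (X (j b)) c d • (if Q c then 0 else p * z c))
      (fun c : {c // Q c} => c.1) Subtype.val_injective).trans (rn_mul_sc _ _)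
    have h3 : ‖bdH s r (X (j b))‖ ≤ L := (norm_bdH_le _).trans ((hX _).trans hjb)
    have h4 := mul_le_mul hdrop h3 (norm_nonneg _) (by positivity)
    have h5 := mul_le_mul hpn (hS (j b) (Finset.mem_image_of_mem _ hb)) (rn_nonneg _) zero_le_one
    linarith

theorem starP_finSat (n : ℕ) (B : CStarAlg) (h : FinSat (drClass n) B) : StarP n B.carrier := by
  induction h with
  | base hB => exact starP_of_DR n _ hB.2
  | iso _ hi ih => exact starP_iso n ih hi.some.symm
  | sum _ _ hi ih₁ ih₂ => exact starP_iso n (starP_prod n ih₁ ih₂) hi.some.symm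
  | matrix k _ hi ih => exact starP_matrix n k ih hi.some
  | corner p _ _ hpp hps hi ih =>
    obtain ⟨j, hj, hp1, hr⟩ := hi
    exact starP_corner n ih p hpp hps j hj hp1 fun x hx => by
      have : x ∈ Set.range j := by rw [hr]; exact hx
      exact this

end Corner

/-! ### Transport along asymptotically multiplicative maps -/

section Asymp

theorem tz_mul_bdd {D : Type*} [NormedRing D] {u v : ℕ → D} {M : ℝ} (hu : Tendsto u atTop (𝓝 0))
    (hv : ∀ t, ‖v t‖ ≤ M) : Tendsto (fun t => u t * v t) atTop (𝓝 0) := by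
  refine squeeze_zero_norm (a := fun t => ‖u t‖ * M) (fun t => (norm_mul_le _ _).trans ?_) ?_
  · exact mul_le_mul_of_nonneg_left (hv t) (norm_nonneg _)
  · simpa using hu.norm.mul_const M

theorem tz_bdd_mul {D : Type*} [NormedRing D] {u v : ℕ → D} {M : ℝ} (hu : Tendsto u atTop (𝓝 0))
    (hv : ∀ t, ‖v t‖ ≤ M) : Tendsto (fun t => v t * u t) atTop (𝓝 0) := by
  refine squeeze_zero_norm (a := fun t => M * ‖u t‖) (fun t => (norm_mul_le _ _).trans ?_) ?_
  · exact mul_le_mul_of_nonneg_right (hv t) (norm_nonneg _)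
  · simpa using hu.norm.const_mul M

theorem subMf_tendsto {ι D : Type*} [Fintype ι] [DecidableEq ι] [CStarAlgebra D] [PartialOrder D]
    [StarOrderedRing D] (f : ℕ → ι → ι → D) (h : ∀ c d, Tendsto (fun t => f t c d) atTop (𝓝 0)) :
    Tendsto (fun t => subMf (f t)) atTop (𝓝 0) := by
  have h1 : Tendsto (fun t => (CStarMatrix.ofMatrix.symm (subMf (f t)) : Matrix (Option ι) (Option ι) D))
      atTop (𝓝 0) := by
    refine tendsto_pi_nhds.2 fun u => tendsto_pi_nhds.2 fun v => ?_
    cases u with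
    | none => exact tendsto_const_nhds
    | some c =>
      cases v with
      | none => exact tendsto_const_nhds
      | some d => exact h c d
  have h2 := ((CStarMatrix.ofMatrixL (m := Option ι) (n := Option ι) (A := D)).continuous.tendsto 0).comp h1
  rw [map_zero] at h2
  exact h2

theorem starP_asymp (n : ℕ) {D F : Type} [CStarAlgebra D] [CStarAlgebra F] (h : StarP n D)
    (i : F → D) (hi : ∀ b, ‖i b‖ ≤ ‖b‖) (β : ℕ → D →ₗ[ℂ] F) (K : ℝ) (hK0 : 0 ≤ K)
    (hK : ∀ t a, ‖β t a‖ ≤ K * ‖a‖)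
    (hst : ∀ a, Tendsto (fun t => star (β t a) - β t (star a)) atTop (𝓝 0))
    (hmul : ∀ a b, Tendsto (fun t => β t a * β t b - β t (a * b)) atTop (𝓝 0))
    (hone : Tendsto (fun t => β t 1 - 1) atTop (𝓝 0))
    (hmod : ∀ b a, Tendsto (fun t => b * β t a - β t (i b * a)) atTop (𝓝 0)) : StarP n F := by
  classical
  let _ := CStarAlgebra.spectralOrder F
  have _ := CStarAlgebra.spectralOrderedRing F
  have F1 : ∀ a b, Tendsto (fun t => star (β t a) * β t b - β t (star a * b)) atTop (𝓝 0) := fun a b => by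
    have := (tz_mul_bdd (hst a) (fun t => hK t b)).add (hmul (star a) b)
    rw [add_zero] at this
    refine this.congr fun t => ?_
    noncomm_ring
  have F2 : ∀ a b, Tendsto (fun t => β t a * star (β t b) - β t (a * star b)) atTop (𝓝 0) := fun a b => by
    have := (tz_bdd_mul (hst b) (fun t => hK t a)).add (hmul a (star b))
    rw [add_zero] at this
    refine this.congr fun t => ?_
    noncomm_ring
  have F3 : ∀ (u : ℕ → F) (a : D) (η : ℝ), Tendsto (fun t => u t - β t a) atTop (𝓝 0) → K * ‖a‖ < η →
      ∀ᶠ t in atTop, ‖u t‖ ≤ η := fun u a η hu hη => by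
    have h1 : ∀ᶠ t in atTop, ‖u t - β t a‖ < η - K * ‖a‖ := by
      have := hu.norm
      rw [norm_zero] at this
      exact this.eventually (gt_mem_nhds (by linarith))
    filter_upwards [h1] with t ht
    have := norm_sub_norm_le (u t) (β t a)
    have := hK t a
    linarith
  refine lemmaQ n (NonUnitalStarAlgHom.id ℂ F) (fun _ _ h => h) 1 rfl (fun x _ => ⟨x, rfl⟩) fun S ε hε => ?_
  obtain ⟨e, he0, he1, he2, he3⟩ : ∃ e : ℝ, 0 < e ∧ e ≤ 1 ∧ K * e < ε ∧ K * e ^ 2 < ε ^ 2 := by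
    have hm : 0 < min ε (ε ^ 2) := by positivity
    refine ⟨min 1 (min ε (ε ^ 2) / (K + 1)), by positivity, min_le_left _ _, ?_⟩
    set e := min 1 (min ε (ε ^ 2) / (K + 1)) with he
    have h0 : 0 < e := by positivity
    have h1 : e ≤ 1 := min_le_left _ _
    have h2 : (K + 1) * e ≤ min ε (ε ^ 2) := by
      rw [← le_div_iff₀' (by positivity)]; exact min_le_right _ _
    have h3 := min_le_left ε (ε ^ 2)
    have h4 := min_le_right ε (ε ^ 2)
    constructor <;> nlinarith [mul_nonneg hK0 h0.le]
  obtain ⟨s, r, J, y, k, ψ, δ, hcp, h1, ho, hsum, hδ0, hδ1, -, hS⟩ := starR_of_starP n h (S.image i) e he0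
  have hψ : ∀ b, ‖ψ b‖ ≤ ‖b‖ := fun b => ucp_norm_le ψ hcp (by rw [h1]; exact norm_FD_one_le) b
  have hw : ∃ w : Fin s → D, ∀ c : (Σ i, Fin (r i)), star (w c.1) * w c.1 = k c.1 := by
    refine ⟨fun i => if hi : ∃ c : (Σ i, Fin (r i)), c.1 = i then y hi.choose else 0, fun c => ?_⟩
    have hi : ∃ c' : (Σ i, Fin (r i)), c'.1 = c.1 := ⟨c, rfl⟩
    dsimp only
    rw [dif_pos hi, ho _ _ rfl, if_pos rfl, hi.choose_spec]
  obtain ⟨w, hw⟩ := hw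
  have E1 : ∀ l, ∀ᶠ t in atTop, ‖star (rowM (fun c : (Σ i, Fin (r i)) => if J c.1 = l then β t (y c) else 0)) *
      rowM (fun c : (Σ i, Fin (r i)) => if J c.1 = l then β t (y c) else 0) -
      dgM (ι := (Σ i, Fin (r i))) (D := F)
        (fun c => if J c.1 = l then star (β t (w c.1)) * β t (w c.1) else 0)‖ ≤ ε := by
    intro l
    have e1 : ∀ t, star (rowM (fun c : (Σ i, Fin (r i)) => if J c.1 = l then β t (y c) else 0)) *
      rowM (fun c : (Σ i, Fin (r i)) => if J c.1 = l then β t (y c) else 0) -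
      dgM (ι := (Σ i, Fin (r i))) (D := F)
        (fun c => if J c.1 = l then star (β t (w c.1)) * β t (w c.1) else 0) =
        subMf (fun c d => if J c.1 = l ∧ J d.1 = l then star (β t (y c)) * β t (y d) -
          (if c = d then star (β t (w c.1)) * β t (w c.1) else 0) else 0) := by
      intro t
      rw [star_rowM_mul]
      change _ - subMf _ = _
      ext u v
      cases u with
      | none => cases v <;> simp
      | some c =>
        cases v with
        | none => simp
        | some d =>
          rw [CStarMatrix.sub_apply]
          simp only [subMf_ss]
          by_cases hc : J c.1 = l
          · by_cases hd : J d.1 = l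
            · simp [hc, hd]
            · have : c ≠ d := fun h => hd (h ▸ hc)
              simp [hd, this]
          · simp [hc]
    simp only [e1]
    have h2 := (subMf_tendsto (fun t (c d : (Σ i, Fin (r i))) => if J c.1 = l ∧ J d.1 = l then star (β t (y c)) * β t (y d) -
          (if c = d then star (β t (w c.1)) * β t (w c.1) else 0) else 0) fun c d => by
      by_cases hcd : J c.1 = l ∧ J d.1 = l
      · simp only [hcd, and_self, if_true]
        have h3 := F1 (y c) (y d)
        rw [ho c d (hcd.1.trans hcd.2.symm)] at h3
        by_cases h4 : c = d
        · simp only [h4, if_true] at h3 ⊢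
          have h5 := h3.sub (F1 (w d.1) (w d.1))
          rw [hw, sub_zero] at h5
          refine h5.congr fun t => ?_
          abel
        · simpa only [h4, if_false, map_zero] using h3
      · simp only [hcd, if_false]; exact tendsto_const_nhds).norm
    rw [norm_zero] at h2
    filter_upwards [h2.eventually (gt_mem_nhds hε)] with t ht using ht.le
  have E2 : ∀ᶠ t in atTop, ‖∑ c, β t (y c) * star (β t (y c)) - 1‖ ≤ ε := by
    refine F3 _ (∑ c, y c * star (y c) - 1) ε ?_ (lt_of_le_of_lt (by gcongr) he2)
    have h2 := (tendsto_finsetSum Finset.univ fun c _ => F2 (y c) (y c)).add hone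
    rw [Finset.sum_const_zero, add_zero] at h2
    refine h2.congr fun t => ?_
    simp only [Finset.sum_sub_distrib, map_sub, map_sum]
    abel
  have E3 : ∀ b ∈ S, ∀ᶠ t in atTop, rn (fun d => b * β t (y d) - ∑ c, bdH s r (ψ (i b)) c d • β t (y c)) ≤ ε := by
    intro b hb
    set R := fun d => i b * y d - ∑ c, bdH s r (ψ (i b)) c d • y c with hR
    have hRn : rn R ≤ e := (hS (i b) (Finset.mem_image_of_mem _ hb)).trans (by nlinarith)
    have hd : ∀ d, Tendsto (fun t => (b * β t (y d) - ∑ c, bdH s r (ψ (i b)) c d • β t (y c)) - β t (R d)) atTop (𝓝 0) := by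
      intro d
      refine (hmod b (y d)).congr fun t => ?_
      simp only [hR, map_sub, map_sum, map_smul]
      abel
    have hbd : ∀ d t, ‖(b * β t (y d) - ∑ c, bdH s r (ψ (i b)) c d • β t (y c))‖ ≤
        ‖b‖ * (K * ‖y d‖) + ∑ c, ‖bdH s r (ψ (i b)) c d‖ * (K * ‖y c‖) := by
      intro d t
      refine (norm_sub_le _ _).trans (add_le_add ?_ ?_)
      · exact (norm_mul_le _ _).trans (mul_le_mul_of_nonneg_left (hK _ _) (norm_nonneg _))
      · refine (norm_sum_le _ _).trans (Finset.sum_le_sum fun c _ => ?_)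
        rw [norm_smul]
        exact mul_le_mul_of_nonneg_left (hK _ _) (norm_nonneg _)
    have h2 : ∀ᶠ t in atTop, ‖∑ d, (b * β t (y d) - ∑ c, bdH s r (ψ (i b)) c d • β t (y c)) *
        star (b * β t (y d) - ∑ c, bdH s r (ψ (i b)) c d • β t (y c))‖ ≤ ε ^ 2 := by
      refine F3 _ (∑ d, R d * star (R d)) _ ?_ ?_
      · have h3 : ∀ d, Tendsto (fun t => (b * β t (y d) - ∑ c, bdH s r (ψ (i b)) c d • β t (y c)) *
            star (b * β t (y d) - ∑ c, bdH s r (ψ (i b)) c d • β t (y c)) - β t (R d * star (R d))) atTop (𝓝 0) := by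
          intro d
          have h4 := (hd d).star
          rw [star_zero] at h4
          have h5 := ((tz_bdd_mul h4 (hbd d)).add (tz_mul_bdd (hd d) (v := fun t => star (β t (R d)))
            (fun t => by rw [norm_star]; exact hK _ _))).add (F2 (R d) (R d))
          rw [add_zero, add_zero] at h5
          refine h5.congr fun t => ?_
          generalize b * β t (y d) - ∑ c, bdH s r (ψ (i b)) c d • β t (y c) = u
          rw [star_sub, mul_sub, sub_mul]
          abel
        have h6 := tendsto_finsetSum Finset.univ fun d _ => h3 d
        rw [Finset.sum_const_zero] at h6
        refine h6.congr fun t => ?_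
        rw [Finset.sum_sub_distrib, map_sum]
      · refine lt_of_le_of_lt ?_ he3
        rw [← rn_sq]
        have := rn_nonneg R
        gcongr
    filter_upwards [h2] with t ht
    rw [← rn_sq] at ht
    exact abs_le_of_sq_le_sq' ht hε.le |>.2
  have E4 : ∀ᶠ t in atTop, ∀ b ∈ S, rn (fun d => b * β t (y d) - ∑ c, bdH s r (ψ (i b)) c d • β t (y c)) ≤ ε :=
    (Filter.eventually_all_finset S).2 E3
  obtain ⟨t, ht1, ht2, ht3⟩ := ((Filter.eventually_all.2 E1).and (E2.and E4)).exists
  refine ⟨(Σ i, Fin (r i)), Fin s, inferInstance, inferInstance, inferInstance, inferInstance,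
    fun c => c.1, J, fun c => β t (y c), fun l => β t (w l), fun b => bdH s r (ψ (i b)),
    fun b c d hcd => bdH_ne _ _ _ hcd, fun c => one_mul _, ht1, ht2, fun b hb => ⟨?_, ht3 b hb⟩⟩
  exact (norm_bdH_le _).trans ((hψ _).trans (hi b))

end Asymp

/-! ### Rokhlin actions -/

section Rokhlin

theorem starP_fixed (n : ℕ) {D : Type} [CStarAlgebra D] (h : StarP n D) {G : Type} [Group G] [Fintype G]
    (α : G → (D →⋆ₐ[ℂ] D)) (hact : IsGroupAction α) (hRok : ActionHasRokhlin α)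
    [IsClosed (fixedPointAlgebra α : Set D)] : StarP n (fixedPointAlgebra α) := by
  classical
  obtain ⟨e, hbd, hid, hst, hcom, hsum, heq⟩ := hRok
  obtain ⟨ha1, ha2⟩ := hact
  replace hid : ∀ g, Tendsto (fun k => e g k * e g k - e g k) atTop (𝓝 0) :=
    fun g => tendsto_zero_iff_norm_tendsto_zero.2 (hid g)
  replace hst : ∀ g, Tendsto (fun k => star (e g k) - e g k) atTop (𝓝 0) :=
    fun g => tendsto_zero_iff_norm_tendsto_zero.2 (hst g)
  replace hcom : ∀ g a, Tendsto (fun k => e g k * a - a * e g k) atTop (𝓝 0) :=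
    fun g a => tendsto_zero_iff_norm_tendsto_zero.2 (hcom g a)
  replace hsum : Tendsto (fun k => (∑ g, e g k) - 1) atTop (𝓝 0) :=
    tendsto_zero_iff_norm_tendsto_zero.2 hsum
  replace heq : ∀ g h, Tendsto (fun k => α g (e h k) - e (g * h) k) atTop (𝓝 0) :=
    fun g h => tendsto_zero_iff_norm_tendsto_zero.2 (heq g h)
  choose M hM using hbd
  have hM0 : ∀ g, 0 ≤ M g := fun g => (norm_nonneg _).trans (hM g 0)
  have hMs : ∀ g k, ‖star (e g k)‖ ≤ M g := fun g k => by rw [norm_star]; exact hM g k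
  have hαn : ∀ g a, ‖α g a‖ ≤ ‖a‖ := fun g a => NonUnitalStarAlgHom.norm_apply_le (α g) a
  have hα : ∀ g (u : ℕ → D), Tendsto u atTop (𝓝 0) → Tendsto (fun t => α g (u t)) atTop (𝓝 0) := fun g u hu =>
    squeeze_zero_norm (fun t => hαn g (u t)) (by simpa using hu.norm)
  have cl : ∀ (u : ℕ → D) (b : D), Tendsto u atTop (𝓝 0) → Tendsto (fun t => u t * b) atTop (𝓝 0) :=
    fun u b hu => by simpa using hu.mul_const b
  have cr : ∀ (u : ℕ → D) (b : D), Tendsto u atTop (𝓝 0) → Tendsto (fun t => b * u t) atTop (𝓝 0) :=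
    fun u b hu => by simpa using hu.const_mul b
  -- asymptotic orthogonality
  have hss : ∀ g, Tendsto (fun k => star (e g k) * e g k - e g k) atTop (𝓝 0) := fun g => by
    have := (tz_mul_bdd (hst g) (hM g)).add (hid g)
    rw [add_zero] at this
    refine this.congr fun t => ?_
    noncomm_ring
  have horth : ∀ g h, h ≠ g → Tendsto (fun k => e h k * e g k) atTop (𝓝 0) := by
    intro g h hgh
    have a1 : ∀ h, Tendsto (fun k => star (e h k * e g k) * (e h k * e g k) - star (e g k) * e h k * e g k)
        atTop (𝓝 0) := fun h => by
      have := tz_mul_bdd (tz_bdd_mul (hss h) (hMs g)) (hM g)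
      refine this.congr fun t => ?_
      rw [star_mul]; noncomm_ring
    have a2 := tendsto_finsetSum Finset.univ fun h _ => a1 h
    have a3 := tz_mul_bdd (tz_bdd_mul hsum (hMs g)) (hM g)
    have a4 := tz_bdd_mul (hid g) (hMs g)
    have a5 := (a2.add a3).sub ((a1 g).add a4)
    rw [Finset.sum_const_zero, add_zero, sub_zero] at a5
    have a6 := a5.norm
    rw [norm_zero] at a6
    have a7 : ∀ k, ‖e h k * e g k‖ ^ 2 ≤ ‖∑ i, (star (e i k * e g k) * (e i k * e g k) -
        star (e g k) * e i k * e g k) + star (e g k) * (∑ g, e g k - 1) * e g k -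
        (star (e g k * e g k) * (e g k * e g k) - star (e g k) * e g k * e g k +
          star (e g k) * (e g k * e g k - e g k))‖ := by
      intro k
      let y : G → D := fun i => if i = g then 0 else star (e i k * e g k)
      have b1 := norm_le_rn y h
      have b2 : ‖y h‖ = ‖e h k * e g k‖ := by simp only [y]; rw [if_neg hgh, norm_star]
      rw [b2] at b1
      have b3 : ‖e h k * e g k‖ ^ 2 ≤ rn y ^ 2 := by gcongr
      rw [rn_sq] at b3
      refine b3.trans (le_of_eq ?_)
      congr 1
      have b4 : ∀ i, y i * star (y i) = star (e i k * e g k) * (e i k * e g k) -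
          if i = g then star (e i k * e g k) * (e i k * e g k) else 0 := by
        intro i
        simp only [y]
        by_cases hi : i = g
        · simp [hi]
        · rw [if_neg hi, if_neg hi, star_star, sub_zero]
      simp only [b4]
      rw [Finset.sum_sub_distrib, Finset.sum_ite_eq' Finset.univ g, if_pos (Finset.mem_univ _),
        Finset.sum_sub_distrib, ← Finset.sum_mul, ← Finset.mul_sum]
      noncomm_ring
    have a8 : Tendsto (fun k => ‖e h k * e g k‖ ^ 2) atTop (𝓝 0) :=
      squeeze_zero (fun k => by positivity) a7 a6
    have a9 := a8.sqrt
    simp only [Real.sqrt_sq (norm_nonneg _), Real.sqrt_zero] at a9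
    exact tendsto_zero_iff_norm_tendsto_zero.2 a9
  -- the averaging maps
  let γ : ℕ → D → D := fun t a => ∑ g, e g t * α g a
  have hmem : ∀ t a, (∑ g, α g (e 1 t * a)) ∈ fixedPointAlgebra α := by
    intro t a g
    rw [map_sum]
    simp only [ha2]
    exact Fintype.sum_equiv (Equiv.mulLeft g) _ _ fun x => rfl
  let β : ℕ → D →ₗ[ℂ] fixedPointAlgebra α := fun t =>
    { toFun := fun a => ⟨∑ g, α g (e 1 t * a), hmem t a⟩
      map_add' := fun a b => Subtype.ext (by
        simp only [mul_add, map_add, Finset.sum_add_distrib]; rfl)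
      map_smul' := fun c a => Subtype.ext (by
        simp only [mul_smul_comm, map_smul, ← Finset.smul_sum]; rfl) }
  have hβ : ∀ t a, (β t a : D) = ∑ g, α g (e 1 t * a) := fun _ _ => rfl
  have hβγ : ∀ a, Tendsto (fun t => (β t a : D) - γ t a) atTop (𝓝 0) := by
    intro a
    have := tendsto_finsetSum Finset.univ fun g _ => cl _ (α g a) (heq g 1)
    rw [Finset.sum_const_zero] at this
    refine this.congr fun t => ?_
    simp only [hβ, γ, ← Finset.sum_sub_distrib, map_mul, mul_one, sub_mul]
  have hγn : ∀ t a, ‖γ t a‖ ≤ (∑ g, M g) * ‖a‖ := by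
    intro t a
    refine (norm_sum_le _ _).trans ?_
    rw [Finset.sum_mul]
    exact Finset.sum_le_sum fun g _ => (norm_mul_le _ _).trans
      (mul_le_mul (hM g t) (hαn g a) (norm_nonneg _) (hM0 g))
  have hβn : ∀ t a, ‖(β t a : D)‖ ≤ (∑ _g : G, M 1) * ‖a‖ := by
    intro t a
    rw [hβ]
    refine (norm_sum_le _ _).trans ?_
    rw [Finset.sum_mul]
    exact Finset.sum_le_sum fun g _ => (hαn _ _).trans ((norm_mul_le _ _).trans
      (mul_le_mul_of_nonneg_right (hM 1 t) (norm_nonneg _)))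
  refine starP_asymp n h (fun b => (b : D)) (fun b => le_rfl) β (∑ _g : G, M 1)
    (Finset.sum_nonneg fun _ _ => hM0 1) hβn (fun a => ?_) (fun a b => ?_) ?_ (fun b a => ?_)
  · refine tendsto_subtype_rng.2 ?_
    change Tendsto (fun t => star (β t a : D) - (β t (star a) : D)) atTop (𝓝 0)
    have h1 := (hβγ a).star
    rw [star_zero] at h1
    have h2 := tendsto_finsetSum Finset.univ fun g _ =>
      (cr _ (star (α g a)) (hst g)).sub (hcom g (star (α g a)))
    have h3 := (h1.add h2).sub (hβγ (star a))
    simp only [sub_zero, Finset.sum_const_zero, add_zero] at h3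
    refine h3.congr fun t => ?_
    have h4 : ∑ g, (star (α g a) * (star (e g t) - e g t) - (e g t * star (α g a) - star (α g a) * e g t)) =
        star (γ t a) - γ t (star a) := by
      simp only [γ, star_sum, ← Finset.sum_sub_distrib]
      refine Finset.sum_congr rfl fun g _ => ?_
      rw [star_mul, map_star]; noncomm_ring
    rw [h4, star_sub]
    abel
  · refine tendsto_subtype_rng.2 ?_
    change Tendsto (fun t => (β t a : D) * (β t b : D) - (β t (a * b) : D)) atTop (𝓝 0)
    have h1 := tz_mul_bdd (hβγ a) (v := fun t => (β t b : D)) (fun t => hβn t b)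
    have h2 := tz_bdd_mul (hβγ b) (v := fun t => γ t a) (fun t => hγn t a)
    have h3 : ∀ g h, Tendsto (fun t => e g t * α g a * (e h t * α h b) -
        if g = h then e g t * α g (a * b) else 0) atTop (𝓝 0) := by
      intro g h
      have h4 := cl _ (α h b) (tz_bdd_mul (hcom h (α g a)) (hM g))
      by_cases hgh : g = h
      · subst hgh
        have h5 := (cl _ (α g a * α g b) (hid g)).sub h4
        rw [sub_zero] at h5
        refine h5.congr fun t => ?_
        rw [if_pos rfl, map_mul]; noncomm_ring
      · have h5 := (cl _ (α g a * α h b) (horth h g hgh)).sub h4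
        rw [sub_zero] at h5
        refine h5.congr fun t => ?_
        rw [if_neg hgh]; noncomm_ring
    have h6 := tendsto_finsetSum Finset.univ fun g _ => tendsto_finsetSum Finset.univ fun h _ => h3 g h
    have h7 := ((h1.add h2).add h6).sub (hβγ (a * b))
    simp only [sub_zero, Finset.sum_const_zero, add_zero] at h7
    refine h7.congr fun t => ?_
    have h8 : ∑ g, ∑ h, (e g t * α g a * (e h t * α h b) - if g = h then e g t * α g (a * b) else 0) =
        γ t a * γ t b - γ t (a * b) := by
      simp only [γ, Finset.sum_mul_sum, Finset.sum_sub_distrib, Finset.sum_ite_eq, Finset.mem_univ, if_true]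
    rw [h8]
    noncomm_ring
  · refine tendsto_subtype_rng.2 ?_
    change Tendsto (fun t => (β t 1 : D) - 1) atTop (𝓝 0)
    have h1 := (hβγ 1).add hsum
    rw [add_zero] at h1
    refine h1.congr fun t => ?_
    simp only [γ, map_one, mul_one]
    abel
  · refine tendsto_subtype_rng.2 ?_
    change Tendsto (fun t => (b : D) * (β t a : D) - (β t ((b : D) * a) : D)) atTop (𝓝 0)
    have h1 := tendsto_finsetSum Finset.univ fun g _ => hα g _ (cl _ a (hcom 1 (b : D)))
    have h2 := h1.neg
    rw [Finset.sum_const_zero, neg_zero] at h2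
    refine h2.congr fun t => ?_
    rw [hβ, hβ, Finset.mul_sum, ← Finset.sum_sub_distrib, ← Finset.sum_neg_distrib]
    refine Finset.sum_congr rfl fun g _ => ?_
    have hb : α g (b : D) = b := b.2 g
    nth_rewrite 3 [← hb]
    rw [← map_mul, ← map_sub, ← map_neg]
    congr 1
    noncomm_ring

end Rokhlin

open TopologicalSpace in
theorem stmt2 (n : ℕ) (A : Type) [CStarAlgebra A] [SeparableSpace A]
    (hA : IsUnitalLocalAlg (drClass n) A)
    (G : Type) [Group G] [Fintype G] (α : G → (A →⋆ₐ[ℂ] A))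
    (hact : IsGroupAction α) (hRok : ActionHasRokhlin α) :
    DecompositionRankLE n (fixedPointAlgebra α) := by
  have hP : StarP n A := starP_local n A fun S ε hε => by
    obtain ⟨B, hB, θ, hθ⟩ := hA S ε hε
    exact ⟨B, starP_finSat n B hB, θ, hθ⟩
  haveI : IsClosed (fixedPointAlgebra α : Set A) := by
    have e : (fixedPointAlgebra α : Set A) = ⋂ g, {a | α g a = a} := by
      ext a; rw [Set.mem_iInter]; rfl
    rw [e]
    refine isClosed_iInter fun g => isClosed_eq ?_ continuous_id
    exact AddMonoidHomClass.continuous_of_bound (α g) 1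
      (fun x => by simpa using NonUnitalStarAlgHom.norm_apply_le (α g) x)
  exact dr_of_starR n (starR_of_starP n (starP_fixed n hP α hact hRok))

end
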